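/- arXiv:1903.07196 — 2 statements merged into one kernel-verified Lean document; each statement's English description precedes it below -/
import Mathlib

section
/- Let Λ be a family of n pseudoplanes in general position in ℝ³ and let k be a nonnegative integer. Then the number |C^k| of k-corridors satisfies |C^k|³ ≤ 48 n⁸ + 64 n⁶; in particular, the complexity of the k-level of the arrangement of Λ is O(n^{8/3}). -/
open scoped Classical

noncomputable section

/-- A pseudoplane, identified with the total bivariate (curried) function whose graph it is. -/
abbrev PP : Type := ℝ → ℝ → ℝ

/-- `φ : ℝ → ℝ` is the continuous function whose graph is the xy-projection of the
intersection curve `γ_{a,b} = a ∩ b` of the pseudoplanes `a` and `b`. -/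
def IsGraphFun (a b : PP) (φ : ℝ → ℝ) : Prop :=
  Continuous φ ∧ ∀ x y : ℝ, a x y = b x y ↔ y = φ x

/-- A family of pseudoplanes in general position in ℝ³:
(1) each member is (the graph of) a continuous total bivariate function;
(2) the intersection of any two distinct members is the graph of a continuous
    function `φ_{a,b} : ℝ → ℝ` (a connected x-monotone unbounded curve);
(3) any three distinct members intersect in exactly one point;
(4) the xy-projections of the intersection curves form a family of pseudolines:
    for distinct pairs `{a,b} ≠ {c,d}`, `φ_{a,b}` and `φ_{c,d}` agree at exactly one point;
(5) no point is incident to more than three pseudoplanes;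
(6) no two pseudoplanes are tangent (the difference changes sign);
(7) no intersection curve of two pseudoplanes is tangent to a third pseudoplane
    (the relevant difference function takes both signs). -/
def PseudoplaneFamily (Λ : Finset PP) : Prop :=
  (∀ a ∈ Λ, Continuous fun q : ℝ × ℝ => a q.1 q.2) ∧
  (∀ a ∈ Λ, ∀ b ∈ Λ, a ≠ b → ∃ φ : ℝ → ℝ, IsGraphFun a b φ) ∧
  (∀ a ∈ Λ, ∀ b ∈ Λ, ∀ c ∈ Λ, a ≠ b → a ≠ c → b ≠ c →
    ∃! q : ℝ × ℝ, a q.1 q.2 = b q.1 q.2 ∧ a q.1 q.2 = c q.1 q.2) ∧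
  (∀ a ∈ Λ, ∀ b ∈ Λ, ∀ c ∈ Λ, ∀ d ∈ Λ, a ≠ b → c ≠ d → ({a, b} : Finset PP) ≠ {c, d} →
    ∀ φ ψ : ℝ → ℝ, IsGraphFun a b φ → IsGraphFun c d ψ → ∃! x : ℝ, φ x = ψ x) ∧
  (∀ a ∈ Λ, ∀ b ∈ Λ, ∀ c ∈ Λ, ∀ d ∈ Λ, a ≠ b → a ≠ c → a ≠ d → b ≠ c → b ≠ d → c ≠ d →
    ¬ ∃ x y : ℝ, a x y = b x y ∧ a x y = c x y ∧ a x y = d x y) ∧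
  (∀ a ∈ Λ, ∀ b ∈ Λ, a ≠ b → (∃ x y : ℝ, a x y < b x y) ∧ (∃ x y : ℝ, b x y < a x y)) ∧
  (∀ a ∈ Λ, ∀ b ∈ Λ, ∀ c ∈ Λ, a ≠ b → a ≠ c → b ≠ c → ∀ φ : ℝ → ℝ, IsGraphFun a b φ →
    (∃ x : ℝ, c x (φ x) < a x (φ x)) ∧ (∃ x : ℝ, a x (φ x) < c x (φ x)))

/-- The level of the point `(x, y, z)`: the number of members of `Λ` passing strictly below it. -/
def level (Λ : Finset PP) (x y z : ℝ) : ℕ :=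
  (Λ.filter fun a => a x y < z).card

/-- The triple `s = {a,b,c}` spans a `k`-corridor: its common (triple intersection) point
is at level `k`. -/
def IsKCorridorTriple (Λ : Finset PP) (k : ℕ) (s : Finset PP) : Prop :=
  ∃ x y z : ℝ, (∀ a ∈ s, a x y = z) ∧ level Λ x y z = k

/-- The set `C^k` of `k`-corridors, encoded by the 3-element subsets of `Λ` spanning them. -/
def kCorridors (Λ : Finset PP) (k : ℕ) : Finset (Finset PP) :=
  (Λ.powersetCard 3).filter (IsKCorridorTriple Λ k)

/-- The corridor of a triple `s`: the open region strictly between the lower and the upper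
envelope of the three surfaces in `s`. Points of ℝ³ are `(x, (y, z))`. -/
def corridorSet (s : Finset PP) : Set (ℝ × ℝ × ℝ) :=
  {p | (∃ a ∈ s, a p.1 p.2.1 < p.2.2) ∧ (∃ a ∈ s, p.2.2 < a p.1 p.2.1)}

/-- The common intersection curve of the members of `s`. -/
def curveSet (s : Finset PP) : Set (ℝ × ℝ × ℝ) :=
  {p | ∀ a ∈ s, a p.1 p.2.1 = p.2.2}

/-- The corridor spanned by `s₁` is immersed in the corridor spanned by `s₂`: they share
exactly one pseudoplane, and the intersection curve of the other two pseudoplanes of `s₁`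
is fully contained in the corridor of `s₂`. -/
def Immersed (s₁ s₂ : Finset PP) : Prop :=
  (s₁ ∩ s₂).card = 1 ∧ curveSet (s₁ \ s₂) ⊆ corridorSet s₂

/-- `X^k`: the number of ordered pairs of `k`-corridors such that the first is immersed
in the second. -/
def numImmersedPairs (Λ : Finset PP) (k : ℕ) : ℕ :=
  ((kCorridors Λ k ×ˢ kCorridors Λ k).filter fun q => Immersed q.1 q.2).card

set_option linter.all false
set_option linter.unusedSimpArgs false

section PartA

/-- Combinatorial data of a (sign-oriented) rank three configuration. -/
structure ChiAx {α : Type*} (R : α → α → Prop) (χ : α → α → α → Prop) : Prop where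
  anti : ∀ u v, u ≠ v → (R u v ↔ ¬ R v u)
  sw : ∀ u v w, u ≠ v → u ≠ w → v ≠ w → (χ u v w ↔ ¬ χ v u w)
  cyc : ∀ u v w, u ≠ v → u ≠ w → v ≠ w → (χ u v w ↔ χ v w u)
  g1 : ∀ u b c d, u ≠ b → u ≠ c → u ≠ d → b ≠ c → b ≠ d → c ≠ d →
    ((χ u b c ↔ R u d) ↔ ¬ (χ u b d ↔ R u c)) → ((χ u b c ↔ R u d) ↔ (χ u c d ↔ R u b)) → False
  g2 : ∀ b c d e, b ≠ c → b ≠ d → b ≠ e → c ≠ d → c ≠ e → d ≠ e →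
    ((R b c ↔ R d e) ↔ ¬ (R b d ↔ R c e)) → ((R b c ↔ R d e) ↔ (R b e ↔ R c d)) → False
  g3 : ∀ u b c d e, u ≠ b → u ≠ c → u ≠ d → u ≠ e → b ≠ c → b ≠ d → b ≠ e → c ≠ d → c ≠ e → d ≠ e →
    ((χ u b c ↔ χ u d e) ↔ ¬ (χ u b d ↔ χ u c e)) →
    ((χ u b c ↔ χ u d e) ↔ (χ u b e ↔ χ u c d)) → False

def NoCross {α : Type*} (χ : α → α → α → Prop) (D : α → α → Prop) : Prop :=
  ∀ b c d e, D b c → D d e → b ≠ c → b ≠ d → b ≠ e → c ≠ d → c ≠ e → d ≠ e →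
    ¬ ((χ b c d ↔ ¬ χ b c e) ∧ (χ d e b ↔ ¬ χ d e c) ∧ (χ b c d ↔ χ d e c))

section
variable {α : Type*} {R : α → α → Prop} {χ : α → α → α → Prop} {D : α → α → Prop}

theorem ChiAx.mirror (h : ChiAx R χ) : ChiAx R (fun u v w => ¬ χ u v w) where
  anti := h.anti
  sw u v w h1 h2 h3 := by have := h.sw u v w h1 h2 h3; tauto
  cyc u v w h1 h2 h3 := by have := h.cyc u v w h1 h2 h3; tauto
  g1 u b c d h1 h2 h3 h4 h5 h6 := by
    have := h.g1 u b c d h1 h2 h3 h4 h5 h6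
    clear h1 h2 h3 h4 h5 h6 h
    grind
  g2 := h.g2
  g3 u b c d e h1 h2 h3 h4 h5 h6 h7 h8 h9 h10 := by
    have := h.g3 u b c d e h1 h2 h3 h4 h5 h6 h7 h8 h9 h10
    simpa only [not_iff_not] using this

theorem NoCross.mirror (h : NoCross χ D) : NoCross (fun u v w => ¬ χ u v w) D := by
  intro b c d e h1 h2 h3 h4 h5 h6 h7 h8
  have := h b c d e h1 h2 h3 h4 h5 h6 h7 h8
  tauto

theorem ChiAx.trans (h : ChiAx R χ) {u b c d : α} (hub : u ≠ b) (huc : u ≠ c) (hud : u ≠ d)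
    (hbc : b ≠ c) (hcd : c ≠ d) (h1 : R u b) (h2 : R u c) (h3 : R u d) (h4 : R b c)
    (h5 : R c d) : R b d := by
  have hbd : b ≠ d := by rintro rfl; have := h.anti b c hbc; tauto
  have := h.g2 u b c d hub huc hud hbc hbd hcd
  tauto

theorem ChiAx.ctrans (h : ChiAx R χ) {u b c d : α} (hub : u ≠ b) (huc : u ≠ c) (hud : u ≠ d)
    (hbc : b ≠ c) (hcd : c ≠ d) (h1 : R u b) (h2 : R u c) (h3 : R u d) (h4 : χ u b c)
    (h5 : χ u c d) : χ u b d := by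
  have hbd : b ≠ d := by
    rintro rfl
    have := h.sw u b c hub huc hbc
    have := h.cyc u b c hub huc hbc
    have := h.cyc u c b huc hub hbc.symm
    have := h.sw b u c hub.symm hbc huc
    have := h.cyc b u c hub.symm hbc huc
    have := h.cyc c b u hbc.symm huc.symm hub.symm
    tauto
  have := h.g1 u b c d hub huc hud hbc hbd hcd
  tauto

/-- swapping the last two arguments -/
theorem ChiAx.sw2 (h : ChiAx R χ) {u v w : α} (h1 : u ≠ v) (h2 : u ≠ w) (h3 : v ≠ w) :
    χ u v w ↔ ¬ χ u w v := by
  have := h.cyc u v w h1 h2 h3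
  have := h.sw v w u h3 h1.symm h2.symm
  have := h.cyc w v u h3.symm h2.symm h1.symm
  have := h.cyc u w v h2 h1 h3.symm
  have := h.cyc w v u h3.symm h2.symm h1.symm
  have := h.cyc v u w h1.symm h3 h2
  tauto

theorem ChiAx.perm (h : ChiAx R χ) {u v w : α} (h1 : u ≠ v) (h2 : u ≠ w) (h3 : v ≠ w) :
    (χ v w u ↔ χ u v w) ∧ (χ w u v ↔ χ u v w) ∧ (χ v u w ↔ ¬ χ u v w) ∧ (χ u w v ↔ ¬ χ u v w) ∧
    (χ w v u ↔ ¬ χ u v w) := by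
  have a := h.cyc u v w h1 h2 h3
  have b := h.cyc v w u h3 h1.symm h2.symm
  have c := h.sw u v w h1 h2 h3
  have d := h.cyc v u w h1.symm h3 h2
  have e := h.cyc u w v h2 h1 h3.symm
  clear h1 h2 h3 h
  tauto

/-- two edges through a common longitude interval whose order changes must cross;
the common right end of the interval is `v`, an endpoint of the first edge. -/
theorem ChiAx.keyT (h : ChiAx R χ) (hn : NoCross χ D) {u v u' p : α}
    (huv : u ≠ v) (huu : u ≠ u') (hup : u ≠ p) (hvu : v ≠ u') (hvp : v ≠ p) (hu'p : u' ≠ p)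
    (e1 : D u v) (e2 : D u' p) (r1 : R u u') (r2 : R u' v) (r3 : R v p) (r4 : R u v) (r5 : R u' p)
    (c1 : ¬ χ u v u') (c2 : ¬ χ u' p v) : False := by
  have hc := hn u v u' p e1 e2 huv huu hup hvu hvp hu'p
  obtain ⟨s1, s2, s3, s4, s5⟩ := h.perm huv huu hvu
  obtain ⟨t1, t2, t3, t4, t5⟩ := h.perm hu'p hvu.symm hvp.symm
  obtain ⟨w1, w2, w3, w4, w5⟩ := h.perm hu'p huu.symm hup.symm
  obtain ⟨y1, y2, y3, y4, y5⟩ := h.perm huv hup hvp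
  have a1 := h.anti u v huv
  have a2 := h.anti u u' huu
  have a3 := h.anti u p hup
  have a4 := h.anti u' v hvu.symm
  have a5 := h.anti v p hvp
  have a6 := h.anti u' p hu'p
  have g1 := h.g1 u v u' p huv huu hup hvu hvp hu'p
  have g2 := h.g1 u' u v p huu.symm hvu.symm hu'p huv hup hvp
  have g3 := h.g1 v u u' p huv.symm hvu hvp huu hup hu'p
  have g4 := h.g1 p u u' v hup.symm hu'p.symm hvp.symm huu huv hvu.symm
  clear hn h
  grind

theorem ChiAx.keyT2 (h : ChiAx R χ) (hn : NoCross χ D) {u v u' p : α}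
    (huv : u ≠ v) (huu : u ≠ u') (hup : u ≠ p) (hvu : v ≠ u') (hvp : v ≠ p) (hu'p : u' ≠ p)
    (e1 : D u p) (e2 : D u' v) (r1 : R u u') (r2 : R u' v) (r3 : R v p) (r4 : R u v) (r5 : R u p)
    (c1 : ¬ χ u p v) (c2 : χ u p u') : False := by
  have hc := hn u p u' v e1 e2 hup huu huv hu'p.symm hvp.symm hvu.symm
  obtain ⟨s1, s2, s3, s4, s5⟩ := h.perm huv huu hvu
  obtain ⟨t1, t2, t3, t4, t5⟩ := h.perm hu'p hvu.symm hvp.symm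
  obtain ⟨w1, w2, w3, w4, w5⟩ := h.perm hu'p huu.symm hup.symm
  obtain ⟨y1, y2, y3, y4, y5⟩ := h.perm huv hup hvp
  have a1 := h.anti u v huv
  have a2 := h.anti u u' huu
  have a3 := h.anti u p hup
  have a4 := h.anti u' v hvu.symm
  have a5 := h.anti v p hvp
  have a6 := h.anti u' p hu'p
  have g1 := h.g1 u v u' p huv huu hup hvu hvp hu'p
  have g2 := h.g1 u' u v p huu.symm hvu.symm hu'p huv hup hvp
  have g3 := h.g1 v u u' p huv.symm hvu hvp huu hup hu'p
  have g4 := h.g1 p u u' v hup.symm hu'p.symm hvp.symm huu huv hvu.symm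
  clear hn h
  grind

theorem ChiAx.keyZ0 (h : ChiAx R χ) {u u' w p : α}
    (huu : u ≠ u') (huw : u ≠ w) (hup : u ≠ p) (hu'w : u' ≠ w) (hu'p : u' ≠ p) (hwp : w ≠ p)
    (r1 : R u u') (r2 : R u w) (r3 : R u' w) (r4 : R w p) (r5 : R u p)
    (c1 : ¬ χ u p w) (c2 : χ u' p w) (c3 : χ u p u') : False := by
  obtain ⟨s1, s2, s3, s4, s5⟩ := h.perm huw huu hu'w.symm
  obtain ⟨t1, t2, t3, t4, t5⟩ := h.perm hu'p hu'w hwp.symm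
  obtain ⟨w1, w2, w3, w4, w5⟩ := h.perm hu'p huu.symm hup.symm
  obtain ⟨y1, y2, y3, y4, y5⟩ := h.perm huw hup hwp
  have a1 := h.anti u w huw
  have a2 := h.anti u u' huu
  have a3 := h.anti u p hup
  have a4 := h.anti u' w hu'w
  have a5 := h.anti w p hwp
  have a6 := h.anti u' p hu'p
  have g1 := h.g1 u w u' p huw huu hup hu'w.symm hwp hu'p
  have g2 := h.g1 u' u w p huu.symm hu'w hu'p huw hup hwp
  have g3 := h.g1 w u u' p huw.symm hu'w.symm hwp huu hup hu'p
  have g4 := h.g1 p u u' w hup.symm hu'p.symm hwp.symm huu huw hu'w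
  clear h
  grind

set_option maxHeartbeats 1000000 in
theorem ChiAx.keyZ (h : ChiAx R χ) (hn : NoCross χ D) {u u' w p q : α}
    (huu : u ≠ u') (huw : u ≠ w) (hup : u ≠ p) (hu'w : u' ≠ w) (hwp : w ≠ p)
    (hu'q : u' ≠ q) (hwq : w ≠ q)
    (e1 : D u p) (e2 : D u' q)
    (r1 : R u u') (r2 : R u w) (r3 : R u' w) (r4 : R w p) (r5 : R u p) (r6 : R w q) (r7 : R u' q)
    (c1 : ¬ χ u p w) (c2 : χ u' q w) (c3 : χ u p u') : False := by
  have hu'p : u' ≠ p := by rintro rfl; exact ((h.anti _ _ hwp).1 r4) r3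
  have huq : u ≠ q := by rintro rfl; exact ((h.anti _ _ hwq).1 r6) r2
  by_cases hpq : p = q
  · subst hpq
    exact h.keyZ0 huu huw hup hu'w hu'p hwp r1 r2 r3 r4 r5 c1 c2 c3
  have r8 : R u' p := h.trans huu huw hup hu'w hwp r1 r2 r5 r3 r4
  have hc := hn u p u' q e1 e2 hup huu huq hu'p.symm hpq hu'q
  have a1 := (h.anti u u' huu).1 r1
  have a2 := (h.anti u w huw).1 r2
  have a3 := (h.anti u p hup).1 r5
  have a4 := (h.anti u' w hu'w).1 r3
  have a5 := (h.anti w p hwp).1 r4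
  have a6 := (h.anti u' p hu'p).1 r8
  have a7 := (h.anti w q hwq).1 r6
  have a8 := (h.anti u' q hu'q).1 r7
  have a9 := h.anti u q huq
  have a10 := h.anti p q hpq
  obtain ⟨s1, s2, s3, s4, s5⟩ := h.perm huu huw hu'w
  obtain ⟨t1, t2, t3, t4, t5⟩ := h.perm huu hup hu'p
  obtain ⟨w1, w2, w3, w4, w5⟩ := h.perm huu huq hu'q
  obtain ⟨y1, y2, y3, y4, y5⟩ := h.perm huw hup hwp
  obtain ⟨b1, b2, b3, b4, b5⟩ := h.perm huw huq hwq
  obtain ⟨d1, d2, d3, d4, d5⟩ := h.perm hup huq hpq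
  obtain ⟨f1, f2, f3, f4, f5⟩ := h.perm hu'w hu'p hwp
  obtain ⟨k1, k2, k3, k4, k5⟩ := h.perm hu'w hu'q hwq
  obtain ⟨l1, l2, l3, l4, l5⟩ := h.perm hu'p hu'q hpq
  obtain ⟨m1, m2, m3, m4, m5⟩ := h.perm hwp hwq hpq
  have G : ∀ a b c d, a ≠ b → a ≠ c → a ≠ d → b ≠ c → b ≠ d → c ≠ d →
    (((χ a b c ↔ R a d) ↔ ¬ (χ a b d ↔ R a c)) →
      ((χ a b c ↔ R a d) ↔ (χ a c d ↔ R a b)) → False) := h.g1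
  have g1 := G u u' w p huu huw hup hu'w hu'p hwp
  have g6 := G u' u w q huu.symm hu'w hu'q huw huq hwq
  have g9 := G w u u' p huw.symm hu'w.symm hwp huu hup hu'p
  have g10 := G w u u' q huw.symm hu'w.symm hwq huu huq hu'q
  have g13 := h.g3 u u' w p q huu huw hup huq hu'w hu'p hu'q hwp hwq hpq
  have g14 := h.g3 u' u w p q huu.symm hu'w hu'p hu'q huw hup huq hwp hwq hpq
  simp only [s1,s2,s3,s4,s5,t1,t2,t3,t4,t5,w1,w2,w3,w4,w5,y1,y2,y3,y4,y5,b1,b2,b3,b4,b5,d1,d2,d3,d4,d5,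
    f1,f2,f3,f4,f5,k1,k2,k3,k4,k5,l1,l2,l3,l4,l5,m1,m2,m3,m4,m5,
    r1,r2,r3,r4,r5,r6,r7,r8,a1,a2,a3,a4,a5,a6,a7,a8,not_not, not_true_eq_false, iff_true, iff_false, true_iff, false_iff] at c1 c2 c3 hc g1 g6 g9 g10 g13 g14
  clear s1 s2 s3 s4 s5 t1 t2 t3 t4 t5 w1 w2 w3 w4 w5 y1 y2 y3 y4 y5 b1 b2 b3 b4 b5 d1 d2 d3 d4 d5
  clear f1 f2 f3 f4 f5 k1 k2 k3 k4 k5 l1 l2 l3 l4 l5 m1 m2 m3 m4 m5 G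
  clear hn h hu'p huq hpq r8 a1 a2 a3 a4 a5 a6 a7 a8 a9 a10 r1 r2 r3 r4 r5 r6 r7 huu huw hup hu'w hwp hu'q hwq e1 e2
  simp only [c1, c2, c3, true_iff, false_iff, iff_true, iff_false, not_not, not_false_eq_true] at hc g1 g6 g9 g10 g13 g14
  clear c1 c2 c3
  by_cases x1 : χ u u' w <;> by_cases x2 : χ u u' q <;> by_cases x3 : χ u' p q <;>
    by_cases x4 : χ u p q <;> by_cases x5 : χ u w q <;> by_cases x6 : χ u' w p <;>
    simp only [x1, x2, x3, x4, x5, x6, true_iff, false_iff, iff_true, iff_false, not_true_eq_false, not_false_eq_true, true_imp_iff, imp_false, and_true, true_and, and_false, false_and, false_imp_iff, not_not, iff_self] at hc g1 g6 g9 g10 g13 g14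

def InK (R : α → α → Prop) (χ : α → α → α → Prop) (u v p w : α) : Prop :=
  u ≠ w ∧ R u w ∧ (w = v ∨ (w ≠ v ∧ R w v ∧ χ u v w)) ∧ (w = p ∨ (w ≠ p ∧ R w p ∧ ¬ χ u p w))

structure Wedge (R : α → α → Prop) (χ : α → α → α → Prop) (D : α → α → Prop) (u v p w : α) :
    Prop where
  d1 : D u v
  d2 : D u p
  n1 : u ≠ v
  n2 : u ≠ p
  n3 : v ≠ p
  r1 : R u v
  r2 : R u p
  c : χ u v p
  k : InK R χ u v p w
  m : ∀ w', InK R χ u v p w' → w' ≠ w → ¬ R w' w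

theorem InK.mirror {u v p w : α} (hk : InK R χ u v p w) :
    InK R (fun u v w => ¬ χ u v w) u p v w := by
  unfold InK at *
  simp only [not_not]
  tauto

theorem Wedge.mirror (h : ChiAx R χ) {u v p w : α} (hw : Wedge R χ D u v p w) :
    Wedge R (fun u v w => ¬ χ u v w) D u p v w := by
  refine ⟨hw.d2, hw.d1, hw.n2, hw.n1, hw.n3.symm, hw.r2, hw.r1, ?_, hw.k.mirror, ?_⟩
  · have := h.perm hw.n1 hw.n2 hw.n3
    have := hw.c
    tauto
  · intro w' hk
    have := InK.mirror hk
    simp only [not_not] at this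
    exact hw.m w' this

theorem Wedge.t1 (h : ChiAx R χ) (hn : NoCross χ D) {u v p u' p' : α}
    (h1 : Wedge R χ D u v p v) (h2 : Wedge R χ D u' v p' v) : u = u' := by
  by_contra huu
  wlog r : R u u' generalizing u u' p p'
  · exact this h2 h1 (Ne.symm huu) (by have := h.anti u u' huu; tauto)
  have rvp : R v p ∧ ¬ χ u p v := by have := h1.k.2.2.2; have := h1.n3; tauto
  have rvp' : R v p' ∧ ¬ χ u' p' v := by have := h2.k.2.2.2; have := h2.n3; tauto
  have hu'p : u' ≠ p := by rintro rfl; exact (h.anti _ _ h1.n3).1 rvp.1 h2.r1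
  have hup' : u ≠ p' := by rintro rfl; exact (h.anti _ _ h2.n3).1 rvp'.1 h1.r1
  by_cases c : χ u v u'
  · by_cases c2 : χ u p u'
    · exact h.keyT2 hn h1.n1 huu h1.n2 h2.n1.symm h1.n3 hu'p h1.d2 h2.d1 r h2.r1 rvp.1 h1.r1 h1.r2
        rvp.2 c2
    · refine h1.m u' ⟨huu, r, Or.inr ⟨h2.n1, h2.r1, c⟩, Or.inr ⟨hu'p, ?_, c2⟩⟩ h2.n1 h2.r1
      exact h.trans huu h1.n1 h1.n2 h2.n1 h1.n3 r h1.r1 h1.r2 h2.r1 rvp.1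
  · exact h.keyT hn h1.n1 huu hup' h2.n1.symm h2.n3 h2.n2 h1.d1 h2.d2 r h2.r1 rvp'.1 h1.r1 h2.r2
      c rvp'.2

theorem Wedge.t3 (h : ChiAx R χ) (hn : NoCross χ D) {u v p u' v' p' w : α}
    (h1 : Wedge R χ D u v p w) (h2 : Wedge R χ D u' v' p' w) (n1 : w ≠ v) (n2 : w ≠ p)
    (n3 : w ≠ v') (n4 : w ≠ p') : u = u' := by
  by_contra huu
  wlog r : R u u' generalizing u u' p p' v v'
  · exact this h2 h1 n3 n4 n1 n2 (Ne.symm huu) (by have := h.anti u u' huu; tauto)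
  obtain ⟨huw, ruw, kv, kp⟩ := h1.k
  obtain ⟨hu'w, ru'w, kv', kp'⟩ := h2.k
  obtain ⟨-, rwv, cv⟩ := kv.resolve_left n1
  obtain ⟨-, rwp, cp⟩ := kp.resolve_left n2
  obtain ⟨-, rwv', cv'⟩ := kv'.resolve_left n3
  obtain ⟨-, rwp', cp'⟩ := kp'.resolve_left n4
  have hu'p : u' ≠ p := by rintro rfl; exact (h.anti _ _ n2).1 rwp ru'w
  have hu'v : u' ≠ v := by rintro rfl; exact (h.anti _ _ n1).1 rwv ru'w
  have ru'v : R u' v := h.trans huu huw h1.n1 hu'w n1 r ruw h1.r1 ru'w rwv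
  have ru'p : R u' p := h.trans huu huw h1.n2 hu'w n2 r ruw h1.r2 ru'w rwp
  by_cases c1 : χ u p u'
  · exact h.keyZ hn huu huw h1.n2 hu'w n2 h2.n1 n3 h1.d2 h2.d1 r ruw ru'w rwp h1.r2 rwv' h2.r1
      cp cv' c1
  by_cases c2 : χ u v u'
  · exact h1.m u' ⟨huu, r, Or.inr ⟨hu'v, ru'v, c2⟩, Or.inr ⟨hu'p, ru'p, c1⟩⟩ hu'w ru'w
  · exact h.mirror.keyZ hn.mirror huu huw h1.n1 hu'w n1 h2.n2 n4 h1.d1 h2.d2 r ruw ru'w rwv h1.r1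
      rwp' h2.r2 (not_not.2 cv) cp' c2
end

end PartA

section PartB

theorem exists_min_rel {α : Type*} (s : Finset α) (hs : s.Nonempty) (r : α → α → Prop)
    (hi : ∀ x ∈ s, ¬ r x x) (ht : ∀ x ∈ s, ∀ y ∈ s, ∀ z ∈ s, r x y → r y z → r x z) :
    ∃ m ∈ s, ∀ x ∈ s, ¬ r x m := by
  let r' : s → s → Prop := fun x y => r x y
  haveI : IsTrans s r' := ⟨fun a b c h1 h2 => ht a a.2 b b.2 c c.2 h1 h2⟩
  haveI : Std.Irrefl r' := ⟨fun a => hi a a.2⟩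
  have hw := Finite.wellFounded_of_trans_of_irrefl r'
  obtain ⟨x, hx⟩ := hs
  obtain ⟨m, -, hm⟩ := hw.has_min Set.univ ⟨⟨x, hx⟩, trivial⟩
  exact ⟨m, m.2, fun x hx => hm ⟨x, hx⟩ trivial⟩

section
variable {α : Type*} {R : α → α → Prop} {χ : α → α → α → Prop}

def Lab (R : α → α → Prop) (χ : α → α → α → Prop) (E : Finset (α × α)) (e : α × α) (l : Fin 4 × α) :
    Prop :=
  (l.1 = 0 ∧ l.2 = e.1 ∧ ∀ v, (e.1, v) ∈ E → v ≠ e.2 → ¬ χ e.1 e.2 v) ∨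
  (∃ p, Wedge R χ (fun u v => (u, v) ∈ E) e.1 e.2 p l.2 ∧
    (∀ v, (e.1, v) ∈ E → v ≠ e.2 → v ≠ p → χ e.1 e.2 v → χ e.1 p v) ∧
    l.1 = if l.2 = e.2 then 1 else if l.2 = p then 2 else 3)

theorem Lab.exists [Fintype α] (h : ChiAx R χ) (E : Finset (α × α))
    (hE : ∀ e ∈ E, e.1 ≠ e.2 ∧ R e.1 e.2) (e : α × α) (he : e ∈ E) : ∃ l, Lab R χ E e l := by
  obtain ⟨u, v⟩ := e
  obtain ⟨huv, ruv⟩ := hE _ he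
  simp only at huv ruv
  by_cases hne : ((Finset.univ : Finset α).filter (fun p => (u, p) ∈ E ∧ p ≠ v ∧ χ u v p)).Nonempty
  · obtain ⟨p, hp, hmin⟩ := exists_min_rel _ hne (fun x y => x ≠ y ∧ χ u x y) (by simp) (by
      intro x hx y hy z hz h1 h2
      simp only [Finset.mem_filter, Finset.mem_univ, true_and] at hx hy hz
      obtain ⟨a1, a2⟩ := hE _ hx.1
      obtain ⟨b1, b2⟩ := hE _ hy.1
      obtain ⟨c1, c2⟩ := hE _ hz.1
      have := h.ctrans a1 b1 c1 h1.1 h2.1 a2 b2 c2 h1.2 h2.2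
      refine ⟨?_, this⟩
      rintro rfl
      have := h.sw2 a1 b1 h1.1
      exact (this.1 h1.2) h2.2)
    simp only [Finset.mem_filter, Finset.mem_univ, true_and] at hp hmin
    obtain ⟨hpE, hpv, cp⟩ := hp
    obtain ⟨hup, rup⟩ := hE _ hpE
    simp only at hup rup
    have hKne : ((Finset.univ : Finset α).filter (fun w => InK R χ u v p w)).Nonempty := by
      by_cases r : R v p
      · refine ⟨v, ?_⟩
        simp only [Finset.mem_filter, Finset.mem_univ, true_and]
        refine ⟨huv, ruv, Or.inl rfl, Or.inr ⟨hpv.symm, r, ?_⟩⟩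
        exact (h.sw2 huv hup hpv.symm).1 cp
      · refine ⟨p, ?_⟩
        simp only [Finset.mem_filter, Finset.mem_univ, true_and]
        refine ⟨hup, rup, Or.inr ⟨hpv, ?_, cp⟩, Or.inl rfl⟩
        by_contra r'
        exact r ((h.anti v p hpv.symm).2 r')
    obtain ⟨w, hw, hwmin⟩ := exists_min_rel _ hKne (fun x y => x ≠ y ∧ R x y) (by simp) (by
      intro x hx y hy z hz h1 h2
      simp only [Finset.mem_filter, Finset.mem_univ, true_and] at hx hy hz
      have := h.trans hx.1 hy.1 hz.1 h1.1 h2.1 hx.2.1 hy.2.1 hz.2.1 h1.2 h2.2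
      refine ⟨?_, this⟩
      rintro rfl
      exact (h.anti _ _ h1.1).1 h1.2 h2.2)
    simp only [Finset.mem_filter, Finset.mem_univ, true_and] at hw hwmin
    refine ⟨(if w = v then 1 else if w = p then 2 else 3, w), Or.inr ⟨p, ?_, ?_, rfl⟩⟩
    · exact ⟨he, hpE, huv, hup, hpv.symm, ruv, rup, cp, hw, fun w' k n r => hwmin w' k ⟨n, r⟩⟩
    · intro v' hv' n1 n2 c
      obtain ⟨a1, a2⟩ := hE _ hv'
      have := hmin v' ⟨hv', n1, c⟩
      have h2 := h.sw2 hup a1 n2.symm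
      simp only at h2 this a1 a2 n1 n2 c ⊢
      tauto
  · refine ⟨(0, u), Or.inl ⟨rfl, rfl, ?_⟩⟩
    intro v' hv' n1 c
    exact hne ⟨v', by simp only [Finset.mem_filter, Finset.mem_univ, true_and]; exact ⟨hv', n1, c⟩⟩

theorem Lab.inj (h : ChiAx R χ) (E : Finset (α × α))
    (hE : ∀ e ∈ E, e.1 ≠ e.2 ∧ R e.1 e.2) (hn : NoCross χ (fun u v => (u, v) ∈ E))
    (e e' : α × α) (he : e ∈ E) (he' : e' ∈ E) (l : Fin 4 × α) (h1 : Lab R χ E e l)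
    (h2 : Lab R χ E e' l) : e = e' := by
  obtain ⟨u, v⟩ := e
  obtain ⟨u', v'⟩ := e'
  obtain ⟨i, w⟩ := l
  obtain ⟨huv, ruv⟩ := hE _ he
  obtain ⟨huv', ruv'⟩ := hE _ he'
  simp only [Lab] at h1 h2 huv ruv huv' ruv'
  have nz : ∀ (a b : Prop) , (0 : Fin 4) ≠ if a then 1 else if b then 2 else 3 := by
    intro a b; split_ifs <;> decide
  rcases h1 with ⟨rfl, rfl, m1⟩ | ⟨p, W, su, hi⟩
  · rcases h2 with ⟨-, rfl, m2⟩ | ⟨p, W, su, hi⟩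
    · by_contra hne
      have hv : v ≠ v' := by rintro rfl; exact hne rfl
      have := h.sw2 huv huv' hv
      have := m1 v' he' hv.symm
      have := m2 v he hv
      tauto
    · exact absurd hi (nz _ _)
  · rcases h2 with ⟨rfl, rfl, m2⟩ | ⟨p', W', su', hi'⟩
    · exact absurd hi (nz _ _)
    · by_cases wv : w = v
      · by_cases wv' : w = v'
        · subst wv; subst wv'
          rw [W.t1 h hn W']
        · exfalso
          rw [if_pos wv] at hi
          rw [if_neg wv', hi] at hi'
          split_ifs at hi' <;> simp at hi'
      by_cases wv' : w = v'
      · exfalso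
        rw [if_pos wv'] at hi'
        rw [if_neg wv, hi'] at hi
        split_ifs at hi <;> simp at hi
      rw [if_neg wv] at hi
      rw [if_neg wv'] at hi'
      have succ_eq : u = u' → p = p' → v = v' := by
        rintro rfl rfl
        by_contra hv
        have q := h.sw2 huv huv' hv
        have q1 := h.sw2 W.n2 W.n1 W.n3.symm
        have q2 := h.sw2 W'.n2 W'.n1 W'.n3.symm
        have c1 := W.c
        have c2 := W'.c
        have s1 := su v' he' (Ne.symm hv) W'.n3
        have s2 := su' v he hv W.n3
        tauto
      by_cases wp : w = p
      · by_cases wp' : w = p'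
        · subst wp; subst wp'
          have := (W.mirror h).t1 h.mirror hn.mirror (W'.mirror h)
          rw [this, succ_eq this rfl]
        · rw [if_pos wp] at hi
          rw [if_neg wp', hi] at hi'
          simp at hi'
      by_cases wp' : w = p'
      · rw [if_pos wp'] at hi'
        rw [if_neg wp, hi'] at hi
        simp at hi
      have huu := W.t3 h hn W' wv wp wv' wp'
      subst huu
      have main : ∀ v v' p p' : α, Wedge R χ (fun u v => (u, v) ∈ E) u v p w →
          Wedge R χ (fun u v => (u, v) ∈ E) u v' p' w → w ≠ v → w ≠ p → w ≠ v' →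
          (∀ v'', (u, v'') ∈ E → v'' ≠ v → v'' ≠ p → χ u v v'' → χ u p v'') → v ≠ v' →
          ¬ χ u v v' := by
        intro v v' p p' W W' wv wp wv' su hv c
        have hcv' : χ u v' w := by
          have := W'.k.2.2.1; tauto
        have hcp : ¬ χ u p w := by
          have := W.k.2.2.2; tauto
        by_cases hp : v' = p
        · subst hp; exact hcp hcv'
        · have c3 := su v' W'.d1 hv.symm hp c
          exact hcp (h.ctrans W.n2 W'.n1 W.k.1 (Ne.symm hp) (Ne.symm wv') W.r2 W'.r1 W.k.2.1 c3 hcv')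
      by_contra hne
      have hv : v ≠ v' := by rintro rfl; exact hne rfl
      have t1 := main v v' p p' W W' wv wp wv' su hv
      have t2 := main v' v p' p W' W wv' wp' wv su' hv.symm
      have := h.sw2 huv huv' hv
      tauto

theorem forest_bound [Fintype α] (h : ChiAx R χ) (E : Finset (α × α))
    (hE : ∀ e ∈ E, e.1 ≠ e.2 ∧ R e.1 e.2) (hn : NoCross χ (fun u v => (u, v) ∈ E)) :
    E.card ≤ 4 * Fintype.card α := by
  choose f hf using Lab.exists h E hE
  have : Fintype.card E ≤ Fintype.card (Fin 4 × α) := by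
    apply Fintype.card_le_of_injective (fun e : E => f e.1 e.2)
    intro e e' hee
    have h1 := hf e.1 e.2
    have h2 := hf e'.1 e'.2
    simp only at hee
    rw [hee] at h1
    exact Subtype.ext (Lab.inj h E hE hn _ _ e.2 e'.2 _ h1 h2)
  simpa using this
end

end PartB

section PartP

structure PLine {V : Type*} (φ : V → ℝ → ℝ) (X : V → V → ℝ) (τ : V → V → Prop) : Prop where
  symm : ∀ b c, X b c = X c b
  eq : ∀ b c, b ≠ c → ∀ x, φ b x = φ c x ↔ x = X b c
  lt : ∀ b c, b ≠ c → ∀ x, x ≠ X b c → (φ c x < φ b x ↔ (τ b c ↔ X b c < x))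
  simp : ∀ b c d, b ≠ c → b ≠ d → c ≠ d → X b c ≠ X b d

def pR {V : Type*} (s : V → Prop) (τ : V → V → Prop) (b c : V) : Prop := s b ↔ (s c ↔ τ b c)

def pC {V : Type*} (s : V → Prop) (τ : V → V → Prop) (X : V → V → ℝ) (b c d : V) : Prop :=
  s b ↔ (s c ↔ (s d ↔ (τ b c ↔ (τ b d ↔ X b c < X b d))))

theorem ord3 (b c d : ℝ) (h1 : b ≠ c) (h2 : b ≠ d) (h3 : c ≠ d) :
    ((b < c) ↔ ¬ (b < d)) → ((b < c) ↔ (c < d)) → False := by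
  intro a1 a2
  by_cases h : b < c
  · have := a1.1 h; have := a2.1 h; linarith
  · have h4 : b < d := by tauto
    have h5 : ¬ c < d := by tauto
    have := lt_of_le_of_ne (not_lt.1 h) h1.symm
    linarith

theorem ord4 (b c d e : ℝ) (h1 : b ≠ c) (h2 : b ≠ d) (h3 : b ≠ e) (h4 : c ≠ d) (h5 : c ≠ e)
    (h6 : d ≠ e) :
    ((b < c ↔ d < e) ↔ ¬ (b < d ↔ c < e)) → ((b < c ↔ d < e) ↔ (b < e ↔ c < d)) → False := by
  rcases lt_or_gt_of_ne h1 with h1 | h1 <;> rcases lt_or_gt_of_ne h2 with h2 | h2 <;>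
  rcases lt_or_gt_of_ne h3 with h3 | h3 <;> rcases lt_or_gt_of_ne h4 with h4 | h4 <;>
  rcases lt_or_gt_of_ne h5 with h5 | h5 <;> rcases lt_or_gt_of_ne h6 with h6 | h6 <;>
  first
  | (exfalso; linarith)
  | simp [h1, h2, h3, h4, h5, h6, not_lt_of_gt]

section
variable {V : Type*} {φ : V → ℝ → ℝ} {X : V → V → ℝ} {τ : V → V → Prop}

theorem PLine.anti (h : PLine φ X τ) (b c : V) (n : b ≠ c) : τ b c ↔ ¬ τ c b := by
  have n1 : X b c + 1 ≠ X b c := by linarith [show X b c + 1 ≠ X b c from by simp]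
  have h1 := h.lt b c n (X b c + 1) n1
  have h2 := h.lt c b n.symm (X b c + 1) (by rw [h.symm c b]; exact n1)
  have h3 := (h.eq b c n (X b c + 1)).not.2 n1
  rw [h.symm c b] at h2
  have e : X b c < X b c + 1 := by linarith
  simp only [e, iff_true] at h1 h2
  rw [← h1, ← h2, not_lt]
  exact ⟨fun h => h.le, fun h => lt_of_le_of_ne h (fun e => h3 e.symm)⟩

theorem PLine.keyA (h : PLine φ X τ) (b c d : V) (n1 : b ≠ c) (n2 : b ≠ d) (n3 : c ≠ d) :
    (τ b d ↔ X b d < X b c) ↔ (τ c d ↔ X c d < X b c) := by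
  have h1 := h.lt b d n2 (X b c) (h.simp b c d n1 n2 n3)
  have h2 := h.lt c d n3 (X b c) (by rw [h.symm b c]; exact h.simp c b d n1.symm n3 n2)
  have h3 := (h.eq b c n1 (X b c)).2 rfl
  rw [← h1, ← h2, h3]

theorem propA (r a b t1 t2 p : Prop) : (r ↔ (a ↔ (b ↔ (t1 ↔ (t2 ↔ p))))) ↔
      (r ↔ ((a ↔ t1) ↔ ((b ↔ t2) ↔ p))) := by
  by_cases r <;> by_cases a <;> by_cases b <;> by_cases t1 <;> by_cases t2 <;> simp [*]

theorem pC_eq (s : V → Prop) (b c d : V) : pC s τ X b c d ↔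
    (s b ↔ ((s c ↔ τ b c) ↔ ((s d ↔ τ b d) ↔ X b c < X b d))) := propA _ _ _ _ _ _

theorem propG1 (u b c d p1 p2 p3 : Prop) (h : (p1 ↔ ¬ p2) → (p1 ↔ p3) → False)
    (h1 : ((u ↔ (b ↔ (c ↔ p1))) ↔ (u ↔ d)) ↔ ¬ ((u ↔ (b ↔ (d ↔ p2))) ↔ (u ↔ c)))
    (h2 : ((u ↔ (b ↔ (c ↔ p1))) ↔ (u ↔ d)) ↔ ((u ↔ (c ↔ (d ↔ p3))) ↔ (u ↔ b))) : False := by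
  revert h h1 h2
  by_cases u <;> by_cases b <;> by_cases c <;> by_cases d <;> simp only [*, true_iff, false_iff, iff_true, iff_false, not_true_eq_false, not_false_eq_true, not_not] <;> by_cases p1 <;> by_cases p2 <;> simp [*]

theorem propB (a b c d t t' : Prop) :
    ((a ↔ (b ↔ t)) ↔ (c ↔ (d ↔ t'))) ↔ ((a ↔ (b ↔ (c ↔ d))) ↔ (t ↔ t')) := by
  by_cases a <;> by_cases b <;> by_cases c <;> by_cases d <;> by_cases t <;> simp [*]

theorem propG2 (b c d e p1 p2 p3 p4 p5 p6 : Prop)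
    (h : ((p1 ↔ p6) ↔ ¬ (p2 ↔ p5)) → ((p1 ↔ p6) ↔ (p3 ↔ p4)) → False)
    (h1 : ((b ↔ (c ↔ p1)) ↔ (d ↔ (e ↔ p6))) ↔ ¬ ((b ↔ (d ↔ p2)) ↔ (c ↔ (e ↔ p5))))
    (h2 : ((b ↔ (c ↔ p1)) ↔ (d ↔ (e ↔ p6))) ↔ ((b ↔ (e ↔ p3)) ↔ (c ↔ (d ↔ p4)))) : False := by
  rw [propB b c d e p1 p6, propB b d c e p2 p5] at h1
  rw [propB b c d e p1 p6, propB b e c d p3 p4] at h2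
  have e1 : (b ↔ (d ↔ (c ↔ e))) ↔ (b ↔ (c ↔ (d ↔ e))) := by
    by_cases b <;> by_cases c <;> by_cases d <;> simp [*]
  have e2 : (b ↔ (e ↔ (c ↔ d))) ↔ (b ↔ (c ↔ (d ↔ e))) := by
    by_cases b <;> by_cases c <;> by_cases d <;> simp [*]
  rw [e1] at h1
  rw [e2] at h2
  clear e1 e2
  generalize (b ↔ (c ↔ (d ↔ e))) = z at *
  generalize (p1 ↔ p6) = y1 at *
  generalize (p2 ↔ p5) = y2 at *
  generalize (p3 ↔ p4) = y3 at *
  by_cases z <;> by_cases y1 <;> by_cases y2 <;> by_cases y3 <;> simp_all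

theorem propG3 (u b c d e p1 p2 p3 p4 p5 p6 : Prop)
    (h : ((p1 ↔ p6) ↔ ¬ (p2 ↔ p5)) → ((p1 ↔ p6) ↔ (p3 ↔ p4)) → False)
    (h1 : ((u ↔ (b ↔ (c ↔ p1))) ↔ (u ↔ (d ↔ (e ↔ p6)))) ↔ ¬ ((u ↔ (b ↔ (d ↔ p2))) ↔ (u ↔ (c ↔ (e ↔ p5)))))
    (h2 : ((u ↔ (b ↔ (c ↔ p1))) ↔ (u ↔ (d ↔ (e ↔ p6)))) ↔ ((u ↔ (b ↔ (e ↔ p3))) ↔ (u ↔ (c ↔ (d ↔ p4))))) : False := by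
  have e1 : ∀ x y : Prop, ((u ↔ x) ↔ (u ↔ y)) ↔ (x ↔ y) := by
    intro x y; by_cases u <;> by_cases x <;> simp [*]
  simp only [e1] at h1 h2
  exact propG2 b c d e _ _ _ _ _ _ h h1 h2

theorem PLine.chiAx (h : PLine φ X τ) (s : V → Prop) : ChiAx (pR s τ) (pC s τ X) := by
  have sw : ∀ u v w, u ≠ v → u ≠ w → v ≠ w → (pC s τ X u v w ↔ ¬ pC s τ X v u w) := by
    intro u v w n1 n2 n3
    have a := h.keyA u v w n1 n2 n3
    have b := h.anti u v n1
    have c := h.simp u v w n1 n2 n3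
    have d := h.simp v u w n1.symm n3 n2
    have e : X u v < X u w ↔ ¬ X u w < X u v := by
      rw [not_lt]; exact ⟨fun h => h.le, fun h => lt_of_le_of_ne h c⟩
    have f : X u v < X v w ↔ ¬ X v w < X u v := by
      rw [not_lt]; exact ⟨fun h => h.le, fun h' => lt_of_le_of_ne h' (by rwa [h.symm u v])⟩
    simp only [pC, h.symm v u, e, f, b]
    have yz : (τ u w ↔ ¬ X u w < X u v) ↔ (τ v w ↔ ¬ X v w < X u v) := by
      clear e f b; tauto
    rw [yz]
    generalize (τ v w ↔ ¬ X v w < X u v) = z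
    clear yz a b e f
    by_cases s u <;> by_cases s v <;> by_cases s w <;> by_cases τ v u <;> simp [*]
  have sw2 : ∀ u v w, u ≠ v → u ≠ w → v ≠ w → (pC s τ X u v w ↔ ¬ pC s τ X u w v) := by
    intro u v w n1 n2 n3
    have c := h.simp u v w n1 n2 n3
    have e : X u v < X u w ↔ ¬ X u w < X u v := by
      rw [not_lt]; exact ⟨fun h => h.le, fun h => lt_of_le_of_ne h c⟩
    simp only [pC, e]
    generalize (X u w < X u v) = z
    clear e
    by_cases s u <;> by_cases s v <;> by_cases s w <;> by_cases τ u v <;> by_cases τ u w <;> simp [*]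
  refine ⟨?_, sw, ?_, ?_, ?_, ?_⟩
  · intro u v n
    have b := h.anti u v n
    simp only [pR]
    tauto
  · intro u v w n1 n2 n3
    have a := sw u v w n1 n2 n3
    have b := sw2 v u w n1.symm n3 n2
    tauto
  · intro u b c d n1 n2 n3 n4 n5 n6
    have := ord3 (X u b) (X u c) (X u d) (h.simp _ _ _ n1 n2 n4) (h.simp _ _ _ n1 n3 n5)
      (h.simp _ _ _ n2 n3 n6)
    simp only [pC_eq, pR]
    exact propG1 _ _ _ _ _ _ _ this
  · intro b c d e n1 n2 n3 n4 n5 n6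
    obtain ⟨x, hx⟩ : ∃ x, x > X b c ∧ x > X b d ∧ x > X b e ∧ x > X c d ∧ x > X c e ∧ x > X d e := by
      have : ∀ᶠ x : ℝ in Filter.atTop, x > X b c ∧ x > X b d ∧ x > X b e ∧ x > X c d ∧ x > X c e ∧ x > X d e := by
        simp only [Filter.eventually_and]
        refine ⟨Filter.eventually_gt_atTop _, Filter.eventually_gt_atTop _, Filter.eventually_gt_atTop _, Filter.eventually_gt_atTop _, Filter.eventually_gt_atTop _, Filter.eventually_gt_atTop _⟩
      exact this.exists
    obtain ⟨h1, h2, h3, h4, h5, h6⟩ := hx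
    have key : ∀ b c, b ≠ c → x > X b c → (τ b c ↔ - φ b x < - φ c x) ∧ -φ b x ≠ - φ c x := by
      intro b c n hx
      have h1 := h.lt b c n x hx.ne'
      have h2 := (h.eq b c n x).not.2 hx.ne'
      refine ⟨?_, by simpa using h2⟩
      rw [neg_lt_neg_iff, h1]
      have : X b c < x := hx
      tauto
    obtain ⟨a1, b1⟩ := key b c n1 h1
    obtain ⟨a2, b2⟩ := key b d n2 h2
    obtain ⟨a3, b3⟩ := key b e n3 h3
    obtain ⟨a4, b4⟩ := key c d n4 h4
    obtain ⟨a5, b5⟩ := key c e n5 h5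
    obtain ⟨a6, b6⟩ := key d e n6 h6
    have := ord4 _ _ _ _ b1 b2 b3 b4 b5 b6
    rw [← a1, ← a2, ← a3, ← a4, ← a5, ← a6] at this
    simp only [pR]
    exact propG2 _ _ _ _ _ _ _ _ _ _ this
  · intro u b c d e n1 n2 n3 n4 n5 n6 n7 n8 n9 n10
    have := ord4 (X u b) (X u c) (X u d) (X u e) (h.simp _ _ _ n1 n2 n5) (h.simp _ _ _ n1 n3 n6)
      (h.simp _ _ _ n1 n4 n7) (h.simp _ _ _ n2 n3 n8) (h.simp _ _ _ n2 n4 n9) (h.simp _ _ _ n3 n4 n10)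
    simp only [pC_eq]
    exact propG3 _ _ _ _ _ _ _ _ _ _ _ this
end

end PartP

section PartG

theorem sgn1 (f : ℝ → ℝ) (hf : Continuous f) (t : ℝ) (h0 : ∀ x, f x = 0 ↔ x = t)
    (hn : ∃ x, f x < 0) (hp : ∃ x, 0 < f x) :
    ∃ Q : Prop, ∀ x, x ≠ t → (0 < f x ↔ (Q ↔ t < x)) := by
  have same : ∀ x y, x < y → (y < t ∨ t < x) → 0 < f x → 0 < f y := by
    intro x y hxy ht hx
    by_contra hy
    obtain ⟨z, hz, hz0⟩ := intermediate_value_Icc' hxy.le hf.continuousOn ⟨not_lt.1 hy, hx.le⟩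
    have := (h0 z).1 hz0
    rcases ht with ht | ht
    · linarith [hz.2]
    · linarith [hz.1]
  have same2 : ∀ x y, x < y → (y < t ∨ t < x) → 0 < f y → 0 < f x := by
    intro x y hxy ht hx
    by_contra hy
    obtain ⟨z, hz, hz0⟩ := intermediate_value_Icc hxy.le hf.continuousOn ⟨not_lt.1 hy, hx.le⟩
    have := (h0 z).1 hz0
    rcases ht with ht | ht
    · linarith [hz.2]
    · linarith [hz.1]
  have R : ∀ x, t < x → (0 < f x ↔ 0 < f (t + 1)) := by
    intro x hx
    rcases lt_trichotomy x (t + 1) with h | h | h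
    · exact ⟨same _ _ h (Or.inr hx), same2 _ _ h (Or.inr hx)⟩
    · rw [h]
    · exact ⟨same2 _ _ h (Or.inr (by linarith)), same _ _ h (Or.inr (by linarith))⟩
  have Lf : ∀ x, x < t → (0 < f x ↔ 0 < f (t - 1)) := by
    intro x hx
    rcases lt_trichotomy x (t - 1) with h | h | h
    · exact ⟨same _ _ h (Or.inl (by linarith)), same2 _ _ h (Or.inl (by linarith))⟩
    · rw [h]
    · exact ⟨same2 _ _ h (Or.inl (by linarith)), same _ _ h (Or.inl (by linarith))⟩
  have opp : 0 < f (t - 1) ↔ ¬ 0 < f (t + 1) := by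
    constructor
    · intro h1 h2
      obtain ⟨x, hx⟩ := hn
      rcases lt_trichotomy x t with h | h | h
      · have := (Lf x h).2 h1; linarith
      · have := (h0 x).2 h; linarith
      · have := (R x h).2 h2; linarith
    · intro h1
      by_contra h2
      obtain ⟨x, hx⟩ := hp
      rcases lt_trichotomy x t with h | h | h
      · exact h2 ((Lf x h).1 hx)
      · have := (h0 x).2 h; linarith
      · exact h1 ((R x h).1 hx)
  refine ⟨0 < f (t + 1), fun x hx => ?_⟩
  rcases lt_or_gt_of_ne hx with h | h
  · have : ¬ t < x := by linarith
    rw [Lf x h, opp]; tauto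
  · rw [R x h]
    have : t < x := h
    tauto

theorem sgn2 (h : ℝ × ℝ → ℝ) (hh : Continuous h) (φ : ℝ → ℝ) (hφ : Continuous φ)
    (h0 : ∀ x y, h (x, y) = 0 ↔ y = φ x) (hn : ∃ x y, h (x, y) < 0) (hp : ∃ x y, 0 < h (x, y)) :
    ∃ Q : Prop, ∀ x y, y ≠ φ x → (0 < h (x, y) ↔ (Q ↔ φ x < y)) := by
  let g : ℝ × ℝ → ℝ := fun q => h (q.1, φ q.1 + q.2)
  have hg : Continuous g := by fun_prop
  have key : ∀ S : Set (ℝ × ℝ), Convex ℝ S → (∀ q ∈ S, q.2 ≠ 0) → ∀ p ∈ S, ∀ q ∈ S,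
      0 < g p → 0 < g q := by
    intro S hS hS0 p hpS q hqS hgp
    by_contra hgq
    obtain ⟨z, hz, hz0⟩ := hS.isPreconnected.intermediate_value hqS hpS hg.continuousOn
      ⟨not_lt.1 hgq, hgp.le⟩
    have := (h0 _ _).1 hz0
    exact hS0 z hz (by linarith)
  have cU : Convex ℝ {q : ℝ × ℝ | 0 < q.2} :=
    convex_halfSpace_gt (IsLinearMap.mk (fun _ _ => rfl) (fun _ _ => rfl)) 0
  have cL : Convex ℝ {q : ℝ × ℝ | q.2 < 0} :=
    convex_halfSpace_lt (IsLinearMap.mk (fun _ _ => rfl) (fun _ _ => rfl)) 0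
  have hgh : ∀ x y, h (x, y) = g (x, y - φ x) := by intro x y; simp [g]
  have R : ∀ x y, φ x < y → (0 < h (x, y) ↔ 0 < g (0, 1)) := by
    intro x y hy
    rw [hgh]
    have m1 : (x, y - φ x) ∈ {q : ℝ × ℝ | 0 < q.2} := by simpa using hy
    have m2 : ((0 : ℝ), (1 : ℝ)) ∈ {q : ℝ × ℝ | 0 < q.2} := by simp
    exact ⟨key _ cU (fun q hq => ne_of_gt hq) _ m1 _ m2, key _ cU (fun q hq => ne_of_gt hq) _ m2 _ m1⟩
  have Lf : ∀ x y, y < φ x → (0 < h (x, y) ↔ 0 < g (0, -1)) := by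
    intro x y hy
    rw [hgh]
    have m1 : (x, y - φ x) ∈ {q : ℝ × ℝ | q.2 < 0} := by simpa using hy
    have m2 : ((0 : ℝ), (-1 : ℝ)) ∈ {q : ℝ × ℝ | q.2 < 0} := by simp
    exact ⟨key _ cL (fun q hq => ne_of_lt hq) _ m1 _ m2, key _ cL (fun q hq => ne_of_lt hq) _ m2 _ m1⟩
  have opp : 0 < g (0, -1) ↔ ¬ 0 < g (0, 1) := by
    constructor
    · intro h1 h2
      obtain ⟨x, y, hx⟩ := hn
      rcases lt_trichotomy y (φ x) with h | h | h
      · have := (Lf x y h).2 h1; linarith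
      · have := (h0 x y).2 h; linarith
      · have := (R x y h).2 h2; linarith
    · intro h1
      by_contra h2
      obtain ⟨x, y, hx⟩ := hp
      rcases lt_trichotomy y (φ x) with h | h | h
      · exact h2 ((Lf x y h).1 hx)
      · have := (h0 x y).2 h; linarith
      · exact h1 ((R x y h).1 hx)
  refine ⟨0 < g (0, 1), fun x y hx => ?_⟩
  rcases lt_or_gt_of_ne hx with h | h
  · have : ¬ φ x < y := by linarith
    rw [Lf x y h, opp]; tauto
  · rw [R x y h]
    have : φ x < y := h
    tauto

/-- the geometric data extracted from a family of pseudoplanes -/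
structure Geo {V : Type*} (f : V → ℝ → ℝ → ℝ) (φ : V → V → ℝ → ℝ) (T : V → V → V → ℝ)
    (E : V → V → Prop) (H : V → V → V → Prop) : Prop where
  cont : ∀ a, Continuous fun q : ℝ × ℝ => f a q.1 q.2
  φc : ∀ a b, a ≠ b → Continuous (φ a b)
  φs : ∀ a b, φ a b = φ b a
  φeq : ∀ a b, a ≠ b → ∀ x y, f a x y = f b x y ↔ y = φ a b x
  hE : ∀ a b, a ≠ b → ∀ x y, y ≠ φ a b x → (f b x y < f a x y ↔ (E a b ↔ φ a b x < y))
  T0 : ∀ a b c, a ≠ b → a ≠ c → b ≠ c → ∀ x, f c x (φ a b x) = f a x (φ a b x) ↔ x = T a b c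
  hH : ∀ a b c, a ≠ b → a ≠ c → b ≠ c → ∀ x, x ≠ T a b c →
    (f a x (φ a b x) < f c x (φ a b x) ↔ (H a b c ↔ T a b c < x))
  X4 : ∀ a b c d, a ≠ b → c ≠ d → ¬ (a = c ∧ b = d) → ¬ (a = d ∧ b = c) → ∃! x, φ a b x = φ c d x
  p5 : ∀ a b c d, a ≠ b → a ≠ c → a ≠ d → b ≠ c → b ≠ d → c ≠ d → ∀ x y,
    f a x y = f b x y → f a x y = f c x y → f a x y = f d x y → False

theorem Geo.exists (Λ : Finset PP) (hΛ : PseudoplaneFamily Λ) :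
    ∃ φ T E H, Geo (fun a : Λ => (a : PP)) φ T E H := by
  obtain ⟨h1, h2, h3, h4, h5, h6, h7⟩ := hΛ
  have ne : ∀ a b : Λ, a ≠ b → (a : PP) ≠ b := fun a b h => fun e => h (Subtype.ext e)
  have A : ∀ a b : Λ, ∃ φ : ℝ → ℝ, a ≠ b → IsGraphFun (a : PP) b φ := by
    intro a b
    by_cases h : a = b
    · exact ⟨0, fun h' => absurd h h'⟩
    · obtain ⟨φ, hφ⟩ := h2 a a.2 b b.2 (ne _ _ h)
      exact ⟨φ, fun _ => hφ⟩
  choose ψ hψ using A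
  let φ : Λ → Λ → ℝ → ℝ := fun a b => if a = b then 0 else ψ a b
  have hφ : ∀ a b : Λ, a ≠ b → IsGraphFun (a : PP) b (φ a b) := by
    intro a b h; simp only [φ, if_neg h]; exact hψ a b h
  have B : ∀ a b c : Λ, ∃ t : ℝ, a ≠ b → a ≠ c → b ≠ c →
      ∀ x, (c : PP) x (φ a b x) = (a : PP) x (φ a b x) ↔ x = t := by
    intro a b c
    by_cases h : a ≠ b ∧ a ≠ c ∧ b ≠ c
    · obtain ⟨n1, n2, n3⟩ := h
      obtain ⟨⟨t, y⟩, ⟨e1, e2⟩, hu⟩ := h3 a a.2 b b.2 c c.2 (ne _ _ n1) (ne _ _ n2) (ne _ _ n3)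
      refine ⟨t, fun _ _ _ x => ⟨fun h => ?_, ?_⟩⟩
      · have := hu (x, φ a b x) ⟨((hφ a b n1).2 _ _).2 rfl, h.symm⟩
        exact congrArg Prod.fst this
      · rintro rfl
        simp only at e1 e2
        rw [← ((hφ a b n1).2 _ _).1 e1, e2]
    · exact ⟨0, fun a b c => absurd ⟨a, b, c⟩ h⟩
  choose T hT using B
  have C : ∀ a b : Λ, ∃ Q : Prop, a ≠ b → ∀ x y, y ≠ φ a b x →
      ((b : PP) x y < (a : PP) x y ↔ (Q ↔ φ a b x < y)) := by
    intro a b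
    by_cases h : a = b
    · exact ⟨True, fun h' => absurd h h'⟩
    · obtain ⟨Q, hQ⟩ := sgn2 (fun q => (a : PP) q.1 q.2 - (b : PP) q.1 q.2)
        ((h1 a a.2).sub (h1 b b.2)) (φ a b) (hφ a b h).1
        (by intro x y; simp only [sub_eq_zero]; exact (hφ a b h).2 x y)
        (by obtain ⟨x, y, e⟩ := (h6 a a.2 b b.2 (ne _ _ h)).1; exact ⟨x, y, by simpa using e⟩)
        (by obtain ⟨x, y, e⟩ := (h6 a a.2 b b.2 (ne _ _ h)).2; exact ⟨x, y, by simpa using e⟩)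
      exact ⟨Q, fun _ x y hy => by have := hQ x y hy; simpa only [sub_pos] using this⟩
  choose E hE using C
  have D : ∀ a b c : Λ, ∃ Q : Prop, a ≠ b → a ≠ c → b ≠ c → ∀ x, x ≠ T a b c →
      ((a : PP) x (φ a b x) < (c : PP) x (φ a b x) ↔ (Q ↔ T a b c < x)) := by
    intro a b c
    by_cases h : a ≠ b ∧ a ≠ c ∧ b ≠ c
    · obtain ⟨n1, n2, n3⟩ := h
      have cc := (hφ a b n1).1
      have := h7 a a.2 b b.2 c c.2 (ne _ _ n1) (ne _ _ n2) (ne _ _ n3) _ (hφ a b n1)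
      obtain ⟨Q, hQ⟩ := sgn1 (fun x => (c : PP) x (φ a b x) - (a : PP) x (φ a b x))
        (((h1 c c.2).comp (continuous_id.prodMk cc)).sub ((h1 a a.2).comp (continuous_id.prodMk cc)))
        (T a b c)
        (by intro x; simp only [sub_eq_zero]; exact hT a b c n1 n2 n3 x)
        (by obtain ⟨x, e⟩ := this.1; exact ⟨x, by simpa using e⟩)
        (by obtain ⟨x, e⟩ := this.2; exact ⟨x, by simpa using e⟩)
      exact ⟨Q, fun _ _ _ x hx => by have := hQ x hx; simpa only [sub_pos] using this⟩
    · exact ⟨True, fun a b c => absurd ⟨a, b, c⟩ h⟩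
  choose H hH using D
  refine ⟨φ, T, E, H, fun a => h1 a a.2, fun a b h => (hφ a b h).1, ?_, fun a b h => (hφ a b h).2,
    hE, hT, hH, ?_, ?_⟩
  · intro a b
    by_cases h : a = b
    · rw [h]
    · funext x
      have e1 := ((hφ a b h).2 x (φ a b x)).2 rfl
      exact ((hφ b a (Ne.symm h)).2 x (φ a b x)).1 e1.symm
  · intro a b c d n1 n2 n3 n4
    refine h4 a a.2 b b.2 c c.2 d d.2 (ne _ _ n1) (ne _ _ n2) ?_ _ _ (hφ a b n1) (hφ c d n2)
    intro e
    have e' := congrArg (fun s : Finset PP => (s : Set PP)) e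
    simp only [Finset.coe_insert, Finset.coe_singleton] at e'
    rcases Set.pair_eq_pair_iff.1 e' with h | h
    · exact n3 ⟨Subtype.ext h.1, Subtype.ext h.2⟩
    · exact n4 ⟨Subtype.ext h.1, Subtype.ext h.2⟩
  · intro a b c d n1 n2 n3 n4 n5 n6 x y e1 e2 e3
    exact h5 a a.2 b b.2 c c.2 d d.2 (ne _ _ n1) (ne _ _ n2) (ne _ _ n3) (ne _ _ n4) (ne _ _ n5)
      (ne _ _ n6) ⟨x, y, e1, e2, e3⟩

end PartG

section PartH

structure Sg (F : ℝ → ℝ) (η : Prop) (t : ℝ) : Prop where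
  eq0 : ∀ x, F x = 0 ↔ x = t
  pos : ∀ x, x ≠ t → (0 < F x ↔ (η ↔ t < x))

theorem Sg.p {F : ℝ → ℝ} {η : Prop} {t : ℝ} (h : Sg F η t) (hη : η) :
    (∀ x, 0 < F x ↔ t < x) ∧ (∀ x, F x < 0 ↔ x < t) := by
  constructor
  · intro x
    by_cases e : x = t
    · have := (h.eq0 x).2 e; rw [this, e]; simp
    · have := h.pos x e; tauto
  · intro x
    by_cases e : x = t
    · have := (h.eq0 x).2 e; rw [this, e]; simp
    · have h1 := h.pos x e
      have h2 : F x ≠ 0 := (h.eq0 x).not.2 e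
      constructor
      · intro h3
        have : ¬ t < x := fun h4 => by have := h1.2 (by tauto); linarith
        exact lt_of_le_of_ne (not_lt.1 this) e
      · intro h3
        refine lt_of_le_of_ne ?_ h2
        rw [← not_lt, h1]
        have : ¬ t < x := by linarith
        tauto

theorem Sg.neg {F : ℝ → ℝ} {η : Prop} {t : ℝ} (h : Sg F η t) : Sg (fun x => - F x) (¬ η) t := by
  refine ⟨by simpa using h.eq0, fun x hx => ?_⟩
  have h1 := h.pos x hx
  have h2 : F x ≠ 0 := (h.eq0 x).not.2 hx
  have h3 : 0 < - F x ↔ ¬ 0 < F x := by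
    rw [neg_pos, not_lt]; exact ⟨fun h => h.le, fun h => lt_of_le_of_ne h h2⟩
  rw [h3, h1]; tauto

theorem Sg.n {F : ℝ → ℝ} {η : Prop} {t : ℝ} (h : Sg F η t) (hη : ¬ η) :
    (∀ x, 0 < F x ↔ x < t) ∧ (∀ x, F x < 0 ↔ t < x) := by
  have := h.neg.p hη
  simpa using And.symm this

theorem Sg.cases {F : ℝ → ℝ} {η : Prop} {t : ℝ} (h : Sg F η t) :
    (η ∧ (∀ x, 0 < F x ↔ t < x) ∧ (∀ x, F x < 0 ↔ x < t)) ∨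
    (¬ η ∧ (∀ x, 0 < F x ↔ x < t) ∧ (∀ x, F x < 0 ↔ t < x)) := by
  by_cases hη : η
  · exact Or.inl ⟨hη, h.p hη⟩
  · exact Or.inr ⟨hη, h.n hη⟩

theorem imm_abs {A D E : ℝ → ℝ} {ηa ηd ηe : Prop} {xa xd xe X0 : ℝ} (hA : Sg A ηa xa)
    (hD : Sg D ηd xd) (hE : Sg E ηe xe) (n2 : xd ≠ xe)
    (h1 : (0 < D xa ∧ E xa < 0) ∨ (D xa < 0 ∧ 0 < E xa))
    (h2 : (0 < A X0 ∧ D X0 < 0 ∧ E X0 < 0) ∨ (A X0 < 0 ∧ 0 < D X0 ∧ 0 < E X0)) (x : ℝ) :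
    (A x < 0 ∨ D x < 0 ∨ E x < 0) ∧ (0 < A x ∨ 0 < D x ∨ 0 < E x) := by
  rcases hA.cases with ⟨a, a1, a2⟩ | ⟨a, a1, a2⟩ <;>
  rcases hD.cases with ⟨d, d1, d2⟩ | ⟨d, d1, d2⟩ <;>
  rcases hE.cases with ⟨e, e1, e2⟩ | ⟨e, e1, e2⟩ <;>
  · simp only [a1, a2, d1, d2, e1, e2] at *
    clear hA hD hE a1 a2 d1 d2 e1 e2 A D E
    grind

end PartH

section PartJ

def Imm {V : Type*} (f : V → ℝ → ℝ → ℝ) (φ : V → V → ℝ → ℝ) (b c a d e : V) : Prop :=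
  ∀ x, (f a x (φ b c x) < f b x (φ b c x) ∨ f d x (φ b c x) < f b x (φ b c x) ∨
      f e x (φ b c x) < f b x (φ b c x)) ∧
    (f b x (φ b c x) < f a x (φ b c x) ∨ f b x (φ b c x) < f d x (φ b c x) ∨
      f b x (φ b c x) < f e x (φ b c x))

section
variable {V : Type*} {f : V → ℝ → ℝ → ℝ} {φ : V → V → ℝ → ℝ} {T : V → V → V → ℝ}
    {E : V → V → Prop} {H : V → V → V → Prop}

theorem Geo.sg (G : Geo f φ T E H) {b c u : V} (n1 : b ≠ c) (n2 : b ≠ u) (n3 : c ≠ u) :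
    Sg (fun x => f u x (φ b c x) - f b x (φ b c x)) (H b c u) (T b c u) := by
  refine ⟨fun x => ?_, fun x hx => ?_⟩
  · rw [sub_eq_zero]; exact G.T0 b c u n1 n2 n3 x
  · rw [sub_pos]; exact G.hH b c u n1 n2 n3 x hx

theorem Geo.on (G : Geo f φ T E H) {b c : V} (n1 : b ≠ c) (x : ℝ) :
    f b x (φ b c x) = f c x (φ b c x) := (G.φeq b c n1 x _).2 rfl

theorem Geo.Tpt (G : Geo f φ T E H) {a b c : V} (n1 : a ≠ b) (n2 : a ≠ c) (n3 : b ≠ c) :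
    φ a c (T a b c) = φ a b (T a b c) ∧ φ b c (T a b c) = φ a b (T a b c) := by
  have h1 := (G.T0 a b c n1 n2 n3 _).2 rfl
  have h2 := G.on n1 (T a b c)
  exact ⟨((G.φeq a c n2 _ _).1 h1.symm).symm, ((G.φeq b c n3 _ _).1 (by rw [h1, h2])).symm⟩

theorem Geo.T23 (G : Geo f φ T E H) {a b c : V} (n1 : a ≠ b) (n2 : a ≠ c) (n3 : b ≠ c) :
    T a c b = T a b c := by
  symm
  rw [← G.T0 a c b n2 n1 n3.symm, (G.Tpt n1 n2 n3).1]
  exact (G.on n1 _).symm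

theorem Geo.T12 (G : Geo f φ T E H) {a b c : V} (n1 : a ≠ b) (n2 : a ≠ c) (n3 : b ≠ c) :
    T b a c = T a b c := by
  symm
  rw [← G.T0 b a c n1.symm n3 n2, G.φs b a, (G.T0 a b c n1 n2 n3 _).2 rfl]
  exact (G.on n1 _)

theorem Geo.Trot (G : Geo f φ T E H) {a b c : V} (n1 : a ≠ b) (n2 : a ≠ c) (n3 : b ≠ c) :
    T b c a = T a b c := by
  rw [G.T23 n1.symm n3 n2, G.T12 n1 n2 n3]

theorem Geo.Tne (G : Geo f φ T E H) {a b c d : V} (n1 : a ≠ b) (n2 : a ≠ c) (n3 : a ≠ d)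
    (n4 : b ≠ c) (n5 : b ≠ d) (n6 : c ≠ d) : T a b c ≠ T a b d := by
  intro e
  have h1 := (G.T0 a b c n1 n2 n4 _).2 rfl
  have h2 := (G.T0 a b d n1 n3 n5 (T a b c)).2 e
  exact G.p5 a b c d n1 n2 n3 n4 n5 n6 _ _ (G.on n1 _) h1.symm h2.symm

theorem Geo.Eanti (G : Geo f φ T E H) {a b : V} (n : a ≠ b) : E a b ↔ ¬ E b a := by
  have h1 := G.hE a b n 0 (φ a b 0 + 1) (by simp)
  have h2 := G.hE b a n.symm 0 (φ a b 0 + 1) (by rw [G.φs b a]; simp)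
  have h3 := (G.φeq a b n 0 (φ a b 0 + 1)).not.2 (by simp)
  rw [G.φs b a] at h2
  have e : φ a b 0 < φ a b 0 + 1 := by linarith
  simp only [e, iff_true] at h1 h2
  rw [← h1, ← h2, not_lt]
  exact ⟨fun h => h.le, fun h => lt_of_le_of_ne h (fun e => h3 e.symm)⟩

theorem Geo.pline (G : Geo f φ T E H) (a : V) (W : Set V) (hW : a ∉ W) :
    PLine (fun b : W => φ a b) (fun b c : W => T a b c) (fun b c : W => (E c a ↔ H a b c)) := by
  have na : ∀ b : W, a ≠ b := fun b e => hW (e ▸ b.2)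
  have ne : ∀ {b c : W}, b ≠ c → (b : V) ≠ c := fun h e => h (Subtype.ext e)
  have key : ∀ b c : W, b ≠ c → ∀ x, φ a b x = φ a c x ↔ x = T a b c := by
    intro b c n x
    rw [← G.T0 a b c (na b) (na c) (ne n) x]
    constructor
    · intro e; rw [eq_comm, G.φeq a c (na c)]; exact e
    · intro e; rw [eq_comm, G.φeq a c (na c)] at e; exact e
  refine ⟨?_, key, ?_, ?_⟩
  · intro b c
    by_cases n : b = c
    · rw [n]
    · exact (G.T23 (na b) (na c) (ne n)).symm
  · intro b c n x hx
    have h1 := G.hH a b c (na b) (na c) (ne n) x hx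
    have h2 := G.hE c a (na c).symm x (φ a b x) (by rw [G.φs c a]; exact (key b c n x).not.2 hx)
    rw [G.φs c a] at h2
    tauto
  · intro b c d n1 n2 n3
    exact G.Tne (na b) (na c) (na d) (ne n1) (ne n2) (ne n3)

theorem exists_gt4 (a b c d e : ℝ) : ∃ x, a < x ∧ b < x ∧ c < x ∧ d < x ∧ e < x := by
  have : ∀ᶠ x : ℝ in Filter.atTop, a < x ∧ b < x ∧ c < x ∧ d < x ∧ e < x := by
    simp only [Filter.eventually_and]
    refine ⟨Filter.eventually_gt_atTop _, Filter.eventually_gt_atTop _, Filter.eventually_gt_atTop _, Filter.eventually_gt_atTop _, Filter.eventually_gt_atTop _⟩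
  exact this.exists

theorem exists_lt4 (a b c d e : ℝ) : ∃ x, x < a ∧ x < b ∧ x < c ∧ x < d ∧ x < e := by
  obtain ⟨x, h⟩ := exists_gt4 (-a) (-b) (-c) (-d) (-e)
  exact ⟨-x, by constructor <;> [linarith; refine ⟨?_, ?_, ?_, ?_⟩] <;> linarith⟩

theorem Geo.half_touch (G : Geo f φ T E H) {a b c d e : V} (ab : a ≠ b) (ac : a ≠ c) (ad : a ≠ d)
    (ae : a ≠ e) (bc : b ≠ c) (bd : b ≠ d) (be : b ≠ e) (cd : c ≠ d) (ce : c ≠ e) (de : d ≠ e)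
    (S1 : (0 < f d (T b c a) (φ b c (T b c a)) - f b (T b c a) (φ b c (T b c a)) ∧
      f e (T b c a) (φ b c (T b c a)) - f b (T b c a) (φ b c (T b c a)) < 0) ∨
      (f d (T b c a) (φ b c (T b c a)) - f b (T b c a) (φ b c (T b c a)) < 0 ∧
      0 < f e (T b c a) (φ b c (T b c a)) - f b (T b c a) (φ b c (T b c a))))
    (X0 : ℝ) (h0 : ∀ x, x ≠ X0 → φ b c x ≠ φ d e x)
    (hD : ∀ x x', x ≠ X0 → x' ≠ X0 → (φ d e x < φ b c x ↔ φ d e x' < φ b c x')) :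
    (H b c d ↔ H b c e) ∧ (¬ (H b c a ↔ H b c d) → Imm f φ b c a d e) := by
  have sa := G.sg bc ab.symm ac.symm
  have sd := G.sg bc bd cd
  have se := G.sg bc be ce
  obtain ⟨xp, p1, p2, p3, p4, -⟩ := exists_gt4 X0 (T b c a) (T b c d) (T b c e) 0
  obtain ⟨xm, m1, m2, m3, m4, -⟩ := exists_lt4 X0 (T b c a) (T b c d) (T b c e) 0
  have first : H b c d ↔ H b c e := by
    have h1 := G.hE d e de xp (φ b c xp) (h0 _ p1.ne')
    have h2 := G.hE d e de xm (φ b c xm) (h0 _ m1.ne)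
    have h3 := hD xp xm p1.ne' m1.ne
    have h4 : f e xp (φ b c xp) < f d xp (φ b c xp) ↔ f e xm (φ b c xm) < f d xm (φ b c xm) := by
      rw [h1, h2, h3]
    by_contra hne
    rcases sd.cases with ⟨e1, e2, e3⟩ | ⟨e1, e2, e3⟩ <;> rcases se.cases with ⟨k1, k2, k3⟩ | ⟨k1, k2, k3⟩
    · tauto
    · have q1 := (e2 xp).2 p3
      have q2 := (k3 xp).2 p4
      have q3 := (e3 xm).2 m3
      have q4 := (k2 xm).2 m4
      have := h4.1 (by linarith)
      linarith
    · have q1 := (e3 xp).2 p3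
      have q2 := (k2 xp).2 p4
      have q3 := (e2 xm).2 m3
      have q4 := (k3 xm).2 m4
      have := h4.2 (by linarith)
      linarith
    · tauto
  refine ⟨first, fun hne x => ?_⟩
  have h2 : (0 < f a xp (φ b c xp) - f b xp (φ b c xp) ∧ f d xp (φ b c xp) - f b xp (φ b c xp) < 0 ∧
      f e xp (φ b c xp) - f b xp (φ b c xp) < 0) ∨ (f a xp (φ b c xp) - f b xp (φ b c xp) < 0 ∧
      0 < f d xp (φ b c xp) - f b xp (φ b c xp) ∧ 0 < f e xp (φ b c xp) - f b xp (φ b c xp)) := by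
    rcases sa.cases with ⟨a1, a2, a3⟩ | ⟨a1, a2, a3⟩ <;>
    rcases sd.cases with ⟨e1, e2, e3⟩ | ⟨e1, e2, e3⟩ <;>
    rcases se.cases with ⟨k1, k2, k3⟩ | ⟨k1, k2, k3⟩ <;>
    first
    | (exfalso; clear * - first hne a1 e1 k1; tauto)
    | (left; exact ⟨(a2 _).2 p2, (e3 _).2 p3, (k3 _).2 p4⟩)
    | (right; exact ⟨(a3 _).2 p2, (e2 _).2 p3, (k2 _).2 p4⟩)
  have := imm_abs sa sd se (G.Tne bc bd be cd ce de) S1 h2 x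
  simpa only [sub_pos, sub_neg] using this

theorem Geo.rho (G : Geo f φ T E H) {a b c : V} (n1 : a ≠ b) (n2 : a ≠ c) (n3 : b ≠ c)
    (hR : E b a ↔ H a b c) : E b c ↔ ¬ H b c a := by
  obtain ⟨x, h1, -⟩ := exists_gt4 (T a b c) 0 0 0 0
  have e1 := G.hH a b c n1 n2 n3 x h1.ne'
  have e2 := G.hH b c a n3 n1.symm n2.symm x (by rw [G.Trot n1 n2 n3]; exact h1.ne')
  rw [G.Trot n1 n2 n3] at e2
  have hne : φ b c x ≠ φ a b x := by
    intro e
    have h2 := (G.T0 a b c n1 n2 n3 x).not.2 h1.ne'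
    apply h2
    rw [← e, ← G.on n3, ← (G.φeq a b n1 x _).2 e]
  have e3 := G.hE b c n3 x (φ a b x) hne.symm
  have e4 := G.hE b a n1.symm x (φ b c x) (by rw [G.φs b a]; exact hne)
  rw [G.φs b a] at e4
  have e5 : f c x (φ a b x) < f b x (φ a b x) ↔ ¬ f a x (φ a b x) < f c x (φ a b x) := by
    rw [G.on n1 x, not_lt]
    refine ⟨fun h => h.le, fun h => lt_of_le_of_ne h ?_⟩
    have h2 := (G.T0 a b c n1 n2 n3 x).not.2 h1.ne'
    rwa [G.on n1 x] at h2
  have e6 : f a x (φ b c x) < f b x (φ b c x) ↔ ¬ f b x (φ b c x) < f a x (φ b c x) := by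
    rw [not_lt]
    refine ⟨fun h => h.le, fun h => lt_of_le_of_ne h ?_⟩
    have := (G.φeq a b n1 x (φ b c x)).not.2 hne
    exact this
  have e7 : φ a b x < φ b c x ↔ ¬ φ b c x < φ a b x := by
    rw [not_lt]
    exact ⟨fun h => h.le, fun h => lt_of_le_of_ne h hne.symm⟩
  rw [e5, e1] at e3
  rw [e6, e2, e7] at e4
  simp only [h1, iff_true] at e3 e4
  clear e1 e2 e5 e6 e7 hne
  generalize (φ b c x < φ a b x) = z at *
  by_cases z <;> by_cases E b a <;> simp_all
end

end PartJ

section PartK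

section
variable {V : Type*} {f : V → ℝ → ℝ → ℝ} {φ : V → V → ℝ → ℝ} {T : V → V → V → ℝ}
    {E : V → V → Prop} {H : V → V → V → Prop}

theorem Geo.side (G : Geo f φ T E H) {a b c d e : V} (ab : a ≠ b) (ac : a ≠ c) (ad : a ≠ d)
    (ae : a ≠ e) (bc : b ≠ c) (bd : b ≠ d) (be : b ≠ e) (cd : c ≠ d) (ce : c ≠ e) (de : d ≠ e)
    (x1 y1 : ℝ) (hx : x1 = T a b c) (hy : y1 = φ a b x1)
    (S1 : f a x1 y1 < f d x1 y1 ↔ ¬ f a x1 y1 < f e x1 y1) :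
    ((0 < f d (T b c a) (φ b c (T b c a)) - f b (T b c a) (φ b c (T b c a)) ∧
      f e (T b c a) (φ b c (T b c a)) - f b (T b c a) (φ b c (T b c a)) < 0) ∨
      (f d (T b c a) (φ b c (T b c a)) - f b (T b c a) (φ b c (T b c a)) < 0 ∧
      0 < f e (T b c a) (φ b c (T b c a)) - f b (T b c a) (φ b c (T b c a)))) ∧
    φ b c x1 ≠ φ d e x1 ∧
    (f a x1 y1 < f d x1 y1 ↔ (E d e ↔ φ d e x1 < φ b c x1)) ∧ y1 = φ b c x1 := by
  have hx' : T b c a = x1 := by rw [hx, G.Trot ab ac bc]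
  have hy' : φ b c x1 = y1 := by rw [hy, hx]; exact (G.Tpt ab ac bc).2
  have hab : f a x1 y1 = f b x1 y1 := (G.φeq a b ab _ _).2 hy
  have hac : f b x1 y1 = f c x1 y1 := (G.φeq b c bc _ _).2 hy'.symm
  have hnd : f a x1 y1 ≠ f d x1 y1 := fun e' => G.p5 a b c d ab ac ad bc bd cd x1 y1 hab (hab.trans hac) e'
  have hne : f a x1 y1 ≠ f e x1 y1 := fun e' => G.p5 a b c e ab ac ae bc be ce x1 y1 hab (hab.trans hac) e'
  rw [hx', hy', ← hab]
  have key : (0 < f d x1 y1 - f a x1 y1 ∧ f e x1 y1 - f a x1 y1 < 0) ∨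
      (f d x1 y1 - f a x1 y1 < 0 ∧ 0 < f e x1 y1 - f a x1 y1) := by
    rcases lt_or_gt_of_ne hnd with h | h
    · left
      have := S1.1 h
      refine ⟨by linarith, ?_⟩
      have := lt_of_le_of_ne (not_lt.1 this) hne.symm
      linarith
    · right
      have : f a x1 y1 < f e x1 y1 := by
        by_contra h2
        have := S1.2 h2
        linarith
      exact ⟨by linarith, by linarith⟩
  have hde : f e x1 y1 ≠ f d x1 y1 := by
    rcases key with h | h
    · intro e'; linarith [h.1, h.2]
    · intro e'; linarith [h.1, h.2]
  have hn : y1 ≠ φ d e x1 := fun e' => hde ((G.φeq d e de _ _).2 e').symm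
  refine ⟨key, hn, ?_, rfl⟩
  rw [← G.hE d e de x1 y1 hn]
  rcases key with h | h
  · constructor <;> intro <;> linarith [h.1, h.2]
  · constructor <;> intro <;> linarith [h.1, h.2]

set_option maxHeartbeats 1000000 in
/-- Crossing edges give an immersed pair of corridors. -/
theorem Geo.cross (G : Geo f φ T E H) {a b c d e : V} (ab : a ≠ b) (ac : a ≠ c) (ad : a ≠ d)
    (ae : a ≠ e) (bc : b ≠ c) (bd : b ≠ d) (be : b ≠ e) (cd : c ≠ d) (ce : c ≠ e) (de : d ≠ e)
    (hR1 : E b a ↔ H a b c) (hR2 : E d a ↔ H a d e)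
    (x1 y1 : ℝ) (hx1 : x1 = T a b c) (hy1 : y1 = φ a b x1)
    (x2 y2 : ℝ) (hx2 : x2 = T a d e) (hy2 : y2 = φ a d x2)
    (S1 : f a x1 y1 < f d x1 y1 ↔ ¬ f a x1 y1 < f e x1 y1)
    (S2 : f a x2 y2 < f b x2 y2 ↔ ¬ f a x2 y2 < f c x2 y2)
    (S3 : f a x1 y1 < f d x1 y1 ↔ f a x2 y2 < f c x2 y2) :
    Imm f φ b c a d e ∨ Imm f φ d e a b c := by
  obtain ⟨k1, z1, s1, w1⟩ := G.side ab ac ad ae bc bd be cd ce de x1 y1 hx1 hy1 S1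
  obtain ⟨k2, z2, s2, w2⟩ := G.side ad ae ab ac de bd.symm cd.symm be.symm ce.symm bc x2 y2 hx2 hy2 S2
  have r1 := G.rho ab ac bc hR1
  have r2 := G.rho ad ae de hR2
  -- the sign relation
  have star : (¬ H d e a ↔ φ d e x1 < φ b c x1) ↔ ¬ (¬ H b c a ↔ φ b c x2 < φ d e x2) := by
    rw [← r1, ← r2, ← s1, ← s2, S3, S2, not_not]
  obtain ⟨X0, hX0, hXu⟩ := G.X4 b c d e bc de (fun h => bd h.1) (fun h => be h.1)
  have h0 : ∀ x, x ≠ X0 → φ b c x ≠ φ d e x := fun x hx e' => hx (hXu x e')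
  have hx1X : x1 ≠ X0 := fun e' => z1 (by rw [e']; exact hX0)
  have hx2X : x2 ≠ X0 := fun e' => z2 (by rw [e']; exact hX0.symm)
  have t1 : T b c a = x1 := by rw [hx1, G.Trot ab ac bc]
  have t2 : T d e a = x2 := by rw [hx2, G.Trot ad ae de]
  have sa := G.sg bc ab.symm ac.symm
  have sd := G.sg bc bd cd
  have se := G.sg bc be ce
  have sa' := G.sg de ad.symm ae.symm
  have sb' := G.sg de bd.symm be.symm
  have sc' := G.sg de cd.symm ce.symm
  by_cases both : (∃ x, φ d e x - φ b c x < 0) ∧ (∃ x, 0 < φ d e x - φ b c x)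
  · -- transversal case
    obtain ⟨θ, hθ⟩ := sgn1 (fun x => φ d e x - φ b c x) ((G.φc d e de).sub (G.φc b c bc)) X0
      (by intro x; rw [sub_eq_zero]; exact ⟨fun h => hXu x h.symm, fun h => by rw [h]; exact hX0.symm⟩)
      both.1 both.2
    simp only [sub_pos] at hθ
    have q1 := hθ x1 hx1X
    have q2 := hθ x2 hx2X
    have q3 : φ d e x1 < φ b c x1 ↔ ¬ φ b c x1 < φ d e x1 := by
      rw [not_lt]; exact ⟨fun h => h.le, fun h => lt_of_le_of_ne h z1.symm⟩
    have star2 : (H d e a ↔ X0 < x2) ↔ (H b c a ↔ X0 < x1) := by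
      rw [q3, q1, q2] at star
      clear * - star
      generalize (X0 < x1) = z1 at *
      generalize (X0 < x2) = z2 at *
      generalize H d e a = z3 at *
      generalize H b c a = z4 at *
      by_cases θ <;> by_cases z1 <;> by_cases z2 <;> by_cases z3 <;> by_cases z4 <;> simp_all
    -- at X0
    have p1 := sa.pos X0 (by rw [t1]; exact hx1X.symm)
    have p2 := sa'.pos X0 (by rw [t2]; exact hx2X.symm)
    have e1 : (x1 < X0) ↔ ¬ X0 < x1 := by
      rw [not_lt]; exact ⟨fun h => h.le, fun h => lt_of_le_of_ne h hx1X⟩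
    have e2 : (x2 < X0) ↔ ¬ X0 < x2 := by
      rw [not_lt]; exact ⟨fun h => h.le, fun h => lt_of_le_of_ne h hx2X⟩
    rw [t1, e1] at p1
    rw [t2, e2] at p2
    have p3 : 0 < f a X0 (φ b c X0) - f b X0 (φ b c X0) ↔ 0 < f a X0 (φ d e X0) - f d X0 (φ d e X0) := by
      rw [p1, p2]; clear * - star2; tauto
    have na : f a X0 (φ b c X0) - f b X0 (φ b c X0) ≠ 0 :=
      (sa.eq0 X0).not.2 (by rw [t1]; exact hx1X.symm)
    have na' : f a X0 (φ d e X0) - f d X0 (φ d e X0) ≠ 0 :=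
      (sa'.eq0 X0).not.2 (by rw [t2]; exact hx2X.symm)
    have g1 : f b X0 (φ b c X0) = f c X0 (φ b c X0) := G.on bc X0
    have g2 : f d X0 (φ d e X0) = f e X0 (φ d e X0) := G.on de X0
    have hX0' : φ b c X0 = φ d e X0 := hX0
    have ngh : f b X0 (φ b c X0) ≠ f d X0 (φ b c X0) := fun e' =>
      G.p5 b c d e bc bd be cd ce de X0 (φ b c X0) g1 e' (e'.trans (by rw [hX0']; exact g2))
    rw [← hX0'] at p3 na' g2
    have c1 : ∀ x, (f a x (φ b c x) < f b x (φ b c x) ∨ f d x (φ b c x) < f b x (φ b c x) ∨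
        f e x (φ b c x) < f b x (φ b c x)) ∧ (f b x (φ b c x) < f a x (φ b c x) ∨
        f b x (φ b c x) < f d x (φ b c x) ∨ f b x (φ b c x) < f e x (φ b c x)) ∨ ∀ x,
        (f a x (φ d e x) < f d x (φ d e x) ∨ f b x (φ d e x) < f d x (φ d e x) ∨
        f c x (φ d e x) < f d x (φ d e x)) ∧ (f d x (φ d e x) < f a x (φ d e x) ∨
        f d x (φ d e x) < f b x (φ d e x) ∨ f d x (φ d e x) < f c x (φ d e x)) := by
      intro x
      have l1 := imm_abs (X0 := X0) sa sd se (G.Tne bc bd be cd ce de) k1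
      have l2 := imm_abs (X0 := X0) sa' sb' sc' (G.Tne de bd.symm cd.symm be.symm ce.symm bc) k2
      simp only [sub_pos, sub_neg] at l1 l2 p3
      rw [← hX0'] at l2
      rw [← g2] at l1
      rw [← g1] at l2
      rw [sub_ne_zero] at na na'
      rcases lt_or_gt_of_ne ngh with hgh | hgh
      · by_cases hp : f b X0 (φ b c X0) < f a X0 (φ b c X0)
        · have := p3.1 hp
          right
          exact l2 (Or.inl ⟨this, hgh, hgh⟩)
        · left
          exact l1 (Or.inr ⟨lt_of_le_of_ne (not_lt.1 hp) na, hgh, hgh⟩) x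
      · by_cases hp : f b X0 (φ b c X0) < f a X0 (φ b c X0)
        · left
          exact l1 (Or.inl ⟨hp, hgh, hgh⟩) x
        · right
          have : ¬ f d X0 (φ b c X0) < f a X0 (φ b c X0) := fun h => hp (p3.2 h)
          exact l2 (Or.inr ⟨lt_of_le_of_ne (not_lt.1 this) na', hgh, hgh⟩)
    by_cases hh : Imm f φ d e a b c
    · exact Or.inr hh
    · left
      intro x
      exact (c1 x).resolve_right hh
  · -- touching case
    have cs : ∀ x, x ≠ X0 → (φ d e x < φ b c x ↔ ¬ φ b c x < φ d e x) := by
      intro x hx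
      rw [not_lt]; exact ⟨fun h => h.le, fun h => lt_of_le_of_ne h (h0 x hx).symm⟩
    have hD : ∀ x x', x ≠ X0 → x' ≠ X0 → (φ d e x < φ b c x ↔ φ d e x' < φ b c x') := by
      have aux : ∀ x x', x ≠ X0 → x' ≠ X0 → φ d e x < φ b c x → φ d e x' < φ b c x' := by
        intro x x' hx hx' h
        by_contra h2
        rw [cs x' hx', not_not] at h2
        exact both ⟨⟨x, by linarith⟩, ⟨x', by linarith⟩⟩
      exact fun x x' hx hx' => ⟨aux x x' hx hx', aux x' x hx' hx⟩
    have hD' : ∀ x x', x ≠ X0 → x' ≠ X0 → (φ b c x < φ d e x ↔ φ b c x' < φ d e x') := by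
      intro x x' hx hx'
      have := hD x x' hx hx'
      rw [cs x hx, cs x' hx'] at this
      exact not_iff_not.1 this
    obtain ⟨a1, a2⟩ := G.half_touch ab ac ad ae bc bd be cd ce de k1 X0 h0 hD
    obtain ⟨b1, b2⟩ := G.half_touch ad ae ab ac de bd.symm cd.symm be.symm ce.symm bc k2 X0
      (fun x hx => (h0 x hx).symm) hD'
    by_cases c1 : H b c a ↔ H b c d
    swap
    · exact Or.inl (a2 c1)
    by_cases c2 : H d e a ↔ H d e b
    swap
    · exact Or.inr (b2 c2)
    exfalso
    have hh : H b c a ↔ H d e a := by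
      have h1 := cs x1 hx1X
      have h2 := hD' x1 x2 hx1X hx2X
      rw [h1, h2] at star
      clear * - star
      generalize (φ b c x2 < φ d e x2) = z at *
      generalize H d e a = z3 at *
      generalize H b c a = z4 at *
      by_cases z <;> by_cases z3 <;> by_cases z4 <;> simp_all
    have hdb : H b c d ↔ H d e b := by rw [← c1, ← c2, hh]
    obtain ⟨xp, p1, p2, p3, -⟩ := exists_gt4 X0 (T b c d) (T d e b) 0 0
    obtain ⟨xm, m1, m2, m3, -⟩ := exists_lt4 X0 (T b c d) (T d e b) 0 0
    have hn1 : ∀ x, x ≠ T b c d → φ b c x ≠ φ d b x := by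
      intro x hx e'
      have h1 := (G.T0 b c d bc bd cd x).not.2 hx
      exact h1 ((G.φeq d b bd.symm x _).2 e')
    have hn2 : ∀ x, x ≠ T d e b → φ d e x ≠ φ d b x := by
      intro x hx e'
      have h1 := (G.T0 d e b de bd.symm be.symm x).not.2 hx
      exact h1 ((G.φeq d b bd.symm x _).2 e').symm
    have final : ∀ x, x ≠ X0 → x ≠ T b c d → x ≠ T d e b → (T b c d < x ↔ T d e b < x) →
        (φ d e x < φ b c x ↔ (E d b ↔ (H b c d ↔ T b c d < x))) := by
      intro x hx hxd hxb hT
      have h1 := sd.pos x hxd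
      have h2 := sb'.pos x hxb
      rw [sub_pos] at h1 h2
      have h3 := G.hE d b bd.symm x (φ b c x) (hn1 x hxd)
      have h4 := G.hE d b bd.symm x (φ d e x) (hn2 x hxb)
      have h5 : f b x (φ d e x) < f d x (φ d e x) ↔ ¬ f d x (φ d e x) < f b x (φ d e x) := by
        rw [not_lt]
        refine ⟨fun h => h.le, fun h => lt_of_le_of_ne h ?_⟩
        exact (G.T0 d e b de bd.symm be.symm x).not.2 hxb
      rw [h3] at h1
      rw [h5, h2, ← hdb, ← hT] at h4
      rw [← h1] at h4 ⊢
      clear * - h4 hn1 hn2 hxd hxb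
      have o1 := lt_or_gt_of_ne (hn1 x hxd)
      have o2 := lt_or_gt_of_ne (hn2 x hxb)
      have h6 : (φ d b x < φ b c x) ↔ ¬ φ d b x < φ d e x := by
        clear o1 o2 hn1 hn2
        generalize E d b = z1 at *
        generalize (φ d b x < φ b c x) = z2 at *
        generalize (φ d b x < φ d e x) = z3 at *
        by_cases z1 <;> by_cases z2 <;> by_cases z3 <;> simp_all
      have h7 : (E d b ↔ (E d b ↔ φ d b x < φ b c x)) ↔ φ d b x < φ b c x := by
        generalize E d b = z1
        generalize (φ d b x < φ b c x) = z2
        by_cases z1 <;> by_cases z2 <;> simp_all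
      rw [h7]
      rcases o1 with o1 | o1
      · have : φ d b x < φ d e x := by
          by_contra hc
          have := h6.2 hc
          linarith
        constructor <;> intro <;> linarith
      · have h8 := h6.1 o1
        have o2 : φ d e x < φ d b x := o2.resolve_right h8
        constructor <;> intro <;> linarith
    have f1 := final xp p1.ne' p2.ne' p3.ne' (by simp [p2, p3])
    have f2 := final xm m1.ne m2.ne m3.ne (iff_of_false (by linarith) (by linarith))
    have f3 := hD xp xm p1.ne' m1.ne
    have f4 : ¬ T b c d < xm := by linarith
    rw [f1, f2] at f3
    simp only [p2, f4, iff_true, iff_false] at f3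
    clear * - f3
    by_cases E d b <;> by_cases H b c d <;> simp_all
end

end PartK

section PartM

section
variable {V : Type*} {f : V → ℝ → ℝ → ℝ} {φ : V → V → ℝ → ℝ} {T : V → V → V → ℝ}
    {E : V → V → Prop} {H : V → V → V → Prop}

theorem half_card {β : Type*} (S : Finset β) (σ : β → β) (hσ : ∀ x, σ (σ x) = x)
    (hS : ∀ x ∈ S, σ x ∈ S) (P : β → Prop) [DecidablePred P] (hP : ∀ x ∈ S, (P (σ x) ↔ ¬ P x)) :
    S.card = 2 * (S.filter P).card := by
  have h1 : (S.filter P).card = (S.filter fun x => ¬ P x).card := by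
    refine Finset.card_bij (fun x _ => σ x) ?_ ?_ ?_
    · intro x hx
      rw [Finset.mem_filter] at hx ⊢
      refine ⟨hS x hx.1, ?_⟩
      rw [hP x hx.1, not_not]; exact hx.2
    · intro x _ y _ h
      have := congrArg σ h
      rwa [hσ, hσ] at this
    · intro x hx
      rw [Finset.mem_filter] at hx
      refine ⟨σ x, ?_, hσ x⟩
      rw [Finset.mem_filter]
      exact ⟨hS x hx.1, (hP x hx.1).2 hx.2⟩
  have h2 := Finset.card_filter_add_card_filter_not (s := S) P
  omega

theorem prop_pR (s t h : Prop) : (s ↔ (t ↔ (t ↔ h))) ↔ (s ↔ h) := by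
  by_cases s <;> by_cases t <;> by_cases h <;> simp [*]

theorem prop_pC (b c d h h' o : Prop) (hr : b ↔ h) :
    (b ↔ (c ↔ (d ↔ ((c ↔ h) ↔ ((d ↔ h') ↔ ¬ o))))) ↔ ¬ (h' ↔ o) := by
  by_cases b <;> by_cases c <;> by_cases d <;> by_cases h <;> by_cases h' <;> by_cases o <;> simp_all

theorem Geo.forest (G : Geo f φ T E H) (a : V) (W : Finset V) (ha : a ∉ W) (S : Finset (V × V))
    (hS : ∀ p ∈ S, p.1 ∈ W ∧ p.2 ∈ W ∧ p.1 ≠ p.2 ∧ (E p.1 a ↔ H a p.1 p.2))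
    (hn : ∀ b c d e, (b, c) ∈ S → (d, e) ∈ S → b ≠ c → b ≠ d → b ≠ e → c ≠ d → c ≠ e → d ≠ e →
      ¬ (Imm f φ b c a d e ∨ Imm f φ d e a b c)) : S.card ≤ 4 * W.card := by
  have hP := G.pline a (↑W : Set V) (by simpa using ha)
  have hχ := hP.chiAx (fun b => E b a)
  let S' : Finset ((↑W : Set V) × (↑W : Set V)) := Finset.univ.filter fun p => (p.1.1, p.2.1) ∈ S
  have na : ∀ b : (↑W : Set V), a ≠ b := fun b e => ha (by rw [e]; exact b.2)
  have ne : ∀ {b c : (↑W : Set V)}, b ≠ c → (b : V) ≠ c := fun h e => h (Subtype.ext e)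
  have hc : S.card = S'.card := by
    symm
    refine Finset.card_bij (fun p _ => (p.1.1, p.2.1)) ?_ ?_ ?_
    · intro p hp
      exact (Finset.mem_filter.1 hp).2
    · intro p _ q _ h
      rw [Prod.mk.injEq] at h
      exact Prod.ext (Subtype.ext h.1) (Subtype.ext h.2)
    · rintro ⟨b, c⟩ hp
      obtain ⟨h1, h2, -⟩ := hS _ hp
      exact ⟨(⟨b, h1⟩, ⟨c, h2⟩), Finset.mem_filter.2 ⟨Finset.mem_univ _, hp⟩, rfl⟩
  have key : ∀ b c d : (↑W : Set V), b ≠ c → b ≠ d → c ≠ d → (E b a ↔ H a b c) →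
      (pC (fun b : (↑W : Set V) => E b a) (fun b c => (E c a ↔ H a b c)) (fun b c => T a b c) b c d ↔
        ¬ f a (T a b c) (φ a b (T a b c)) < f d (T a b c) (φ a b (T a b c))) := by
    intro b c d n1 n2 n3 hr
    have hT : T a b c ≠ T a b d := G.Tne (na b) (na c) (na d) (ne n1) (ne n2) (ne n3)
    rw [G.hH a b d (na b) (na d) (ne n2) _ hT]
    have e1 : T a b c < T a b d ↔ ¬ T a b d < T a b c := by
      rw [not_lt]; exact ⟨fun h => h.le, fun h => lt_of_le_of_ne h hT⟩
    unfold pC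
    rw [e1]
    exact prop_pC _ _ _ _ _ _ hr
  have main := forest_bound hχ S' ?_ ?_
  · rw [hc]
    simpa using main
  · intro p hp
    have h1 := hS _ (Finset.mem_filter.1 hp).2
    refine ⟨fun e => h1.2.2.1 (by rw [e]), ?_⟩
    unfold pR
    rw [prop_pR]
    exact h1.2.2.2
  · intro b c d e h1 h2 bc bd be cd ce de hh
    have h1 := (Finset.mem_filter.1 h1).2
    have h2 := (Finset.mem_filter.1 h2).2
    have r1 := (hS _ h1).2.2.2
    have r2 := (hS _ h2).2.2.2
    obtain ⟨s1, s2, s3⟩ := hh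
    rw [key b c d bc bd cd r1, key b c e bc be ce r1, not_iff_not] at s1
    rw [key d e b de bd.symm be.symm r2, key d e c de cd.symm ce.symm r2, not_iff_not] at s2
    rw [key b c d bc bd cd r1, key d e c de cd.symm ce.symm r2, not_iff_not] at s3
    exact hn b c d e h1 h2 (ne bc) (ne bd) (ne be) (ne cd) (ne ce) (ne de)
      (G.cross (na b) (na c) (na d) (na e) (ne bc) (ne bd) (ne be) (ne cd) (ne ce) (ne de) r1 r2
        _ _ rfl rfl _ _ rfl rfl s1 s2 s3)

/-- two disjoint pairs -/
def Dj (p q : V × V) : Prop := p.1 ≠ q.1 ∧ p.1 ≠ q.2 ∧ p.2 ≠ q.1 ∧ p.2 ≠ q.2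

theorem Geo.del (G : Geo f φ T E H) (a : V) (W : Finset V) (ha : a ∉ W) : ∀ (n : ℕ) (S : Finset (V × V)),
    S.card = n →
    (∀ p ∈ S, p.1 ∈ W ∧ p.2 ∈ W ∧ p.1 ≠ p.2 ∧ (E p.1 a ↔ H a p.1 p.2)) →
    S.card ≤ 4 * W.card +
      ((S ×ˢ S).filter fun q => Dj q.1 q.2 ∧ Imm f φ q.1.1 q.1.2 a q.2.1 q.2.2).card := by
  intro n
  induction n with
  | zero => intro S h _; omega
  | succ n ih =>
    intro S hc hS
    by_cases hn : ∀ b c d e, (b, c) ∈ S → (d, e) ∈ S → b ≠ c → b ≠ d → b ≠ e → c ≠ d → c ≠ e → d ≠ e →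
      ¬ (Imm f φ b c a d e ∨ Imm f φ d e a b c)
    · have := G.forest a W ha S hS hn
      omega
    · have : ∃ p ∈ S, ∃ q ∈ S, Dj p q ∧ Imm f φ p.1 p.2 a q.1 q.2 := by
        push Not at hn
        obtain ⟨b, c, d, e, h1, h2, bc, bd, be, cd, ce, de, h⟩ := hn
        rcases h with h | h
        · exact ⟨_, h1, _, h2, ⟨bd, be, cd, ce⟩, h⟩
        · exact ⟨_, h2, _, h1, ⟨bd.symm, cd.symm, be.symm, ce.symm⟩, h⟩
      obtain ⟨p, hp, q, hq, hD, hI⟩ := this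
      have h1 := ih (S.erase p) (by rw [Finset.card_erase_of_mem hp]; omega)
        (fun r hr => hS r (Finset.mem_of_mem_erase hr))
      have h2 : (((S.erase p) ×ˢ (S.erase p)).filter fun q => Dj q.1 q.2 ∧ Imm f φ q.1.1 q.1.2 a q.2.1 q.2.2).card <
          ((S ×ˢ S).filter fun q => Dj q.1 q.2 ∧ Imm f φ q.1.1 q.1.2 a q.2.1 q.2.2).card := by
        apply Finset.card_lt_card
        rw [Finset.ssubset_iff_of_subset]
        · refine ⟨(p, q), ?_, ?_⟩
          · simp only [Finset.mem_filter, Finset.mem_product]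
            exact ⟨⟨hp, hq⟩, hD, hI⟩
          · simp
        · intro r hr
          simp only [Finset.mem_filter, Finset.mem_product, Finset.mem_erase] at hr ⊢
          tauto
      rw [Finset.card_erase_of_mem hp] at h1
      omega

theorem Imm.sw1 (G : Geo f φ T E H) {a b c d e : V} (bc : b ≠ c) :
    Imm f φ b c a d e ↔ Imm f φ c b a d e := by
  unfold Imm
  refine forall_congr' fun x => ?_
  rw [G.φs c b, G.on bc x]

theorem Imm.sw2 {a b c d e : V} : Imm f φ b c a d e ↔ Imm f φ b c a e d := by
  unfold Imm
  refine forall_congr' fun x => ?_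
  rw [or_comm (a := f d x (φ b c x) < f b x (φ b c x)), or_comm (a := f b x (φ b c x) < f d x (φ b c x))]

theorem Imm.sw3 {a b c d e : V} : Imm f φ b c a d e ↔ Imm f φ b c d a e := by
  unfold Imm
  refine forall_congr' fun x => ?_
  rw [or_left_comm, or_left_comm (a := f b x (φ b c x) < f a x (φ b c x))]

theorem Geo.Ranti (G : Geo f φ T E H) {a b c : V} (ab : a ≠ b) (ac : a ≠ c) (bc : b ≠ c) :
    (E b a ↔ H a b c) ↔ ¬ (E c a ↔ H a c b) := by
  have hP := G.pline a ({b, c} : Set V) (by simp [ab, ac])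
  have hχ := hP.chiAx (fun b => E b a)
  have := hχ.anti ⟨b, by simp⟩ ⟨c, by simp⟩ (fun e => bc (congrArg Subtype.val e))
  unfold pR at this
  rw [prop_pR, prop_pR] at this
  exact this

theorem Geo.loc (G : Geo f φ T E H) (K : V → V → V → Prop) (hK : ∀ a b c, K a b c → K a c b)
    (a : V) (W : Finset V) (ha : a ∉ W) :
    2 * ((W ×ˢ W).filter fun p => p.1 ≠ p.2 ∧ K a p.1 p.2).card ≤ 16 * W.card +
      (((W ×ˢ W) ×ˢ (W ×ˢ W)).filter fun q => (q.1.1 ≠ q.1.2 ∧ K a q.1.1 q.1.2) ∧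
        (q.2.1 ≠ q.2.2 ∧ K a q.2.1 q.2.2) ∧ Dj q.1 q.2 ∧ Imm f φ q.1.1 q.1.2 a q.2.1 q.2.2).card := by
  have na : ∀ {b}, b ∈ W → a ≠ b := fun h e => ha (e ▸ h)
  have h1 := half_card ((W ×ˢ W).filter fun p => p.1 ≠ p.2 ∧ K a p.1 p.2) Prod.swap (fun x => rfl)
    (by
      rintro ⟨b, c⟩ h
      simp only [Finset.mem_filter, Finset.mem_product, Prod.swap] at h ⊢
      exact ⟨h.1.symm, h.2.1.symm, hK _ _ _ h.2.2⟩) (fun p => E p.1 a ↔ H a p.1 p.2)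
    (by
      rintro ⟨b, c⟩ h
      simp only [Finset.mem_filter, Finset.mem_product, Prod.swap] at h ⊢
      exact G.Ranti (na h.1.2) (na h.1.1) h.2.1.symm)
  have h2 := half_card (((W ×ˢ W) ×ˢ (W ×ˢ W)).filter fun q => (q.1.1 ≠ q.1.2 ∧ K a q.1.1 q.1.2) ∧
        (q.2.1 ≠ q.2.2 ∧ K a q.2.1 q.2.2) ∧ Dj q.1 q.2 ∧ Imm f φ q.1.1 q.1.2 a q.2.1 q.2.2)
    (fun q => (q.1.swap, q.2)) (fun x => rfl)
    (by
      rintro ⟨⟨b, c⟩, ⟨d, e⟩⟩ h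
      simp only [Finset.mem_filter, Finset.mem_product, Prod.swap] at h ⊢
      unfold Dj at *
      rw [← Imm.sw1 G h.2.1.1]
      have := hK _ _ _ h.2.1.2
      have := h.2.1.1.symm
      tauto) (fun q => E q.1.1 a ↔ H a q.1.1 q.1.2)
    (by
      rintro ⟨⟨b, c⟩, ⟨d, e⟩⟩ h
      simp only [Finset.mem_filter, Finset.mem_product, Prod.swap] at h ⊢
      exact G.Ranti (na h.1.1.2) (na h.1.1.1) h.2.1.1.symm)
  have h3 := half_card ((((W ×ˢ W) ×ˢ (W ×ˢ W)).filter fun q => (q.1.1 ≠ q.1.2 ∧ K a q.1.1 q.1.2) ∧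
        (q.2.1 ≠ q.2.2 ∧ K a q.2.1 q.2.2) ∧ Dj q.1 q.2 ∧ Imm f φ q.1.1 q.1.2 a q.2.1 q.2.2).filter
        (fun q => E q.1.1 a ↔ H a q.1.1 q.1.2))
    (fun q => (q.1, q.2.swap)) (fun x => rfl)
    (by
      rintro ⟨⟨b, c⟩, ⟨d, e⟩⟩ h
      simp only [Finset.mem_filter, Finset.mem_product, Prod.swap] at h ⊢
      unfold Dj at *
      rw [← Imm.sw2]
      have := hK _ _ _ h.1.2.2.1.2
      have := h.1.2.2.1.1.symm
      exact ⟨by tauto, h.2⟩) (fun q => E q.2.1 a ↔ H a q.2.1 q.2.2)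
    (by
      rintro ⟨⟨b, c⟩, ⟨d, e⟩⟩ h
      simp only [Finset.mem_filter, Finset.mem_product, Prod.swap] at h ⊢
      exact G.Ranti (na h.1.1.2.2) (na h.1.1.2.1) h.1.2.2.1.1.symm)
  rw [h1, h2, h3]
  have h4 := G.del a W ha _ (((W ×ˢ W).filter fun p => p.1 ≠ p.2 ∧ K a p.1 p.2).filter
    fun p => E p.1 a ↔ H a p.1 p.2) rfl (by
      rintro ⟨b, c⟩ h
      simp only [Finset.mem_filter, Finset.mem_product] at h ⊢
      exact ⟨h.1.1.1, h.1.1.2, h.1.2.1, h.2⟩)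
  refine le_trans (Nat.mul_le_mul_left 2 (Nat.mul_le_mul_left 2 h4)) ?_
  have h5 : ((((W ×ˢ W).filter fun p => p.1 ≠ p.2 ∧ K a p.1 p.2).filter fun p => E p.1 a ↔ H a p.1 p.2) ×ˢ
      (((W ×ˢ W).filter fun p => p.1 ≠ p.2 ∧ K a p.1 p.2).filter fun p => E p.1 a ↔ H a p.1 p.2)).filter
        (fun q => Dj q.1 q.2 ∧ Imm f φ q.1.1 q.1.2 a q.2.1 q.2.2) ⊆
      ((((W ×ˢ W) ×ˢ (W ×ˢ W)).filter fun q => (q.1.1 ≠ q.1.2 ∧ K a q.1.1 q.1.2) ∧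
        (q.2.1 ≠ q.2.2 ∧ K a q.2.1 q.2.2) ∧ Dj q.1 q.2 ∧ Imm f φ q.1.1 q.1.2 a q.2.1 q.2.2).filter
        (fun q => E q.1.1 a ↔ H a q.1.1 q.1.2)).filter (fun q => E q.2.1 a ↔ H a q.2.1 q.2.2) := by
    rintro ⟨⟨b, c⟩, ⟨d, e⟩⟩ h
    simp only [Finset.mem_filter, Finset.mem_product] at h ⊢
    exact ⟨⟨⟨⟨h.1.1.1.1, h.1.2.1.1⟩, h.1.1.1.2, h.1.2.1.2, h.2⟩, h.1.1.2⟩, h.1.2.2⟩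
  have := Finset.card_le_card h5
  omega
end

end PartM

section PartQ

theorem card_fib {V β : Type*} (L : Finset V) (S : Finset (V × β)) (A : V → Finset β)
    (h : ∀ a x, (a, x) ∈ S ↔ a ∈ L ∧ x ∈ A a) : S.card = ∑ a ∈ L, (A a).card := by
  rw [← Finset.card_sigma]
  refine Finset.card_bij (fun p _ => ⟨p.1, p.2⟩) ?_ ?_ ?_
  · rintro ⟨a, x⟩ hp
    rw [Finset.mem_sigma]
    exact (h a x).1 hp
  · rintro ⟨a, x⟩ _ ⟨b, y⟩ _ e
    simp only [Sigma.mk.injEq, heq_eq_eq] at e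
    exact Prod.ext e.1 e.2
  · rintro ⟨a, x⟩ hp
    rw [Finset.mem_sigma] at hp
    exact ⟨(a, x), (h a x).2 hp, rfl⟩

theorem card_color {V : Type*} [Fintype V] (m : ℕ) (U : Finset V) :
    ((Finset.univ : Finset (V → Fin (m + 1))).filter fun g => ∀ v ∈ U, g v = 0).card * (m + 1) ^ U.card
      = (m + 1) ^ Fintype.card V := by
  have h1 : ((Finset.univ : Finset (V → Fin (m + 1))).filter fun g => ∀ v ∈ U, g v = 0) =
      Fintype.piFinset (fun v => if v ∈ U then ({0} : Finset (Fin (m + 1))) else Finset.univ) := by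
    ext g
    simp only [Finset.mem_filter, Finset.mem_univ, true_and, Fintype.mem_piFinset]
    refine forall_congr' fun v => ?_
    by_cases h : v ∈ U <;> simp [h]
  rw [h1, Fintype.card_piFinset]
  have h2 : ∀ v, (if v ∈ U then ({0} : Finset (Fin (m + 1))) else Finset.univ).card = if v ∈ U then 1 else m + 1 := by
    intro v
    by_cases h : v ∈ U <;> simp [h]
  have h3 : (m + 1) ^ U.card = ∏ v : V, if v ∈ U then (m + 1) else 1 := by
    rw [Finset.prod_ite_mem, Finset.univ_inter, Finset.prod_const]
  rw [Finset.prod_congr rfl (fun v _ => h2 v), h3, ← Finset.prod_mul_distrib,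
    ← Finset.card_univ, ← Finset.prod_const]
  refine Finset.prod_congr rfl fun v _ => ?_
  by_cases h : v ∈ U <;> simp [h]

theorem sum_color {V β : Type*} [Fintype V] (m j : ℕ) (S : Finset β) (supp : β → Finset V)
    (hs : ∀ x ∈ S, (supp x).card = j) :
    (∑ g : V → Fin (m + 1), (S.filter fun x => ∀ v ∈ supp x, v ∈ Finset.univ.filter fun v => g v = 0).card) *
      (m + 1) ^ j = S.card * (m + 1) ^ Fintype.card V := by
  have h1 : (∑ g : V → Fin (m + 1), (S.filter fun x => ∀ v ∈ supp x, v ∈ Finset.univ.filter fun v => g v = 0).card)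
      = ∑ x ∈ S, ((Finset.univ : Finset (V → Fin (m + 1))).filter fun g => ∀ v ∈ supp x, g v = 0).card := by
    simp only [Finset.card_filter, Finset.mem_filter, Finset.mem_univ, true_and]
    exact Finset.sum_comm
  rw [h1, Finset.sum_mul]
  rw [Finset.sum_congr rfl (g := fun _ => (m + 1) ^ Fintype.card V)]
  · simp
  · intro x hx
    rw [← hs x hx]
    exact card_color m _

section
variable {V : Type*} {f : V → ℝ → ℝ → ℝ} {φ : V → V → ℝ → ℝ} {T : V → V → V → ℝ}
    {E : V → V → Prop} {H : V → V → V → Prop}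

def P3 (K : V → V → V → Prop) (t : V × V × V) : Prop :=
  t.1 ≠ t.2.1 ∧ t.1 ≠ t.2.2 ∧ t.2.1 ≠ t.2.2 ∧ K t.1 t.2.1 t.2.2

def P5 (f : V → ℝ → ℝ → ℝ) (φ : V → V → ℝ → ℝ) (K : V → V → V → Prop)
    (t : V × (V × V) × (V × V)) : Prop :=
  (t.1 ≠ t.2.1.1 ∧ t.1 ≠ t.2.1.2 ∧ t.1 ≠ t.2.2.1 ∧ t.1 ≠ t.2.2.2) ∧
  (t.2.1.1 ≠ t.2.1.2 ∧ K t.1 t.2.1.1 t.2.1.2) ∧ (t.2.2.1 ≠ t.2.2.2 ∧ K t.1 t.2.2.1 t.2.2.2) ∧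
  Dj t.2.1 t.2.2 ∧ Imm f φ t.2.1.1 t.2.1.2 t.1 t.2.2.1 t.2.2.2

theorem Geo.glob [Fintype V] (G : Geo f φ T E H) (K : V → V → V → Prop) (hK : ∀ a b c, K a b c → K a c b)
    (L : Finset V) :
    2 * ((Finset.univ.filter (P3 K)).filter fun t => ∀ v ∈ ({t.1, t.2.1, t.2.2} : Finset V), v ∈ L).card ≤
      16 * (((Finset.univ : Finset (V × V)).filter fun p => p.1 ≠ p.2).filter
        fun t => ∀ v ∈ ({t.1, t.2} : Finset V), v ∈ L).card +
      ((Finset.univ.filter (P5 f φ K)).filter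
        fun t => ∀ v ∈ ({t.1, t.2.1.1, t.2.1.2, t.2.2.1, t.2.2.2} : Finset V), v ∈ L).card := by
  rw [card_fib L _ (fun a => ((L.erase a ×ˢ L.erase a).filter fun p => p.1 ≠ p.2 ∧ K a p.1 p.2)),
    card_fib L _ (fun a => L.erase a),
    card_fib L _ (fun a => (((L.erase a ×ˢ L.erase a) ×ˢ (L.erase a ×ˢ L.erase a)).filter
      fun q => (q.1.1 ≠ q.1.2 ∧ K a q.1.1 q.1.2) ∧
        (q.2.1 ≠ q.2.2 ∧ K a q.2.1 q.2.2) ∧ Dj q.1 q.2 ∧ Imm f φ q.1.1 q.1.2 a q.2.1 q.2.2))]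
  · rw [Finset.mul_sum, Finset.mul_sum, ← Finset.sum_add_distrib]
    refine Finset.sum_le_sum fun a _ => ?_
    exact G.loc K hK a (L.erase a) (by simp)
  · rintro a ⟨⟨b, c⟩, ⟨d, e⟩⟩
    simp only [Finset.mem_filter, Finset.mem_univ, true_and, P5, Finset.mem_insert, Finset.mem_singleton,
      forall_eq_or_imp, forall_eq, Finset.mem_product, Finset.mem_erase]
    constructor
    · rintro ⟨⟨⟨h1, h2, h3, h4⟩, h5⟩, ⟨h6, h7, h8, h9, h10⟩⟩
      exact ⟨h6, ⟨⟨⟨h1.symm, h7⟩, h2.symm, h8⟩, ⟨h3.symm, h9⟩, h4.symm, h10⟩, h5⟩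
    · rintro ⟨h6, ⟨⟨⟨h1, h7⟩, h2, h8⟩, ⟨h3, h9⟩, h4, h10⟩, h5⟩
      exact ⟨⟨⟨h1.symm, h2.symm, h3.symm, h4.symm⟩, h5⟩, ⟨h6, h7, h8, h9, h10⟩⟩
  · rintro a b
    simp only [Finset.mem_filter, Finset.mem_univ, true_and, Finset.mem_insert, Finset.mem_singleton,
      forall_eq_or_imp, forall_eq, Finset.mem_erase]
    constructor
    · rintro ⟨h1, h2, h3⟩
      exact ⟨h2, h1.symm, h3⟩
    · rintro ⟨h2, h1, h3⟩
      exact ⟨h1.symm, h2, h3⟩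
  · rintro a ⟨b, c⟩
    simp only [Finset.mem_filter, Finset.mem_univ, true_and, P3, Finset.mem_insert, Finset.mem_singleton,
      forall_eq_or_imp, forall_eq, Finset.mem_product, Finset.mem_erase]
    constructor
    · rintro ⟨⟨h1, h2, h3, h4⟩, ⟨h6, h7, h8⟩⟩
      exact ⟨h6, ⟨⟨h1.symm, h7⟩, h2.symm, h8⟩, h3, h4⟩
    · rintro ⟨h6, ⟨⟨h1, h7⟩, h2, h8⟩, h3, h4⟩
      exact ⟨⟨h1.symm, h2.symm, h3, h4⟩, ⟨h6, h7, h8⟩⟩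

theorem Geo.sample [Fintype V] (G : Geo f φ T E H) (K : V → V → V → Prop) (hK : ∀ a b c, K a b c → K a c b)
    (q : ℕ) (hq : 1 ≤ q) :
    2 * (Finset.univ.filter (P3 K)).card * q ^ 2 ≤ 16 * (Fintype.card V) ^ 2 * q ^ 3 +
      (Finset.univ.filter (P5 f φ K)).card := by
  obtain ⟨m, rfl⟩ := Nat.exists_eq_add_of_le' hq
  have s3 := sum_color (V := V) m 3 (Finset.univ.filter (P3 K)) (fun t => {t.1, t.2.1, t.2.2}) (by
    rintro ⟨a, b, c⟩ h
    simp only [Finset.mem_filter, Finset.mem_univ, true_and, P3] at h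
    obtain ⟨h1, h2, h3, -⟩ := h
    simp [h1, h2, h3])
  have s2 := sum_color (V := V) m 2 ((Finset.univ : Finset (V × V)).filter fun p => p.1 ≠ p.2)
    (fun t => {t.1, t.2}) (by
    rintro ⟨a, b⟩ h
    simp only [Finset.mem_filter, Finset.mem_univ, true_and] at h
    simp [h])
  have s5 := sum_color (V := V) m 5 (Finset.univ.filter (P5 f φ K))
    (fun t => {t.1, t.2.1.1, t.2.1.2, t.2.2.1, t.2.2.2}) (by
    rintro ⟨a, ⟨b, c⟩, ⟨d, e⟩⟩ h
    simp only [Finset.mem_filter, Finset.mem_univ, true_and, P5, Dj] at h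
    obtain ⟨⟨h1, h2, h3, h4⟩, ⟨h5, -⟩, ⟨h6, -⟩, ⟨h7, h8, h9, h10⟩, -⟩ := h
    simp [h1, h2, h3, h4, h5, h6, h7, h8, h9, h10])
  have hs := Finset.sum_le_sum (s := (Finset.univ : Finset (V → Fin (m + 1))))
    (fun g _ => G.glob K hK (Finset.univ.filter fun v => g v = 0))
  rw [Finset.sum_add_distrib, ← Finset.mul_sum, ← Finset.mul_sum] at hs
  generalize (∑ g : V → Fin (m + 1), ((Finset.univ.filter (P3 K)).filter fun x => ∀ v ∈ ({x.1, x.2.1, x.2.2} : Finset V), v ∈ Finset.univ.filter fun v => g v = 0).card) = A at hs s3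
  generalize (∑ g : V → Fin (m + 1), (((Finset.univ : Finset (V × V)).filter fun p => p.1 ≠ p.2).filter fun x => ∀ v ∈ ({x.1, x.2} : Finset V), v ∈ Finset.univ.filter fun v => g v = 0).card) = B at hs s2
  generalize (∑ g : V → Fin (m + 1), ((Finset.univ.filter (P5 f φ K)).filter fun x => ∀ v ∈ ({x.1, x.2.1.1, x.2.1.2, x.2.2.1, x.2.2.2} : Finset V), v ∈ Finset.univ.filter fun v => g v = 0).card) = C at hs s5
  have hn2 : ((Finset.univ : Finset (V × V)).filter fun p => p.1 ≠ p.2).card ≤ (Fintype.card V) ^ 2 := by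
    refine (Finset.card_filter_le _ _).trans ?_
    simp [sq]
  generalize ((Finset.univ : Finset (V × V)).filter fun p => p.1 ≠ p.2).card = n2 at *
  generalize (Finset.univ.filter (P3 K)).card = N at *
  generalize (Finset.univ.filter (P5 f φ K)).card = X at *
  have hpos : 0 < (m + 1) ^ Fintype.card V := by positivity
  generalize (m + 1) ^ Fintype.card V = Z at *
  generalize m + 1 = q at *
  refine Nat.le_of_mul_le_mul_right ?_ hpos
  calc 2 * N * q ^ 2 * Z = 2 * (N * Z) * q ^ 2 := by ring
    _ = (2 * A) * q ^ 5 := by rw [← s3]; ring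
    _ ≤ (16 * B + C) * q ^ 5 := Nat.mul_le_mul_right _ hs
    _ = 16 * (B * q ^ 2) * q ^ 3 + C * q ^ 5 := by ring
    _ = 16 * (n2 * Z) * q ^ 3 + X * Z := by rw [s2, s5]
    _ ≤ 16 * (Fintype.card V ^ 2 * Z) * q ^ 3 + X * Z := by gcongr
    _ = _ := by ring
end

end PartQ

section PartWk

theorem walk0 {β : Type*} (η : β → Prop) (t : β → ℝ) (k c : ℤ) (F : Finset β) :
    (∀ x ∈ F, ∀ y ∈ F, t x = t y → x = y) →
    ∑ e ∈ F, (if c - ((F.filter fun e' => η e' ∧ t e' ≤ t e).card : ℤ) +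
        ((F.filter fun e' => ¬ η e' ∧ t e' < t e).card : ℤ) = k then (if η e then (1 : ℤ) else -1) else 0) =
      (if c > k then 1 else 0) -
        (if c - ((F.filter fun e' => η e').card : ℤ) + ((F.filter fun e' => ¬ η e').card : ℤ) > k then 1 else 0) := by
  induction F using Finset.induction_on_max_value t with
  | empty => intro _; simp
  | insert a s ha hmax ih =>
    intro hinj
    have hlt : ∀ x ∈ s, t x < t a := by
      intro x hx
      refine lt_of_le_of_ne (hmax x hx) fun e => ?_
      have := hinj x (Finset.mem_insert_of_mem hx) a (Finset.mem_insert_self _ _) e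
      exact ha (this ▸ hx)
    have ih := ih (fun x hx y hy => hinj x (Finset.mem_insert_of_mem hx) y (Finset.mem_insert_of_mem hy))
    rw [Finset.sum_insert ha]
    have e1 : ∀ e ∈ s, (insert a s).filter (fun e' => η e' ∧ t e' ≤ t e) = s.filter (fun e' => η e' ∧ t e' ≤ t e) := by
      intro e he
      rw [Finset.filter_insert, if_neg]
      rintro ⟨-, h⟩
      linarith [hlt e he]
    have e2 : ∀ e ∈ s, (insert a s).filter (fun e' => ¬ η e' ∧ t e' < t e) = s.filter (fun e' => ¬ η e' ∧ t e' < t e) := by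
      intro e he
      rw [Finset.filter_insert, if_neg]
      rintro ⟨-, h⟩
      linarith [hlt e he]
    have e3 : (∑ e ∈ s, (if c - (((insert a s).filter fun e' => η e' ∧ t e' ≤ t e).card : ℤ) +
        (((insert a s).filter fun e' => ¬ η e' ∧ t e' < t e).card : ℤ) = k then (if η e then (1 : ℤ) else -1) else 0)) =
        ∑ e ∈ s, (if c - ((s.filter fun e' => η e' ∧ t e' ≤ t e).card : ℤ) +
        ((s.filter fun e' => ¬ η e' ∧ t e' < t e).card : ℤ) = k then (if η e then (1 : ℤ) else -1) else 0) :=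
      Finset.sum_congr rfl fun e he => by rw [e1 e he, e2 e he]
    rw [e3, ih]
    have e4 : s.filter (fun e' => η e' ∧ t e' ≤ t a) = s.filter (fun e' => η e') :=
      Finset.filter_congr fun x hx => by simp [(hlt x hx).le]
    have e5 : s.filter (fun e' => ¬ η e' ∧ t e' < t a) = s.filter (fun e' => ¬ η e') :=
      Finset.filter_congr fun x hx => by simp [(hlt x hx)]
    have e6 : (insert a s).filter (fun e' => ¬ η e' ∧ t e' < t a) = s.filter (fun e' => ¬ η e') := by
      rw [Finset.filter_insert, if_neg (by simp), e5]
    rw [e6]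
    by_cases hη : η a
    · have e7 : (insert a s).filter (fun e' => η e' ∧ t e' ≤ t a) = insert a (s.filter (fun e' => η e')) := by
        rw [Finset.filter_insert, if_pos ⟨hη, le_rfl⟩, e4]
      have e8 : (insert a s).filter (fun e' => η e') = insert a (s.filter (fun e' => η e')) := by
        rw [Finset.filter_insert, if_pos hη]
      have e9 : (insert a s).filter (fun e' => ¬ η e') = (s.filter (fun e' => ¬ η e')) := by
        rw [Finset.filter_insert, if_neg (not_not.2 hη)]
      rw [e7, e8, e9, Finset.card_insert_of_notMem (by simp [ha]), if_pos hη]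
      push_cast
      generalize ((s.filter fun e' => η e').card : ℤ) = A
      generalize ((s.filter fun e' => ¬ η e').card : ℤ) = B
      split_ifs <;> omega
    · have e7 : (insert a s).filter (fun e' => η e' ∧ t e' ≤ t a) = (s.filter (fun e' => η e')) := by
        rw [Finset.filter_insert, if_neg (fun h => hη h.1), e4]
      have e8 : (insert a s).filter (fun e' => η e') = (s.filter (fun e' => η e')) := by
        rw [Finset.filter_insert, if_neg hη]
      have e9 : (insert a s).filter (fun e' => ¬ η e') = insert a (s.filter (fun e' => ¬ η e')) := by
        rw [Finset.filter_insert, if_pos hη]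
      rw [e7, e8, e9, Finset.card_insert_of_notMem (by simp [ha]), if_neg hη]
      push_cast
      generalize ((s.filter fun e' => η e').card : ℤ) = A
      generalize ((s.filter fun e' => ¬ η e').card : ℤ) = B
      split_ifs <;> omega

/-- number of members below the moving point -/
def wlev {β : Type*} (U : Finset β) (η : β → Prop) (t : β → ℝ) (x : ℝ) : ℕ :=
  (U.filter fun e => (η e ∧ x < t e) ∨ (¬ η e ∧ t e < x)).card

theorem walk1 {β : Type*} (U : Finset β) (η : β → Prop) (t : β → ℝ)
    (hinj : ∀ x ∈ U, ∀ y ∈ U, t x = t y → x = y) (k : ℕ) (x0 : ℝ) :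
    (U.filter fun e => wlev U η t (t e) = k ∧ x0 < t e ∧ η e).card ≤
      (U.filter fun e => wlev U η t (t e) = k ∧ x0 < t e ∧ ¬ η e).card + 1 := by
  set R := U.filter fun e => x0 < t e with hR
  set c : ℤ := ((U.filter fun e => t e ≤ x0 ∧ ¬ η e).card : ℤ) + ((R.filter fun e => η e).card : ℤ) with hc
  have w := walk0 η t k c R (fun x hx y hy => hinj x (Finset.mem_filter.1 hx).1 y (Finset.mem_filter.1 hy).1)
  have key : ∀ e ∈ R, (c - ((R.filter fun e' => η e' ∧ t e' ≤ t e).card : ℤ) +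
        ((R.filter fun e' => ¬ η e' ∧ t e' < t e).card : ℤ) = k) ↔ wlev U η t (t e) = k := by
    intro e he
    have he0 : x0 < t e := (Finset.mem_filter.1 he).2
    have h1 : (R.filter fun e => η e).card = (R.filter fun e' => η e' ∧ t e' ≤ t e).card +
        (U.filter fun e' => η e' ∧ t e < t e').card := by
      rw [← Finset.card_union_of_disjoint]
      · congr 1
        ext x
        simp only [hR, Finset.mem_filter, Finset.mem_union]
        constructor
        · rintro ⟨⟨h1, h2⟩, h3⟩
          rcases le_or_gt (t x) (t e) with h | h
          · exact Or.inl ⟨⟨h1, h2⟩, h3, h⟩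
          · exact Or.inr ⟨h1, h3, h⟩
        · rintro (⟨⟨h1, h2⟩, h3, h⟩ | ⟨h1, h3, h⟩)
          · exact ⟨⟨h1, h2⟩, h3⟩
          · exact ⟨⟨h1, by linarith⟩, h3⟩
      · rw [Finset.disjoint_left]
        intro x hx hy
        simp only [Finset.mem_filter] at hx hy
        linarith [hx.2.2, hy.2.2]
    have h2 : (U.filter fun e' => ¬ η e' ∧ t e' < t e).card = (U.filter fun e => t e ≤ x0 ∧ ¬ η e).card +
        (R.filter fun e' => ¬ η e' ∧ t e' < t e).card := by
      rw [← Finset.card_union_of_disjoint]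
      · congr 1
        ext x
        simp only [hR, Finset.mem_filter, Finset.mem_union]
        constructor
        · rintro ⟨h1, h2, h3⟩
          rcases le_or_gt (t x) x0 with h | h
          · exact Or.inl ⟨h1, h, h2⟩
          · exact Or.inr ⟨⟨h1, h⟩, h2, h3⟩
        · rintro (⟨h1, h2, h3⟩ | ⟨⟨h1, h2⟩, h3, h⟩)
          · exact ⟨h1, h3, by linarith⟩
          · exact ⟨h1, h3, h⟩
      · rw [Finset.disjoint_left]
        intro x hx hy
        simp only [hR, Finset.mem_filter] at hx hy
        linarith [hx.2.1, hy.1.2]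
    have h3 : wlev U η t (t e) = (U.filter fun e' => η e' ∧ t e < t e').card +
        (U.filter fun e' => ¬ η e' ∧ t e' < t e).card := by
      unfold wlev
      rw [← Finset.card_union_of_disjoint, Finset.filter_or]
      rw [Finset.disjoint_left]
      intro x hx hy
      simp only [Finset.mem_filter] at hx hy
      exact hy.2.1 hx.2.1
    rw [h3, hc]
    omega
  have w2 : ∑ e ∈ R, (if wlev U η t (t e) = k then (if η e then (1 : ℤ) else -1) else 0) ≤ 1 := by
    rw [Finset.sum_congr rfl (fun e he => by rw [if_congr (key e he) rfl rfl])] at w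
    rw [w]
    split_ifs <;> omega
  have w3 : ∑ e ∈ R, (if wlev U η t (t e) = k then (if η e then (1 : ℤ) else -1) else 0) =
     ((U.filter fun e => wlev U η t (t e) = k ∧ x0 < t e ∧ η e).card : ℤ) -
      ((U.filter fun e => wlev U η t (t e) = k ∧ x0 < t e ∧ ¬ η e).card : ℤ) := by
    rw [Finset.card_filter, Finset.card_filter, hR, Finset.sum_filter]
    push_cast
    rw [← Finset.sum_sub_distrib]
    refine Finset.sum_congr rfl fun e _ => ?_
    by_cases h1 : wlev U η t (t e) = k <;> by_cases h2 : x0 < t e <;> by_cases h3 : η e <;> simp [h1, h2, h3]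
  omega

theorem walk2 {β : Type*} (U : Finset β) (η : β → Prop) (t : β → ℝ)
    (hinj : ∀ x ∈ U, ∀ y ∈ U, t x = t y → x = y) (k : ℕ) (x0 : ℝ) :
    (U.filter fun e => wlev U η t (t e) = k ∧ ((η e ∧ x0 < t e) ∨ (¬ η e ∧ t e < x0))).card ≤
      (U.filter fun e => wlev U η t (t e) = k ∧ ((η e ∧ t e < x0) ∨ (¬ η e ∧ x0 < t e))).card + 2 := by
  have a1 := walk1 U η t hinj k x0
  have a2 := walk1 U (fun e => ¬ η e) (fun e => - t e) (fun x hx y hy h => hinj x hx y hy (neg_injective h)) k (-x0)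
  have hl : ∀ x, wlev U (fun e => ¬ η e) (fun e => - t e) (-x) = wlev U η t x := by
    intro x
    unfold wlev
    congr 1
    ext e
    simp only [Finset.mem_filter, neg_lt_neg_iff, not_not]
    tauto
  simp only [hl, neg_lt_neg_iff, not_not] at a2
  have b1 : (U.filter fun e => wlev U η t (t e) = k ∧ ((η e ∧ x0 < t e) ∨ (¬ η e ∧ t e < x0))).card ≤
      (U.filter fun e => wlev U η t (t e) = k ∧ x0 < t e ∧ η e).card +
      (U.filter fun e => wlev U η t (t e) = k ∧ t e < x0 ∧ ¬ η e).card := by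
    refine le_trans (Finset.card_le_card ?_) (Finset.card_union_le _ _)
    intro e
    simp only [Finset.mem_filter, Finset.mem_union]
    tauto
  have b2 : (U.filter fun e => wlev U η t (t e) = k ∧ x0 < t e ∧ ¬ η e).card +
      (U.filter fun e => wlev U η t (t e) = k ∧ t e < x0 ∧ η e).card =
      (U.filter fun e => wlev U η t (t e) = k ∧ ((η e ∧ t e < x0) ∨ (¬ η e ∧ x0 < t e))).card := by
    rw [← Finset.card_union_of_disjoint]
    · congr 1
      ext e
      simp only [Finset.mem_filter, Finset.mem_union]
      tauto
    · rw [Finset.disjoint_left]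
      intro x hx hy
      simp only [Finset.mem_filter] at hx hy
      exact hx.2.2.2 hy.2.2.2
  omega

end PartWk

section PartLv

/-- abstract flags on a curtain -/
structure Cur {V : Type*} (A : Finset V) (g : V → ℝ → ℝ) (η : V → Prop) (t : V → ℝ) (X : V → V → ℝ)
    (K : V → V → V → Prop) : Prop where
  sg : ∀ u ∈ A, Sg (g u) (η u) (t u)
  hX : ∀ p ∈ A, ∀ m ∈ A, η p → ¬ η m → t p < t m → t p < X p m ∧ X p m < t m ∧
    ∀ x, (g m x < g p x ↔ X p m < x) ∧ (g p x < g m x ↔ x < X p m)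
  k1 : ∀ a b c, K a b c → K b a c
  k2 : ∀ a b c, K a b c → K a c b
  hw : ∀ p ∈ A, ∀ m ∈ A, η p → ¬ η m → t p < t m →
    (A.filter fun e => (p ≠ e ∧ m ≠ e) ∧ K p m e ∧ g e (X p m) < g p (X p m)).card ≤
    (A.filter fun e => (p ≠ e ∧ m ≠ e) ∧ K p m e ∧ g p (X p m) < g e (X p m)).card + 2

def CFlag {V : Type*} (η : V → Prop) (t : V → ℝ)
    (K : V → V → V → Prop) (r : (V × V) × V) : Prop :=
  (η r.1.1 ∧ ¬ η r.1.2 ∧ t r.1.1 < t r.1.2) ∧ (r.1.1 ≠ r.2 ∧ r.1.2 ≠ r.2) ∧ K r.1.1 r.1.2 r.2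

def Lone {V : Type*} (η : V → Prop) (t : V → ℝ) (r : (V × V) × V) : Prop :=
  (η r.2 ∧ t r.1.2 < t r.2) ∨ (¬ η r.2 ∧ t r.2 < t r.1.1)

section
variable {V : Type*} {A : Finset V} {g : V → ℝ → ℝ} {η : V → Prop} {t : V → ℝ} {X : V → V → ℝ}
    {K : V → V → V → Prop}

theorem Cur.v0 (h : Cur A g η t X K) {p m : V} (hp : p ∈ A) (hm : m ∈ A) (ep : η p) (em : ¬ η m)
    (hlt : t p < t m) : 0 < g p (X p m) ∧ g p (X p m) = g m (X p m) := by
  obtain ⟨h1, h2, h3⟩ := h.hX p hp m hm ep em hlt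
  refine ⟨((h.sg p hp).p ep).1 _ |>.2 h1, ?_⟩
  have a := (h3 (X p m)).1.not.2 (lt_irrefl _)
  have b := (h3 (X p m)).2.not.2 (lt_irrefl _)
  linarith

def FP (A : Finset V) (g : V → ℝ → ℝ) (η : V → Prop) (t : V → ℝ) (X : V → V → ℝ)
    (K : V → V → V → Prop) : Finset ((V × V) × V) :=
  ((A ×ˢ A) ×ˢ A).filter fun r => CFlag η t K r ∧ g r.2 (X r.1.1 r.1.2) < g r.1.1 (X r.1.1 r.1.2)

def FM (A : Finset V) (g : V → ℝ → ℝ) (η : V → Prop) (t : V → ℝ) (X : V → V → ℝ)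
    (K : V → V → V → Prop) : Finset ((V × V) × V) :=
  ((A ×ˢ A) ×ˢ A).filter fun r => CFlag η t K r ∧ g r.1.1 (X r.1.1 r.1.2) < g r.2 (X r.1.1 r.1.2)

def PM (A : Finset V) (η : V → Prop) (t : V → ℝ) : Finset (V × V) :=
  (A ×ˢ A).filter fun r => η r.1 ∧ ¬ η r.2 ∧ t r.1 < t r.2

theorem Cur.wk (h : Cur A g η t X K) :
    (FP A g η t X K).card ≤ (FM A g η t X K).card + 2 * (PM A η t).card := by
  rw [card_fib (PM A η t) (FP A g η t X K) (fun r => A.filter fun e => (r.1 ≠ e ∧ r.2 ≠ e) ∧ K r.1 r.2 e ∧ g e (X r.1 r.2) < g r.1 (X r.1 r.2)),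
    card_fib (PM A η t) (FM A g η t X K) (fun r => A.filter fun e => (r.1 ≠ e ∧ r.2 ≠ e) ∧ K r.1 r.2 e ∧ g r.1 (X r.1 r.2) < g e (X r.1 r.2))]
  · rw [mul_comm, ← smul_eq_mul, ← Finset.sum_const, ← Finset.sum_add_distrib]
    refine Finset.sum_le_sum ?_
    rintro ⟨p, m⟩ hr
    simp only [PM, Finset.mem_filter, Finset.mem_product] at hr
    exact h.hw p hr.1.1 m hr.1.2 hr.2.1 hr.2.2.1 hr.2.2.2
  · rintro ⟨p, m⟩ e
    simp only [FM, PM, Finset.mem_filter, Finset.mem_product]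
    simp only [CFlag]
    tauto
  · rintro ⟨p, m⟩ e
    simp only [FP, PM, Finset.mem_filter, Finset.mem_product]
    simp only [CFlag]
    tauto

theorem PM_card : 4 * (PM A η t).card ≤ A.card ^ 2 := by
  have h1 : (PM A η t).card ≤ (A.filter η).card * (A.filter fun e => ¬ η e).card := by
    rw [← Finset.card_product]
    refine Finset.card_le_card ?_
    rintro ⟨p, m⟩
    simp only [PM, Finset.mem_filter, Finset.mem_product]
    tauto
  have h2 := Finset.card_filter_add_card_filter_not (s := A) η
  rw [← h2]
  generalize (A.filter η).card = x at *
  generalize (A.filter fun e => ¬ η e).card = y at *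
  have h3 : 4 * (x * y) ≤ (x + y) ^ 2 := by
    have := four_mul_le_pow_two_add (x : ℤ) y
    zify
    nlinarith
  omega

def iot (η : V → Prop) (r : (V × V) × V) : (V × V) × V :=
  if η r.2 then ((r.2, r.1.2), r.1.1) else ((r.1.1, r.2), r.1.2)

theorem Cur.inv (h : Cur A g η t X K) :
    ((FP A g η t X K).filter (Lone η t)).card + (FM A g η t X K).card ≤ (FP A g η t X K).card := by
  have h1 : (FM A g η t X K).card ≤ ((FP A g η t X K).filter fun r => ¬ Lone η t r).card := by
    refine Finset.card_le_card_of_injOn (iot η) ?_ ?_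
    · rintro ⟨⟨p, m⟩, e⟩ hr
      simp only [FM, Finset.coe_filter, Finset.mem_filter, Finset.mem_product, Set.mem_setOf_eq] at hr
      simp only [CFlag] at hr
      obtain ⟨⟨⟨hp, hm⟩, he⟩, ⟨⟨ep, em, hlt⟩, ⟨npe, nme⟩, hK⟩, hg⟩ := hr
      obtain ⟨x1, x2, x3⟩ := h.hX p hp m hm ep em hlt
      obtain ⟨v1, v2⟩ := h.v0 hp hm ep em hlt
      by_cases ee : η e
      · have q : iot η ((p, m), e) = ((e, m), p) := by simp [iot, ee]
        rw [q]
        have te : t e < X p m := ((h.sg e he).p ee).1 _ |>.1 (by linarith)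
        have tem : t e < t m := by linarith
        obtain ⟨y1, y2, y3⟩ := h.hX e he m hm ee em tem
        obtain ⟨w1, w2⟩ := h.v0 he hm ee em tem
        have o1 : X e m < X p m := ((y3 (X p m)).1).1 (by linarith)
        have o2 : g p (X e m) < g m (X e m) := ((x3 (X e m)).2).2 o1
        simp only [FP, Finset.coe_filter, Finset.mem_filter, Finset.mem_product, Set.mem_setOf_eq]
        simp only [CFlag, Lone]
        refine ⟨⟨⟨⟨he, hm⟩, hp⟩, ⟨⟨ee, em, tem⟩, ⟨npe.symm, ?_⟩, ?_⟩, by linarith⟩, ?_⟩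
        · rintro rfl; exact em ep
        · exact h.k1 _ _ _ (h.k2 _ _ _ (h.k1 _ _ _ hK))
        · rintro (⟨-, h'⟩ | ⟨h', -⟩)
          · linarith
          · exact h' ep
      · have q : iot η ((p, m), e) = ((p, e), m) := by simp [iot, ee]
        rw [q]
        have te : X p m < t e := ((h.sg e he).n ee).1 _ |>.1 (by linarith)
        have tpe : t p < t e := by linarith
        obtain ⟨y1, y2, y3⟩ := h.hX p hp e he ep ee tpe
        obtain ⟨w1, w2⟩ := h.v0 hp he ep ee tpe
        have o1 : X p m < X p e := ((y3 (X p m)).2).1 (by linarith)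
        have o2 : g m (X p e) < g p (X p e) := ((x3 (X p e)).1).2 o1
        simp only [FP, Finset.coe_filter, Finset.mem_filter, Finset.mem_product, Set.mem_setOf_eq]
        simp only [CFlag, Lone]
        refine ⟨⟨⟨⟨hp, he⟩, hm⟩, ⟨⟨ep, ee, tpe⟩, ⟨?_, nme.symm⟩, h.k2 _ _ _ hK⟩, o2⟩, ?_⟩
        · rintro rfl; exact em ep
        · rintro (⟨h', -⟩ | ⟨-, h'⟩)
          · exact em h'
          · linarith
    · rintro ⟨⟨p, m⟩, e⟩ hr ⟨⟨p', m'⟩, e'⟩ hr' hq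
      simp only [FM, Finset.coe_filter, Finset.mem_filter, Finset.mem_product, Set.mem_setOf_eq] at hr hr'
      simp only [CFlag] at hr hr'
      obtain ⟨⟨⟨hp, hm⟩, he⟩, ⟨⟨ep, em, hlt⟩, ⟨npe, nme⟩, hK⟩, hg⟩ := hr
      obtain ⟨⟨⟨hp', hm'⟩, he'⟩, ⟨⟨ep', em', hlt'⟩, ⟨npe', nme'⟩, hK'⟩, hg'⟩ := hr'
      by_cases ee : η e <;> by_cases ee' : η e' <;>
        simp only [iot, ee, ee', if_true, if_false, Prod.mk.injEq] at hq ⊢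
      · tauto
      · exact absurd ep (by rw [hq.2]; exact em')
      · exact absurd ep' (by rw [← hq.2]; exact em)
      · tauto
  have h2 := Finset.card_filter_add_card_filter_not (s := FP A g η t X K) (Lone η t)
  omega

theorem Cur.lonely (h : Cur A g η t X K) :
    2 * ((FP A g η t X K).filter (Lone η t)).card ≤ A.card ^ 2 := by
  have h1 := h.inv
  have h2 := h.wk
  have h3 := PM_card (A := A) (η := η) (t := t)
  omega

def GImm (g : V → ℝ → ℝ) (a d e : V) : Prop :=
  ∀ x, (g a x < 0 ∨ g d x < 0 ∨ g e x < 0) ∧ (0 < g a x ∨ 0 < g d x ∨ 0 < g e x)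

theorem Cur.mk1 (h : Cur A g η t X K) {p m e : V} (hp : p ∈ A) (hm : m ∈ A) (he : e ∈ A)
    (ep : η p) (em : ¬ η m) (ee : η e) (h1 : t p < t m) (h2 : t m < t e) (n : p ≠ e) (hK : K p m e) :
    ((p, m), e) ∈ (FP A g η t X K).filter (Lone η t) := by
  obtain ⟨x1, x2, x3⟩ := h.hX p hp m hm ep em h1
  obtain ⟨v1, v2⟩ := h.v0 hp hm ep em h1
  have : g e (X p m) < 0 := (((h.sg e he).p ee).2 _).2 (by linarith)
  simp only [FP, Finset.mem_filter, Finset.mem_product]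
  simp only [CFlag, Lone]
  refine ⟨⟨⟨⟨hp, hm⟩, he⟩, ⟨⟨ep, em, h1⟩, ⟨n, ?_⟩, hK⟩, by linarith⟩, Or.inl ⟨ee, h2⟩⟩
  rintro rfl; exact em ee

theorem Cur.mk2 (h : Cur A g η t X K) {p m e : V} (hp : p ∈ A) (hm : m ∈ A) (he : e ∈ A)
    (ep : η p) (em : ¬ η m) (ee : ¬ η e) (h1 : t p < t m) (h2 : t e < t p) (n : m ≠ e) (hK : K p m e) :
    ((p, m), e) ∈ (FP A g η t X K).filter (Lone η t) := by
  obtain ⟨x1, x2, x3⟩ := h.hX p hp m hm ep em h1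
  obtain ⟨v1, v2⟩ := h.v0 hp hm ep em h1
  have : g e (X p m) < 0 := (((h.sg e he).n ee).2 _).2 (by linarith)
  simp only [FP, Finset.mem_filter, Finset.mem_product]
  simp only [CFlag, Lone]
  refine ⟨⟨⟨⟨hp, hm⟩, he⟩, ⟨⟨ep, em, h1⟩, ⟨?_, n⟩, hK⟩, by linarith⟩, Or.inr ⟨ee, h2⟩⟩
  rintro rfl; exact ee ep

theorem Cur.odd (h : Cur A g η t X K) {p m e : V} (hp : p ∈ A) (hm : m ∈ A) (he : e ∈ A)
    (n1 : p ≠ m) (n2 : p ≠ e) (n3 : m ≠ e)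
    (hK : K p m e) (o1 : η p ↔ ¬ η m) (o2 : η p ↔ ¬ η e) (hI : GImm g p m e) :
    ((p, m), e) ∈ (FP A g η t X K).filter (Lone η t) ∨ ((p, e), m) ∈ (FP A g η t X K).filter (Lone η t) ∨
    ((m, p), e) ∈ (FP A g η t X K).filter (Lone η t) ∨ ((e, p), m) ∈ (FP A g η t X K).filter (Lone η t) := by
  have h0 := ((h.sg p hp).eq0 (t p)).2 rfl
  have hI := hI (t p)
  rw [h0] at hI
  simp only [lt_irrefl, false_or] at hI
  have k1 := h.k1 _ _ _ hK
  have k2 := h.k2 _ _ _ hK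
  have k3 := h.k1 _ _ _ k2
  obtain ⟨hI1, hI2⟩ := hI
  by_cases ep : η p
  · have em := o1.1 ep
    have ee := o2.1 ep
    rw [((h.sg m hm).n em).2, ((h.sg e he).n ee).2] at hI1
    rw [((h.sg m hm).n em).1, ((h.sg e he).n ee).1] at hI2
    rcases hI2 with i2 | i2 <;> rcases hI1 with i1 | i1
    · linarith
    · exact Or.inl (h.mk2 hp hm he ep em ee i2 i1 n3 hK)
    · exact Or.inr (Or.inl (h.mk2 hp he hm ep ee em i2 i1 n3.symm k2))
    · linarith
  · have em : η m := by tauto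
    have ee : η e := by tauto
    rw [((h.sg m hm).p em).2, ((h.sg e he).p ee).2] at hI1
    rw [((h.sg m hm).p em).1, ((h.sg e he).p ee).1] at hI2
    rcases hI2 with i2 | i2 <;> rcases hI1 with i1 | i1
    · linarith
    · exact Or.inr (Or.inr (Or.inl (h.mk1 hm hp he em ep ee i2 i1 n3 k1)))
    · exact Or.inr (Or.inr (Or.inr (h.mk1 he hp hm ee ep em i2 i1 n3.symm k3)))
    · linarith

theorem Cur.six (h : Cur A g η t X K) {a d e : V} (ha : a ∈ A) (hd : d ∈ A) (he : e ∈ A)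
    (n1 : a ≠ d) (n2 : a ≠ e) (n3 : d ≠ e) (hK : K a d e) (hI : GImm g a d e) :
    ((a, d), e) ∈ (FP A g η t X K).filter (Lone η t) ∨ ((a, e), d) ∈ (FP A g η t X K).filter (Lone η t) ∨
    ((d, a), e) ∈ (FP A g η t X K).filter (Lone η t) ∨ ((d, e), a) ∈ (FP A g η t X K).filter (Lone η t) ∨
    ((e, a), d) ∈ (FP A g η t X K).filter (Lone η t) ∨ ((e, d), a) ∈ (FP A g η t X K).filter (Lone η t) := by
  have Id : GImm g d a e := fun x => by have := hI x; tauto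
  have Ie : GImm g e a d := fun x => by have := hI x; tauto
  have kd := h.k1 _ _ _ hK
  have ke := h.k1 _ _ _ (h.k2 _ _ _ hK)
  by_cases ea : η a <;> by_cases ed : η d <;> by_cases ee : η e
  · exfalso
    obtain ⟨x, h1, h2, h3, -⟩ := exists_lt4 (t a) (t d) (t e) 0 0
    have := (hI x).2
    rw [((h.sg a ha).p ea).1, ((h.sg d hd).p ed).1, ((h.sg e he).p ee).1] at this
    rcases this with h | h | h <;> linarith
  · have := h.odd he ha hd n2.symm n3.symm n1 ke (by tauto) (by tauto) Ie
    tauto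
  · have := h.odd hd ha he n1.symm n3 n2 kd (by tauto) (by tauto) Id
    tauto
  · have := h.odd ha hd he n1 n2 n3 hK (by tauto) (by tauto) hI
    tauto
  · have := h.odd ha hd he n1 n2 n3 hK (by tauto) (by tauto) hI
    tauto
  · have := h.odd hd ha he n1.symm n3 n2 kd (by tauto) (by tauto) Id
    tauto
  · have := h.odd he ha hd n2.symm n3.symm n1 ke (by tauto) (by tauto) Ie
    tauto
  · exfalso
    obtain ⟨x, h1, h2, h3, -⟩ := exists_lt4 (t a) (t d) (t e) 0 0
    have := (hI x).1
    rw [((h.sg a ha).n ea).2, ((h.sg d hd).n ed).2, ((h.sg e he).n ee).2] at this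
    rcases this with h | h | h <;> linarith

theorem Cur.bound (h : Cur A g η t X K) (S : Finset ((V × V) × V))
    (hS : ∀ a d e, ((a, d), e) ∈ S → (a ∈ A ∧ d ∈ A ∧ e ∈ A) ∧ (a ≠ d ∧ a ≠ e ∧ d ≠ e) ∧ K a d e ∧ GImm g a d e) :
    S.card ≤ 3 * A.card ^ 2 := by
  have h1 := h.lonely
  set L := (FP A g η t X K).filter (Lone η t) with hL
  have h2 : S ⊆ L ∪ (L.image (fun r => ((r.1.1, r.2), r.1.2)) ∪ (L.image (fun r => ((r.1.2, r.1.1), r.2)) ∪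
      (L.image (fun r => ((r.2, r.1.1), r.1.2)) ∪ (L.image (fun r => ((r.1.2, r.2), r.1.1)) ∪
      L.image (fun r => ((r.2, r.1.2), r.1.1)))))) := by
    rintro ⟨⟨a, d⟩, e⟩ hm
    obtain ⟨⟨ha, hd, he⟩, ⟨n1, n2, n3⟩, hK, hI⟩ := hS a d e hm
    simp only [Finset.mem_union, Finset.mem_image]
    rcases h.six ha hd he n1 n2 n3 hK hI with q | q | q | q | q | q
    · exact Or.inl q
    · exact Or.inr (Or.inl ⟨_, q, rfl⟩)
    · exact Or.inr (Or.inr (Or.inl ⟨_, q, rfl⟩))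
    · exact Or.inr (Or.inr (Or.inr (Or.inl ⟨_, q, rfl⟩)))
    · exact Or.inr (Or.inr (Or.inr (Or.inr (Or.inl ⟨_, q, rfl⟩))))
    · exact Or.inr (Or.inr (Or.inr (Or.inr (Or.inr ⟨_, q, rfl⟩))))
  have h3 := Finset.card_le_card h2
  have c : ∀ u : (V × V) × V → (V × V) × V, (L.image u).card ≤ L.card := fun u => Finset.card_image_le
  have := c (fun r => ((r.1.1, r.2), r.1.2))
  have := c (fun r => ((r.1.2, r.1.1), r.2))
  have := c (fun r => ((r.2, r.1.1), r.1.2))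
  have := c (fun r => ((r.1.2, r.2), r.1.1))
  have := c (fun r => ((r.2, r.1.2), r.1.1))
  have u1 := Finset.card_union_le L (L.image (fun r => ((r.1.1, r.2), r.1.2)) ∪ (L.image (fun r => ((r.1.2, r.1.1), r.2)) ∪
      (L.image (fun r => ((r.2, r.1.1), r.1.2)) ∪ (L.image (fun r => ((r.1.2, r.2), r.1.1)) ∪
      L.image (fun r => ((r.2, r.1.2), r.1.1))))))
  have u2 := Finset.card_union_le (L.image (fun r => ((r.1.1, r.2), r.1.2))) (L.image (fun r => ((r.1.2, r.1.1), r.2)) ∪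
      (L.image (fun r => ((r.2, r.1.1), r.1.2)) ∪ (L.image (fun r => ((r.1.2, r.2), r.1.1)) ∪
      L.image (fun r => ((r.2, r.1.2), r.1.1)))))
  have u3 := Finset.card_union_le (L.image (fun r => ((r.1.2, r.1.1), r.2)))
      (L.image (fun r => ((r.2, r.1.1), r.1.2)) ∪ (L.image (fun r => ((r.1.2, r.2), r.1.1)) ∪
      L.image (fun r => ((r.2, r.1.2), r.1.1))))
  have u4 := Finset.card_union_le (L.image (fun r => ((r.2, r.1.1), r.1.2))) (L.image (fun r => ((r.1.2, r.2), r.1.1)) ∪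
      L.image (fun r => ((r.2, r.1.2), r.1.1)))
  have u5 := Finset.card_union_le (L.image (fun r => ((r.1.2, r.2), r.1.1))) (L.image (fun r => ((r.2, r.1.2), r.1.1)))
  omega
end

end PartLv

section PartR

/-- the triple point of `a, b, c` has level `k` -/
def KL {V : Type*} [Fintype V] (f : V → ℝ → ℝ → ℝ) (k : ℕ) (a b c : V) : Prop :=
  ∃ x y z, f a x y = z ∧ f b x y = z ∧ f c x y = z ∧ (Finset.univ.filter fun u => f u x y < z).card = k

theorem KL.k1 {V : Type*} [Fintype V] {f : V → ℝ → ℝ → ℝ} {k : ℕ} (a b c : V) (h : KL f k a b c) :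
    KL f k b a c := by
  obtain ⟨x, y, z, h1, h2, h3, h4⟩ := h
  exact ⟨x, y, z, h2, h1, h3, h4⟩

theorem KL.k2 {V : Type*} [Fintype V] {f : V → ℝ → ℝ → ℝ} {k : ℕ} (a b c : V) (h : KL f k a b c) :
    KL f k a c b := by
  obtain ⟨x, y, z, h1, h2, h3, h4⟩ := h
  exact ⟨x, y, z, h1, h3, h2, h4⟩

section
variable {V : Type*} {f : V → ℝ → ℝ → ℝ} {φ : V → V → ℝ → ℝ} {T : V → V → V → ℝ}
    {E : V → V → Prop} {H : V → V → V → Prop}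

theorem Geo.below (G : Geo f φ T E H) {p m u : V} (n1 : p ≠ m) (n2 : p ≠ u) (n3 : m ≠ u) (x : ℝ) :
    (f u x (φ p m x) < f p x (φ p m x) ↔ (H p m u ∧ x < T p m u) ∨ (¬ H p m u ∧ T p m u < x)) ∧
    (f p x (φ p m x) < f u x (φ p m x) ↔ (H p m u ∧ T p m u < x) ∨ (¬ H p m u ∧ x < T p m u)) := by
  have s := G.sg n1 n2 n3
  rcases s.cases with ⟨h1, h2, h3⟩ | ⟨h1, h2, h3⟩
  · have h2 := h2 x
    have h3 := h3 x
    simp only [sub_pos, sub_neg] at h2 h3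
    rw [h2, h3]
    simp [h1]
  · have h2 := h2 x
    have h3 := h3 x
    simp only [sub_pos, sub_neg] at h2 h3
    rw [h2, h3]
    simp [h1]

theorem Geo.KLiff [Fintype V] (G : Geo f φ T E H) {p m e : V} (n1 : p ≠ m) (n2 : p ≠ e) (n3 : m ≠ e) (k : ℕ) :
    KL f k p m e ↔ wlev (Finset.univ.filter fun u => p ≠ u ∧ m ≠ u) (H p m) (T p m) (T p m e) = k := by
  have hc : ∀ x, (Finset.univ.filter fun u => f u x (φ p m x) < f p x (φ p m x)).card =
      wlev (Finset.univ.filter fun u => p ≠ u ∧ m ≠ u) (H p m) (T p m) x := by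
    intro x
    unfold wlev
    congr 1
    ext u
    simp only [Finset.mem_filter, Finset.mem_univ, true_and]
    constructor
    · intro h
      have a1 : p ≠ u := by rintro rfl; exact lt_irrefl _ h
      have a2 : m ≠ u := by rintro rfl; rw [G.on n1 x] at h; exact lt_irrefl _ h
      exact ⟨⟨a1, a2⟩, (G.below n1 a1 a2 x).1.1 h⟩
    · rintro ⟨⟨a1, a2⟩, h⟩
      exact (G.below n1 a1 a2 x).1.2 h
  rw [← hc]
  constructor
  · rintro ⟨x, y, z, h1, h2, h3, h4⟩
    have hy : y = φ p m x := (G.φeq p m n1 x y).1 (h1.trans h2.symm)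
    subst hy
    have hx : x = T p m e := (G.T0 p m e n1 n2 n3 x).1 (h3.trans h1.symm)
    subst hx
    rw [h1]
    exact h4
  · intro h
    exact ⟨T p m e, φ p m (T p m e), _, rfl, (G.on n1 _).symm, (G.T0 p m e n1 n2 n3 _).2 rfl, h⟩

theorem Geo.Xex (G : Geo f φ T E H) {b c p m : V} (bc : b ≠ c) (bp : b ≠ p) (cp : c ≠ p) (bm : b ≠ m)
    (cm : c ≠ m) (ep : H b c p) (em : ¬ H b c m) (hlt : T b c p < T b c m) :
    ∃ X, φ p m X = φ b c X ∧ T b c p < X ∧ X < T b c m ∧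
      ∀ x, (f m x (φ b c x) < f p x (φ b c x) ↔ X < x) ∧ (f p x (φ b c x) < f m x (φ b c x) ↔ x < X) := by
  have pm : p ≠ m := by rintro rfl; exact em ep
  obtain ⟨X, hX, hXu⟩ := G.X4 p m b c pm bc (fun h => bp h.1.symm) (fun h => cp h.1.symm)
  have sp := (G.sg bc bp cp).p ep
  have sm := (G.sg bc bm cm).n em
  simp only [sub_pos, sub_neg] at sp sm
  have hz : ∀ x, f p x (φ b c x) - f m x (φ b c x) = 0 ↔ x = X := by
    intro x
    rw [sub_eq_zero, G.φeq p m pm]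
    exact ⟨fun h => hXu x h.symm, fun h => by rw [h]; exact hX.symm⟩
  have ep0 := (G.T0 b c p bc bp cp _).2 rfl
  have em0 := (G.T0 b c m bc bm cm _).2 rfl
  have dp : f p (T b c p) (φ b c (T b c p)) - f m (T b c p) (φ b c (T b c p)) < 0 := by
    have := (sm.1 (T b c p)).2 hlt
    linarith
  have dm : 0 < f p (T b c m) (φ b c (T b c m)) - f m (T b c m) (φ b c (T b c m)) := by
    have := (sp.1 (T b c m)).2 hlt
    linarith
  have hcu : ∀ u, Continuous fun x => f u x (φ b c x) := by
    intro u
    have h1 := G.cont u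
    have h2 := G.φc b c bc
    exact h1.comp (continuous_id.prodMk h2)
  obtain ⟨Q, hQ⟩ := sgn1 (fun x => f p x (φ b c x) - f m x (φ b c x)) ((hcu p).sub (hcu m)) X hz
    ⟨_, dp⟩ ⟨_, dm⟩
  have np : T b c p ≠ X := fun e => by have := (hz _).2 e; linarith
  have nm : T b c m ≠ X := fun e => by have := (hz _).2 e; linarith
  have q1 := hQ _ np
  have q2 := hQ _ nm
  have q1' : ¬ (Q ↔ X < T b c p) := fun h => by have := q1.2 h; linarith
  have q2' := q2.1 dm
  have hq : Q := by
    by_contra hq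
    have a1 : X < T b c p := by tauto
    have a2 : ¬ X < T b c m := by tauto
    linarith
  have sD : Sg (fun x => f p x (φ b c x) - f m x (φ b c x)) Q X := ⟨hz, hQ⟩
  have sD := sD.p hq
  simp only [sub_pos, sub_neg] at sD
  refine ⟨X, hX, ?_, q2'.1 hq, fun x => ⟨sD.1 x, sD.2 x⟩⟩
  have : ¬ X < T b c p := by tauto
  exact lt_of_le_of_ne (not_lt.1 this) np

theorem Geo.cur [Fintype V] (G : Geo f φ T E H) (k : ℕ) {b c : V} (bc : b ≠ c) :
    ∃ X, Cur (Finset.univ.filter fun u => b ≠ u ∧ c ≠ u) (fun u x => f u x (φ b c x) - f b x (φ b c x))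
      (H b c) (T b c) X (KL f k) := by
  have hex : ∀ p m, ∃ X, (b ≠ p ∧ c ≠ p) → (b ≠ m ∧ c ≠ m) → H b c p → ¬ H b c m → T b c p < T b c m →
      φ p m X = φ b c X ∧ T b c p < X ∧ X < T b c m ∧
      ∀ x, (f m x (φ b c x) < f p x (φ b c x) ↔ X < x) ∧ (f p x (φ b c x) < f m x (φ b c x) ↔ x < X) := by
    intro p m
    by_cases h : (b ≠ p ∧ c ≠ p) ∧ (b ≠ m ∧ c ≠ m) ∧ H b c p ∧ ¬ H b c m ∧ T b c p < T b c m
    · obtain ⟨X, hX⟩ := G.Xex bc h.1.1 h.1.2 h.2.1.1 h.2.1.2 h.2.2.1 h.2.2.2.1 h.2.2.2.2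
      exact ⟨X, fun _ _ _ _ _ => hX⟩
    · exact ⟨0, fun h1 h2 h3 h4 h5 => absurd ⟨h1, h2, h3, h4, h5⟩ h⟩
  choose X hX using hex
  refine ⟨X, ?_, ?_, KL.k1, KL.k2, ?_⟩
  · intro u hu
    simp only [Finset.mem_filter, Finset.mem_univ, true_and] at hu
    exact G.sg bc hu.1 hu.2
  · intro p hp m hm ep em hlt
    simp only [Finset.mem_filter, Finset.mem_univ, true_and] at hp hm
    obtain ⟨h1, h2, h3, h4⟩ := hX p m hp hm ep em hlt
    refine ⟨h2, h3, fun x => ?_⟩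
    simp only [sub_lt_sub_iff_right]
    exact h4 x
  · intro p hp m hm ep em hlt
    simp only [Finset.mem_filter, Finset.mem_univ, true_and] at hp hm
    obtain ⟨h1, h2, h3, h4⟩ := hX p m hp hm ep em hlt
    have pm : p ≠ m := by rintro rfl; exact em ep
    have hpos := (((G.sg bc hp.1 hp.2).p ep).1 (X p m)).2 h2
    simp only [sub_pos] at hpos
    have w := walk2 (Finset.univ.filter fun u => p ≠ u ∧ m ≠ u) (H p m) (T p m) (by
      intro u hu v hv e
      simp only [Finset.mem_filter, Finset.mem_univ, true_and] at hu hv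
      by_contra n
      exact G.Tne pm hu.1 hv.1 hu.2 hv.2 n e) k (X p m)
    refine le_trans (Finset.card_le_card ?_) (le_trans w (Nat.add_le_add_right (Finset.card_le_card ?_) 2))
    · intro e he
      simp only [Finset.mem_filter, Finset.mem_univ, true_and, sub_lt_sub_iff_right] at he ⊢
      obtain ⟨-, ⟨n1, n2⟩, hK, hg⟩ := he
      refine ⟨⟨n1, n2⟩, (G.KLiff pm n1 n2 k).1 hK, (G.below pm n1 n2 _).1.1 ?_⟩
      rw [h1]; exact hg
    · intro e he
      simp only [Finset.mem_filter, Finset.mem_univ, true_and, sub_lt_sub_iff_right] at he ⊢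
      obtain ⟨⟨n1, n2⟩, hK, hg⟩ := he
      have hg := (G.below pm n1 n2 _).2.2 hg
      rw [h1] at hg
      refine ⟨⟨?_, ?_⟩, ⟨n1, n2⟩, (G.KLiff pm n1 n2 k).2 hK, hg⟩
      · rintro rfl; linarith
      · rintro rfl; have := G.on bc (X p m); linarith

theorem Geo.X5 [Fintype V] (G : Geo f φ T E H) (k : ℕ) :
    (Finset.univ.filter (P5 f φ (KL f k))).card ≤ 3 * (Fintype.card V) ^ 4 := by
  let S : Finset ((V × V) × ((V × V) × V)) := Finset.univ.filter fun r =>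
    P5 f φ (KL f k) (r.2.1.1, r.1, (r.2.1.2, r.2.2))
  have h1 : (Finset.univ.filter (P5 f φ (KL f k))).card ≤ S.card := by
    refine Finset.card_le_card_of_injOn (fun r => (r.2.1, ((r.1, r.2.2.1), r.2.2.2))) ?_ ?_
    · rintro ⟨a, ⟨b, c⟩, ⟨d, e⟩⟩ h
      have h := (Finset.mem_filter.1 h).2
      exact Finset.mem_coe.2 (Finset.mem_filter.2 ⟨Finset.mem_univ _, h⟩)
    · rintro ⟨a, ⟨b, c⟩, ⟨d, e⟩⟩ _ ⟨a', ⟨b', c'⟩, ⟨d', e'⟩⟩ _ h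
      simp only [Prod.mk.injEq] at h ⊢
      tauto
  have h2 := card_fib Finset.univ S (fun p => Finset.univ.filter fun r =>
    P5 f φ (KL f k) (r.1.1, p, (r.1.2, r.2))) (by
      intro a x
      simp only [S, Finset.mem_filter, Finset.mem_univ, true_and])
  have h3 : ∀ p ∈ (Finset.univ : Finset (V × V)), ((Finset.univ : Finset ((V × V) × V)).filter fun r =>
    P5 f φ (KL f k) (r.1.1, p, (r.1.2, r.2))).card ≤ 3 * (Fintype.card V) ^ 2 := by
    rintro ⟨b, c⟩ -
    by_cases bc : b = c
    · rw [Finset.filter_false_of_mem]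
      · simp
      · rintro r - h
        exact h.2.1.1 bc
    · obtain ⟨X, hX⟩ := G.cur k bc
      refine (hX.bound _ ?_).trans ?_
      · intro a d e h
        have h := (Finset.mem_filter.1 h).2
        obtain ⟨⟨ab, ac, ad, ae⟩, ⟨-, -⟩, ⟨de, hK⟩, ⟨bd, be, cd, ce⟩, hI⟩ := h
        simp only [Finset.mem_filter, Finset.mem_univ, true_and]
        refine ⟨⟨⟨ab.symm, ac.symm⟩, ⟨bd, cd⟩, ⟨be, ce⟩⟩, ⟨ad, ae, de⟩, hK, ?_⟩
        intro x
        simp only [sub_pos, sub_neg]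
        exact hI x
      · gcongr
        exact Finset.card_le_univ _
  have h4 := Finset.sum_le_card_nsmul _ _ _ h3
  rw [← h2] at h4
  refine h1.trans (h4.trans (le_of_eq ?_))
  simp only [Finset.card_univ, Fintype.card_prod, smul_eq_mul]
  ring
end

end PartR

section PartZ

theorem final_arith (M n X : ℕ) (h0 : n = 0 → M = 0) (hX : X ≤ 3 * n ^ 4)
    (h : ∀ q : ℕ, 1 ≤ q → 12 * M * q ^ 2 ≤ 16 * n ^ 2 * q ^ 3 + X) :
    M ^ 3 ≤ 48 * n ^ 8 + 64 * n ^ 6 := by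
  rcases Nat.eq_zero_or_pos n with hn | hn
  · rw [h0 hn, hn]; norm_num
  have hd : 0 < 8 * n ^ 2 := by positivity
  obtain ⟨q, hq⟩ : ∃ q, q = 3 * M / (8 * n ^ 2) := ⟨_, rfl⟩
  have q1 : 8 * n ^ 2 * q ≤ 3 * M := by rw [hq]; exact Nat.mul_div_le _ _
  have q2 : 3 * M < 8 * n ^ 2 * (q + 1) := by
    rw [hq]; exact Nat.lt_mul_div_succ _ hd
  rcases Nat.eq_zero_or_pos q with hz | hz
  · rw [hz] at q2
    have : M ≤ 4 * n ^ 2 := by omega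
    calc M ^ 3 ≤ (4 * n ^ 2) ^ 3 := Nat.pow_le_pow_left this 3
      _ = 64 * n ^ 6 := by ring
      _ ≤ _ := Nat.le_add_left _ _
  · have e := h q hz
    have e1 : 16 * n ^ 2 * q ^ 3 ≤ 6 * M * q ^ 2 := by
      calc 16 * n ^ 2 * q ^ 3 = 8 * n ^ 2 * q * (2 * q ^ 2) := by ring
        _ ≤ 3 * M * (2 * q ^ 2) := Nat.mul_le_mul_right _ q1
        _ = _ := by ring
    have e2 : 2 * (M * q ^ 2) ≤ n ^ 4 := by nlinarith
    have e3 : 3 * M ≤ 16 * n ^ 2 * q := by nlinarith [Nat.mul_le_mul_left (8 * n ^ 2) hz]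
    have e4 : (3 * M) ^ 2 ≤ (16 * n ^ 2 * q) ^ 2 := Nat.pow_le_pow_left e3 2
    have e5 : 18 * M ^ 3 ≤ 256 * n ^ 8 := by
      calc 18 * M ^ 3 = (3 * M) ^ 2 * (2 * M) := by ring
        _ ≤ (16 * n ^ 2 * q) ^ 2 * (2 * M) := Nat.mul_le_mul_right _ e4
        _ = 256 * n ^ 4 * (2 * (M * q ^ 2)) := by ring
        _ ≤ 256 * n ^ 4 * n ^ 4 := Nat.mul_le_mul_left _ e2
        _ = _ := by ring
    have : 0 ≤ n ^ 6 := Nat.zero_le _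
    omega

theorem perm3_p1 {α : Type*} (a b c : α) : ({a, c, b} : Finset α) = {a, b, c} := by
  ext; simp; tauto
theorem perm3_p2 {α : Type*} (a b c : α) : ({b, a, c} : Finset α) = {a, b, c} := by
  ext; simp; tauto
theorem perm3_p3 {α : Type*} (a b c : α) : ({b, c, a} : Finset α) = {a, b, c} := by
  ext; simp; tauto
theorem perm3_p4 {α : Type*} (a b c : α) : ({c, a, b} : Finset α) = {a, b, c} := by
  ext; simp; tauto
theorem perm3_p5 {α : Type*} (a b c : α) : ({c, b, a} : Finset α) = {a, b, c} := by
  ext; simp; tauto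

theorem six_corr (Λ : Finset PP) (k : ℕ) :
    6 * (kCorridors Λ k).card ≤
      (Finset.univ.filter (P3 (KL (fun a : Λ => (a : PP)) k))).card := by
  rw [mul_comm]
  let g : Λ × Λ × Λ → Finset PP := fun t => {t.1.1, t.2.1.1, t.2.2.1}
  have : ∀ s ∈ kCorridors Λ k, 6 ≤ ((Finset.univ.filter (P3 (KL (fun a : Λ => (a : PP)) k))).filter
      fun t => g t = s).card := by
    intro s hs
    obtain ⟨hs1, x, y, z, hz, hl⟩ := Finset.mem_filter.1 hs
    obtain ⟨hs1, hc⟩ := Finset.mem_powersetCard.1 hs1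
    obtain ⟨a, b, c, ab, ac, bc, rfl⟩ := Finset.card_eq_three.1 hc
    have ha : a ∈ Λ := hs1 (by simp)
    have hb : b ∈ Λ := hs1 (by simp)
    have hcc : c ∈ Λ := hs1 (by simp)
    have za := hz a (by simp)
    have zb := hz b (by simp)
    have zc := hz c (by simp)
    have hlev : (Finset.univ.filter fun u : Λ => (u : PP) x y < z).card = k := by
      rw [← hl, level, ← Finset.card_map (Function.Embedding.subtype _)]
      congr 1
      ext u
      simp only [Finset.mem_map, Finset.mem_filter, Finset.mem_univ, true_and,
        Function.Embedding.subtype_apply]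
      constructor
      · rintro ⟨v, hv, rfl⟩; exact ⟨v.2, hv⟩
      · rintro ⟨h1, h2⟩; exact ⟨⟨u, h1⟩, h2, rfl⟩
    have key : ∀ a b c : Λ, (a : PP) x y = z → (b : PP) x y = z → (c : PP) x y = z →
        KL (fun a : Λ => (a : PP)) k a b c := fun a b c h1 h2 h3 => ⟨x, y, z, h1, h2, h3, hlev⟩
    let A : Λ := ⟨a, ha⟩
    let B : Λ := ⟨b, hb⟩
    let C : Λ := ⟨c, hcc⟩
    have AB : A ≠ B := fun h => ab (congrArg Subtype.val h)
    have AC : A ≠ C := fun h => ac (congrArg Subtype.val h)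
    have BC : B ≠ C := fun h => bc (congrArg Subtype.val h)
    have h6 : ({(A,B,C),(A,C,B),(B,A,C),(B,C,A),(C,A,B),(C,B,A)} : Finset (Λ × Λ × Λ)).card = 6 := by
      simp [AB, AC, BC, AB.symm, AC.symm, BC.symm]
    rw [← h6]
    apply Finset.card_le_card
    intro t ht
    simp only [Finset.mem_insert, Finset.mem_singleton] at ht
    simp only [Finset.mem_filter, Finset.mem_univ, true_and]
    rcases ht with rfl | rfl | rfl | rfl | rfl | rfl
    · exact ⟨⟨AB, AC, BC, key _ _ _ za zb zc⟩, rfl⟩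
    · exact ⟨⟨AC, AB, BC.symm, key _ _ _ za zc zb⟩, perm3_p1 a b c⟩
    · exact ⟨⟨AB.symm, BC, AC, key _ _ _ zb za zc⟩, perm3_p2 a b c⟩
    · exact ⟨⟨BC, AB.symm, AC.symm, key _ _ _ zb zc za⟩, perm3_p3 a b c⟩
    · exact ⟨⟨AC.symm, BC.symm, AB, key _ _ _ zc za zb⟩, perm3_p4 a b c⟩
    · exact ⟨⟨BC.symm, AC.symm, AB.symm, key _ _ _ zc zb za⟩, perm3_p5 a b c⟩
  calc (kCorridors Λ k).card * 6 = ∑ s ∈ kCorridors Λ k, 6 := by simp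
    _ ≤ ∑ s ∈ kCorridors Λ k, ((Finset.univ.filter
          (P3 (KL (fun a : Λ => (a : PP)) k))).filter fun t => g t = s).card :=
        Finset.sum_le_sum this
    _ = ((kCorridors Λ k).biUnion fun s => (Finset.univ.filter
          (P3 (KL (fun a : Λ => (a : PP)) k))).filter fun t => g t = s).card := by
        rw [Finset.card_biUnion]
        intro s _ s2 _ hne
        rw [Function.onFun, Finset.disjoint_left]
        intro t h1 h2
        exact hne ((Finset.mem_filter.1 h1).2.symm.trans (Finset.mem_filter.1 h2).2)
    _ ≤ _ := Finset.card_le_card (Finset.biUnion_subset.2 fun s _ => Finset.filter_subset _ _)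

end PartZ

/-- For a family `Λ` of `n` pseudoplanes in general position in ℝ³ and a
nonnegative integer `k`, the number `|C^k|` of `k`-corridors satisfies
`|C^k|³ ≤ 48 n⁸ + 64 n⁶` (hence the complexity of the `k`-level is `O(n^{8/3})`). -/
theorem statement1 (Λ : Finset PP) (n k : ℕ) (hn : Λ.card = n)
    (hΛ : PseudoplaneFamily Λ) :
    ((kCorridors Λ k).card) ^ 3 ≤ 48 * n ^ 8 + 64 * n ^ 6 := by
  obtain ⟨φ, T, E, H, G⟩ := Geo.exists Λ hΛ
  have hcard : Fintype.card Λ = n := by rw [Fintype.card_coe, hn]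
  have h6 := six_corr Λ k
  have hX := G.X5 k
  rw [hcard] at hX
  refine final_arith _ n _ ?_ hX ?_
  · intro h0
    have : Λ = ∅ := Finset.card_eq_zero.1 (hn.trans h0)
    subst this
    rfl
  · intro q hq
    have hs := G.sample (KL (fun a : Λ => (a : PP)) k) (fun a b c h => KL.k2 a b c h) q hq
    rw [hcard] at hs
    refine le_trans ?_ hs
    apply Nat.mul_le_mul_right
    omega
end
end

section
/- (Dual Lovász Lemma for planes.) Let Λ be a set of n nonvertical planes in ℝ³ in general position and let k be a nonnegative integer. Any nonvertical line l₀ that is not parallel to any plane of Λ and is disjoint from every intersection line a ∩ b of two planes of Λ (so it does not intersect any edge of the arrangement) is fully contained in at most n(n−1)/2 corridors of C^k. -/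
open scoped Classical

noncomputable section

/-- `a` is an affine function, i.e. its graph is a nonvertical plane. -/
def IsAffinePlane (a : PP) : Prop :=
  ∃ α β δ : ℝ, ∀ x y : ℝ, a x y = α * x + β * y + δ

/-- A set of nonvertical planes in general position:
the linear parts of any two are distinct (the difference is nonconstant, so any two planes
meet in a line), any three planes meet in exactly one point, and no four planes have a
common point. -/
def PlaneFamily (Λ : Finset PP) : Prop :=
  (∀ a ∈ Λ, IsAffinePlane a) ∧
  (∀ a ∈ Λ, ∀ b ∈ Λ, a ≠ b → ∃ x y x' y' : ℝ, a x y - b x y ≠ a x' y' - b x' y') ∧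
  (∀ a ∈ Λ, ∀ b ∈ Λ, ∀ c ∈ Λ, a ≠ b → a ≠ c → b ≠ c →
    ∃! q : ℝ × ℝ, a q.1 q.2 = b q.1 q.2 ∧ a q.1 q.2 = c q.1 q.2) ∧
  (∀ a ∈ Λ, ∀ b ∈ Λ, ∀ c ∈ Λ, ∀ d ∈ Λ, a ≠ b → a ≠ c → a ≠ d → b ≠ c → b ≠ d → c ≠ d →
    ¬ ∃ x y : ℝ, a x y = b x y ∧ a x y = c x y ∧ a x y = d x y)

theorem core_tel {ι : Type*} (r : ι → ℝ) (pos : ι → Prop) (k : ℕ) (S : Finset ι) :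
    Set.InjOn r S → ∀ n0 : ℕ,
    (∑ c ∈ S, (if n0 + (S.filter fun d => pos d ∧ r d < r c).card
        + (S.filter fun d => ¬ pos d ∧ r c < r d).card = k then (if pos c then (1:ℤ) else -1) else 0))
    = (if k < n0 + (S.filter fun d => pos d).card then 1 else 0)
      - (if k < n0 + (S.filter fun d => ¬ pos d).card then 1 else 0) := by
  induction S using Finset.induction_on_max_value r with
  | empty => intro _ n0; simp
  | insert c0 S hc0 hmax ih =>
    intro hinj n0
    have hinj' : Set.InjOn r S := hinj.mono (by simp)
    have hlt : ∀ x ∈ S, r x < r c0 := by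
      intro x hx
      refine lt_of_le_of_ne (hmax x hx) ?_
      intro h
      have := hinj (by simp [hx]) (by simp) h
      exact hc0 (this ▸ hx)
    rw [Finset.sum_insert hc0]
    by_cases hp : pos c0
    · have e1 : (insert c0 S).filter (fun d => pos d ∧ r d < r c0) = S.filter (fun d => pos d) := by
        ext d; simp only [Finset.mem_filter, Finset.mem_insert]
        constructor
        · rintro ⟨rfl | h, h1, h2⟩
          · exact absurd h2 (lt_irrefl _)
          · exact ⟨h, h1⟩
        · rintro ⟨h, h1⟩; exact ⟨Or.inr h, h1, hlt d h⟩
      have e2 : (insert c0 S).filter (fun d => ¬ pos d ∧ r c0 < r d) = ∅ := by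
        ext d; simp only [Finset.mem_filter, Finset.mem_insert, Finset.notMem_empty, iff_false]
        rintro ⟨rfl | h, h1, h2⟩
        · exact lt_irrefl _ h2
        · exact lt_asymm h2 (hlt d h)
      have e3 : ∀ c ∈ S, (insert c0 S).filter (fun d => pos d ∧ r d < r c)
          = S.filter (fun d => pos d ∧ r d < r c) := by
        intro c hc
        rw [Finset.filter_insert, if_neg]
        rintro ⟨_, h⟩; exact lt_asymm h (hlt c hc)
      have e4 : ∀ c, (insert c0 S).filter (fun d => ¬ pos d ∧ r c < r d)
          = S.filter (fun d => ¬ pos d ∧ r c < r d) := by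
        intro c
        rw [Finset.filter_insert, if_neg]
        rintro ⟨h, _⟩; exact h hp
      rw [e1, e2]
      rw [Finset.sum_congr rfl (fun c hc => by rw [e3 c hc, e4 c])]
      rw [ih hinj' n0]
      have e6 : ((insert c0 S).filter (fun d => pos d)).card = (S.filter (fun d => pos d)).card + 1 := by
        rw [Finset.filter_insert, if_pos hp, Finset.card_insert_of_notMem (by simp [hc0])]
      have e7 : (insert c0 S).filter (fun d => ¬ pos d) = S.filter (fun d => ¬ pos d) := by
        rw [Finset.filter_insert, if_neg (not_not.mpr hp)]
      rw [e6, e7]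
      simp only [hp, if_true, Finset.card_empty]
      split_ifs <;> first | omega | rfl
    · have e1 : (insert c0 S).filter (fun d => pos d ∧ r d < r c0) = S.filter (fun d => pos d) := by
        ext d; simp only [Finset.mem_filter, Finset.mem_insert]
        constructor
        · rintro ⟨rfl | h, h1, h2⟩
          · exact absurd h2 (lt_irrefl _)
          · exact ⟨h, h1⟩
        · rintro ⟨h, h1⟩; exact ⟨Or.inr h, h1, hlt d h⟩
      have e2 : (insert c0 S).filter (fun d => ¬ pos d ∧ r c0 < r d) = ∅ := by
        ext d; simp only [Finset.mem_filter, Finset.mem_insert, Finset.notMem_empty, iff_false]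
        rintro ⟨rfl | h, h1, h2⟩
        · exact lt_irrefl _ h2
        · exact lt_asymm h2 (hlt d h)
      have e3 : ∀ c, (insert c0 S).filter (fun d => pos d ∧ r d < r c)
          = S.filter (fun d => pos d ∧ r d < r c) := by
        intro c
        rw [Finset.filter_insert, if_neg]
        rintro ⟨h, _⟩; exact hp h
      have e4 : ∀ c ∈ S, ((insert c0 S).filter (fun d => ¬ pos d ∧ r c < r d)).card
          = (S.filter (fun d => ¬ pos d ∧ r c < r d)).card + 1 := by
        intro c hc
        rw [Finset.filter_insert, if_pos ⟨hp, hlt c hc⟩,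
          Finset.card_insert_of_notMem (by simp [hc0])]
      have e5 : ∀ c ∈ S, (if n0 + ((insert c0 S).filter fun d => pos d ∧ r d < r c).card
        + ((insert c0 S).filter fun d => ¬ pos d ∧ r c < r d).card = k
          then (if pos c then (1:ℤ) else -1) else 0)
          = (if (n0 + 1) + (S.filter fun d => pos d ∧ r d < r c).card
        + (S.filter fun d => ¬ pos d ∧ r c < r d).card = k then (if pos c then (1:ℤ) else -1) else 0) := by
        intro c hc
        rw [e3, e4 c hc]
        congr 1
        apply propext
        constructor <;> intro h <;> omega
      rw [e1, e2, Finset.sum_congr rfl e5, ih hinj' (n0+1)]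
      have e6 : ((insert c0 S).filter (fun d => ¬ pos d)).card
          = (S.filter (fun d => ¬ pos d)).card + 1 := by
        rw [Finset.filter_insert, if_pos hp, Finset.card_insert_of_notMem (by simp [hc0])]
      have e7 : (insert c0 S).filter (fun d => pos d) = S.filter (fun d => pos d) := by
        rw [Finset.filter_insert, if_neg hp]
      rw [e6, e7]
      simp only [hp, if_false, Finset.card_empty]
      split_ifs <;> first | omega | rfl

theorem half_bound {ι : Type*} (M : Finset ι) (A r : ι → ℝ) (hA : ∀ c ∈ M, A c ≠ 0)
    (hr : Set.InjOn r M) (k : ℕ) :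
    |∑ c ∈ M.filter (fun c => 0 < r c),
      (if (M.filter fun d => A d * (r c - r d) < 0).card = k then
        (if A c < 0 then (1:ℤ) else -1) else 0)| ≤ 1 := by
  set S := M.filter (fun c => 0 < r c) with hS
  have key : ∀ c ∈ S, (M.filter fun d => A d * (r c - r d) < 0).card
      = (M.filter fun d => ¬ 0 < r d ∧ A d < 0).card
        + (S.filter fun d => A d < 0 ∧ r d < r c).card
        + (S.filter fun d => ¬ A d < 0 ∧ r c < r d).card := by
    intro c hc
    have hc' : 0 < r c := (Finset.mem_filter.mp hc).2
    rw [← Finset.card_union_of_disjoint, ← Finset.card_union_of_disjoint]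
    · congr 1
      ext d
      simp only [hS, Finset.mem_filter, Finset.mem_union]
      constructor
      · rintro ⟨hd, h⟩
        rcases mul_neg_iff.mp h with ⟨h1, h2⟩ | ⟨h1, h2⟩
        · right; exact ⟨⟨hd, by linarith⟩, by linarith, by linarith⟩
        · left
          by_cases h3 : 0 < r d
          · right; exact ⟨⟨hd, h3⟩, h1, by linarith⟩
          · left; exact ⟨hd, h3, h1⟩
      · rintro ((⟨hd, h1, h2⟩ | ⟨⟨hd, h0⟩, h1, h2⟩) | ⟨⟨hd, h0⟩, h1, h2⟩)
        · exact ⟨hd, mul_neg_of_neg_of_pos h2 (by linarith)⟩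
        · exact ⟨hd, mul_neg_of_neg_of_pos h1 (by linarith)⟩
        · have := lt_of_le_of_ne (not_lt.mp h1) (Ne.symm (hA d hd))
          exact ⟨hd, mul_neg_of_pos_of_neg this (by linarith)⟩
    · rw [Finset.disjoint_left]
      intro d
      simp only [hS, Finset.mem_filter, Finset.mem_union]
      rintro (⟨_, _, h⟩ | ⟨_, h, _⟩) ⟨_, h', _⟩ <;> exact h' h
    · rw [Finset.disjoint_left]
      intro d
      simp only [hS, Finset.mem_filter]
      rintro ⟨_, h, _⟩ ⟨⟨_, h'⟩, _⟩; exact h h'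
  rw [Finset.sum_congr rfl (fun c hc => by rw [key c hc])]
  rw [core_tel r (fun c => A c < 0) k S (hr.mono (by intro x hx; exact (Finset.mem_filter.mp hx).1))]
  split_ifs <;> simp

theorem line_bound {ι : Type*} (M : Finset ι) (A r : ι → ℝ) (hA : ∀ c ∈ M, A c ≠ 0)
    (hr : Set.InjOn r M) (k : ℕ) :
    |∑ c ∈ M, (if (M.filter fun d => A d * (r c - r d) < 0).card = k then
        ((SignType.sign (-(A c * r c)) : SignType) : ℤ) else 0)| ≤ 2 := by
  have h1 := half_bound M A r hA hr k
  have h2 := half_bound M (fun c => - A c) (fun c => - r c) (fun c hc => neg_ne_zero.mpr (hA c hc))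
    (fun c hc d hd h => hr hc hd (neg_injective h)) k
  have e : ∀ c d, - A d * (- r c - - r d) = A d * (r c - r d) := by intros; ring
  simp only [e, Finset.sum_filter] at h1 h2
  have : (∑ c ∈ M, (if (M.filter fun d => A d * (r c - r d) < 0).card = k then
        ((SignType.sign (-(A c * r c)) : SignType) : ℤ) else 0))
    = (∑ c ∈ M, if 0 < r c then (if (M.filter fun d => A d * (r c - r d) < 0).card = k then
        (if A c < 0 then (1:ℤ) else -1) else 0) else 0)
    + (∑ c ∈ M, if 0 < - r c then (if (M.filter fun d => A d * (r c - r d) < 0).card = k then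
        (if - A c < 0 then (1:ℤ) else -1) else 0) else 0) := by
    rw [← Finset.sum_add_distrib]
    refine Finset.sum_congr rfl fun c hc => ?_
    by_cases hk : (M.filter fun d => A d * (r c - r d) < 0).card = k
    · simp only [hk, if_true]
      rcases lt_or_gt_of_ne (hA c hc) with ha | ha <;> rcases lt_trichotomy (r c) 0 with h | h | h
      · have : -(A c * r c) < 0 := by nlinarith
        rw [sign_neg this]
        simp [h, ha.le, not_lt.mpr h.le]
      · simp [h]
      · have : 0 < -(A c * r c) := by nlinarith
        rw [sign_pos this]
        simp [h, ha, not_lt.mpr h.le]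
      · have : 0 < -(A c * r c) := by nlinarith
        rw [sign_pos this]
        simp [h, ha, not_lt.mpr h.le]
      · simp [h]
      · have : -(A c * r c) < 0 := by nlinarith
        rw [sign_neg this]
        simp [h, not_lt.mpr ha.le, not_lt.mpr h.le]
    · simp [hk]
  rw [this]
  exact (abs_add_le _ _).trans (by linarith)

/-- Integer-valued sign of a real number. -/
def sg (x : ℝ) : ℤ := ((SignType.sign x : SignType) : ℤ)

theorem sg_pos' {x : ℝ} (h : 0 < x) : sg x = 1 := by simp [sg, sign_pos h]
theorem sg_neg' {x : ℝ} (h : x < 0) : sg x = -1 := by simp [sg, sign_neg h]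
theorem sg_neg_eq (x : ℝ) : sg (-x) = - sg x := by
  rcases lt_trichotomy x 0 with h | h | h
  · rw [sg_pos' (by linarith), sg_neg' h]; rfl
  · simp [sg, h]
  · rw [sg_neg' (by linarith), sg_pos' h]
theorem sg_mul (x y : ℝ) : sg (x * y) = sg x * sg y := by simp [sg, sign_mul]
theorem sg_abs_le (x : ℝ) : |sg x| ≤ 1 := by
  rcases lt_trichotomy x 0 with h | h | h
  · rw [sg_neg' h]; simp
  · simp [sg, h]
  · rw [sg_pos' h]; simp

/-- Orientation of the pair `a, b` as seen from the origin. -/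
def HH {ι : Type*} (σ c : ι → ℝ) (a b : ι) : ℝ := σ a * c b - σ b * c a

/-- Orientation of the triple. -/
def DD {ι : Type*} (σ c : ι → ℝ) (a b d : ι) : ℝ := HH σ c a b + HH σ c b d + HH σ c d a

theorem arith_two_pos {h1 h2 h3 p q m : ℝ} (hp : 0 < p) (hq : 0 < q) (hm : m < 0)
    (h1n : h1 ≠ 0) (h2n : h2 ≠ 0) (hid : p * h2 + m * h3 + q * h1 = 0) :
    0 ≤ sg (h1 * (h1 + h2 + h3)) + sg (h2 * (h1 + h2 + h3)) ∧
    (0 < h1 * h2 → 2 ≤ sg (h1 * (h1 + h2 + h3)) + sg (h2 * (h1 + h2 + h3))) := by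
  rw [sg_mul, sg_mul]
  rcases lt_or_gt_of_ne h1n with h | h <;> rcases lt_or_gt_of_ne h2n with h' | h'
  · have : h3 < 0 := by
      by_contra hc
      nlinarith [mul_neg_of_pos_of_neg hp h', mul_neg_of_pos_of_neg hq h,
        mul_nonpos_of_nonpos_of_nonneg hm.le (not_lt.mp hc)]
    rw [sg_neg' h, sg_neg' h', sg_neg' (by linarith)]; simp
  · rw [sg_neg' h, sg_pos' h']; simp
    nlinarith
  · rw [sg_pos' h, sg_neg' h']; simp
    nlinarith
  · have : 0 < h3 := by
      by_contra hc
      nlinarith [mul_pos hp h', mul_pos hq h, mul_nonneg_of_nonpos_of_nonpos hm.le (not_lt.mp hc)]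
    rw [sg_pos' h, sg_pos' h', sg_pos' (by linarith)]; simp

/-- The local sum at a triple. -/
def GG {ι : Type*} (σ c : ι → ℝ) (s : Finset ι) : ℤ :=
  ∑ p ∈ s ×ˢ s ×ˢ s, if (0 < σ p.1 ∧ σ p.2.1 < 0 ∧ p.2.2 ≠ p.1 ∧ p.2.2 ≠ p.2.1) then
    sg (HH σ c p.1 p.2.1 * DD σ c p.1 p.2.1 p.2.2) else 0

/-- The line is contained in the corridor. -/
def LineCont {ι : Type*} (σ c : ι → ℝ) (s : Finset ι) : Prop :=
  ∀ t : ℝ, (∃ a ∈ s, σ a * t + c a < 0) ∧ (∃ a ∈ s, 0 < σ a * t + c a)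

theorem cont_root {ι : Type*} {σ c : ι → ℝ} {x y z : ι} (hz : σ z ≠ 0)
    (h : LineCont σ c {x, y, z}) : 0 < HH σ c x z * HH σ c z y := by
  obtain ⟨⟨a, ha, ha'⟩, ⟨b, hb, hb'⟩⟩ := h (-(c z) / σ z)
  have ez : σ z * (-(c z) / σ z) + c z = 0 := by field_simp; ring
  have ex : HH σ c x z = - σ z * (σ x * (-(c z) / σ z) + c x) := by
    unfold HH; field_simp; ring
  have ey : HH σ c z y = σ z * (σ y * (-(c z) / σ z) + c y) := by
    unfold HH; field_simp; ring
  rw [ex, ey]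
  set X := σ x * (-(c z) / σ z) + c x
  set Y := σ y * (-(c z) / σ z) + c y
  have hXY : X * Y < 0 := by
    simp only [Finset.mem_insert, Finset.mem_singleton] at ha hb
    rcases ha with rfl | rfl | rfl <;> rcases hb with rfl | rfl | rfl <;>
      first
      | (exact absurd ha' (by linarith))
      | (exact absurd hb' (by linarith))
      | (exact mul_neg_of_neg_of_pos ha' hb')
      | (exact mul_neg_of_pos_of_neg hb' ha')
  have : 0 < σ z ^ 2 := by positivity
  nlinarith [mul_pos this (neg_pos.mpr hXY)]

theorem gg_expand {ι : Type*} (σ c : ι → ℝ) {x y z : ι} (hxy : x ≠ y) (hxz : x ≠ z) (hyz : y ≠ z) :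
    GG σ c {x, y, z} =
      (if 0 < σ x ∧ σ y < 0 then sg (HH σ c x y * DD σ c x y z) else 0) +
      (if 0 < σ x ∧ σ z < 0 then sg (HH σ c x z * DD σ c x z y) else 0) +
      (if 0 < σ y ∧ σ x < 0 then sg (HH σ c y x * DD σ c y x z) else 0) +
      (if 0 < σ y ∧ σ z < 0 then sg (HH σ c y z * DD σ c y z x) else 0) +
      (if 0 < σ z ∧ σ x < 0 then sg (HH σ c z x * DD σ c z x y) else 0) +
      (if 0 < σ z ∧ σ y < 0 then sg (HH σ c z y * DD σ c z y x) else 0) := by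
  have nn : ∀ w : ι, ¬ (0 < σ w ∧ σ w < 0) := fun w h => lt_asymm h.1 h.2
  unfold GG
  simp only [Finset.sum_product]
  simp only [Finset.sum_insert (show x ∉ ({y, z} : Finset ι) by simp [hxy, hxz]),
    Finset.sum_insert (show y ∉ ({z} : Finset ι) by simp [hyz]), Finset.sum_singleton]
  simp [hxy, hxz, hyz, hxy.symm, hxz.symm, hyz.symm]
  rw [if_neg (nn x), if_neg (nn x), if_neg (nn y), if_neg (nn y), if_neg (nn z), if_neg (nn z)]
  ring

theorem pat_ppn {ι : Type*} {σ c : ι → ℝ} {x y z : ι} (hxy : x ≠ y) (hxz : x ≠ z) (hyz : y ≠ z)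
    (hx : 0 < σ x) (hy : 0 < σ y) (hz : σ z < 0)
    (h1 : HH σ c x z ≠ 0) (h2 : HH σ c z y ≠ 0) :
    0 ≤ GG σ c {x, y, z} ∧ (LineCont σ c {x, y, z} → 2 ≤ GG σ c {x, y, z}) := by
  rw [gg_expand σ c hxy hxz hyz]
  simp only [hx, hy, hz, not_lt.mpr hx.le, not_lt.mpr hy.le, not_lt.mpr hz.le, and_true, and_false,
    if_true, if_false, true_and, zero_add, add_zero]
  have := arith_two_pos (h1 := HH σ c x z) (h2 := HH σ c z y) (h3 := HH σ c y x) hx hy hz h1 h2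
    (by unfold HH; ring)
  have e : HH σ c y z * DD σ c y z x
      = HH σ c z y * (HH σ c x z + HH σ c z y + HH σ c y x) := by unfold DD HH; ring
  rw [e]
  exact ⟨this.1, fun h => this.2 (cont_root hz.ne h)⟩

theorem pat_nnp {ι : Type*} {σ c : ι → ℝ} {x y z : ι} (hxy : x ≠ y) (hxz : x ≠ z) (hyz : y ≠ z)
    (hx : σ x < 0) (hy : σ y < 0) (hz : 0 < σ z)
    (h1 : HH σ c x z ≠ 0) (h2 : HH σ c z y ≠ 0) :
    0 ≤ GG σ c {x, y, z} ∧ (LineCont σ c {x, y, z} → 2 ≤ GG σ c {x, y, z}) := by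
  rw [gg_expand σ c hxy hxz hyz]
  simp only [hx, hy, hz, not_lt.mpr hx.le, not_lt.mpr hy.le, not_lt.mpr hz.le, and_true, and_false,
    if_true, if_false, true_and, zero_add, add_zero]
  have := arith_two_pos (h1 := HH σ c x z) (h2 := HH σ c z y) (h3 := HH σ c y x)
    (neg_pos.mpr hx) (neg_pos.mpr hy) (neg_neg_iff_pos.mpr hz) h1 h2
    (by unfold HH; ring)
  have e : HH σ c z y * DD σ c z y x
      = HH σ c z y * (HH σ c x z + HH σ c z y + HH σ c y x) := by unfold DD HH; ring
  have e' : HH σ c z x * DD σ c z x y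
      = HH σ c x z * (HH σ c x z + HH σ c z y + HH σ c y x) := by unfold DD HH; ring
  rw [e, e']
  exact ⟨this.1, fun h => this.2 (cont_root hz.ne' h)⟩

theorem pat_same {ι : Type*} {σ c : ι → ℝ} {x y z : ι} (hxy : x ≠ y) (hxz : x ≠ z) (hyz : y ≠ z)
    (hs : (0 < σ x ∧ 0 < σ y ∧ 0 < σ z) ∨ (σ x < 0 ∧ σ y < 0 ∧ σ z < 0)) :
    0 ≤ GG σ c {x, y, z} ∧ (LineCont σ c {x, y, z} → 2 ≤ GG σ c {x, y, z}) := by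
  constructor
  · rw [gg_expand σ c hxy hxz hyz]
    rcases hs with ⟨hx, hy, hz⟩ | ⟨hx, hy, hz⟩ <;>
    simp [not_lt.mpr hx.le, not_lt.mpr hy.le, not_lt.mpr hz.le]
  · intro h
    exfalso
    set t := max (-(c x) / σ x) (max (-(c y) / σ y) (-(c z) / σ z))
    have hx' : -(c x) / σ x ≤ t := le_max_left _ _
    have hy' : -(c y) / σ y ≤ t := (le_max_left _ _).trans (le_max_right _ _)
    have hz' : -(c z) / σ z ≤ t := (le_max_right _ _).trans (le_max_right _ _)
    obtain ⟨⟨a, ha, ha'⟩, ⟨b, hb, hb'⟩⟩ := h t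
    simp only [Finset.mem_insert, Finset.mem_singleton] at ha hb
    rcases hs with ⟨hx, hy, hz⟩ | ⟨hx, hy, hz⟩
    · rw [div_le_iff₀ hx] at hx'
      rw [div_le_iff₀ hy] at hy'
      rw [div_le_iff₀ hz] at hz'
      rcases ha with rfl | rfl | rfl <;> linarith
    · rw [div_le_iff_of_neg hx] at hx'
      rw [div_le_iff_of_neg hy] at hy'
      rw [div_le_iff_of_neg hz] at hz'
      rcases hb with rfl | rfl | rfl <;> linarith

theorem triple_sum {ι : Type*} {σ c : ι → ℝ} (s : Finset ι) (hs : s.card = 3)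
    (hσ : ∀ a ∈ s, σ a ≠ 0) (hH : ∀ a ∈ s, ∀ b ∈ s, a ≠ b → HH σ c a b ≠ 0) :
    0 ≤ GG σ c s ∧ (LineCont σ c s → 2 ≤ GG σ c s) := by
  obtain ⟨x, y, z, hxy, hxz, hyz, rfl⟩ := Finset.card_eq_three.mp hs
  have p1 : ({x, y, z} : Finset ι) = {x, z, y} := by ext w; simp; tauto
  have p2 : ({x, y, z} : Finset ι) = {y, z, x} := by ext w; simp; tauto
  have mx : x ∈ ({x, y, z} : Finset ι) := by simp
  have my : y ∈ ({x, y, z} : Finset ι) := by simp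
  have mz : z ∈ ({x, y, z} : Finset ι) := by simp
  have hxy' := hH _ mx _ my hxy
  have hxz' := hH _ mx _ mz hxz
  have hyx' := hH _ my _ mx hxy.symm
  have hyz' := hH _ my _ mz hyz
  have hzx' := hH _ mz _ mx hxz.symm
  have hzy' := hH _ mz _ my hyz.symm
  rcases lt_or_gt_of_ne (hσ x mx) with hx | hx <;>
  rcases lt_or_gt_of_ne (hσ y my) with hy | hy <;>
  rcases lt_or_gt_of_ne (hσ z mz) with hz | hz
  · exact pat_same hxy hxz hyz (Or.inr ⟨hx, hy, hz⟩)
  · exact pat_nnp hxy hxz hyz hx hy hz hxz' hzy'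
  · rw [p1]; exact pat_nnp hxz hxy hyz.symm hx hz hy hxy' hyz'
  · rw [p2]; exact pat_ppn hyz hxy.symm hxz.symm hy hz hx hyx' hxz'
  · rw [p2]; exact pat_nnp hyz hxy.symm hxz.symm hy hz hx hyx' hxz'
  · rw [p1]; exact pat_ppn hxz hxy hyz.symm hx hz hy hxy' hyz'
  · exact pat_ppn hxy hxz hyz hx hy hz hxz' hzy'
  · exact pat_same hxy hxz hyz (Or.inl ⟨hx, hy, hz⟩)

theorem double_count {ι : Type*} (σ c : ι → ℝ) (Λ : Finset ι) (C : Finset (Finset ι))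
    (hC : ∀ s ∈ C, s ⊆ Λ ∧ s.card = 3) :
    ∑ s ∈ C, GG σ c s = ∑ a ∈ Λ, ∑ b ∈ Λ, if 0 < σ a ∧ σ b < 0 then
      (∑ d ∈ Λ, if (d ≠ a ∧ d ≠ b ∧ ({a, b, d} : Finset ι) ∈ C) then
        sg (HH σ c a b * DD σ c a b d) else 0) else 0 := by
  have h1 : ∀ s ∈ C, GG σ c s = ∑ p ∈ Λ ×ˢ Λ ×ˢ Λ, if p ∈ s ×ˢ s ×ˢ s then
      (if (0 < σ p.1 ∧ σ p.2.1 < 0 ∧ p.2.2 ≠ p.1 ∧ p.2.2 ≠ p.2.1) then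
      sg (HH σ c p.1 p.2.1 * DD σ c p.1 p.2.1 p.2.2) else 0) else 0 := by
    intro s hs
    unfold GG
    rw [← Finset.sum_filter (p := fun p => p ∈ s ×ˢ s ×ˢ s)]
    refine Finset.sum_congr ?_ (fun _ _ => rfl)
    ext p
    have := (hC s hs).1
    simp only [Finset.mem_filter, Finset.mem_product]
    constructor
    · intro h; exact ⟨⟨this h.1, this h.2.1, this h.2.2⟩, h⟩
    · exact fun h => h.2
  rw [Finset.sum_congr rfl h1, Finset.sum_comm, Finset.sum_product]
  refine Finset.sum_congr rfl fun a ha => ?_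
  rw [Finset.sum_product]
  refine Finset.sum_congr rfl fun b hb => ?_
  by_cases hab : 0 < σ a ∧ σ b < 0
  · rw [if_pos hab]
    refine Finset.sum_congr rfl fun d hd => ?_
    have hne : a ≠ b := by rintro rfl; exact lt_asymm hab.1 hab.2
    by_cases hd' : d ≠ a ∧ d ≠ b
    · simp only [hab, hd', true_and, and_true, ne_eq, not_false_eq_true, if_true]
      have : ∀ s ∈ C, ((a, b, d) ∈ s ×ˢ s ×ˢ s) = (s = {a, b, d}) := by
        intro s hs
        apply propext
        simp only [Finset.mem_product]
        constructor
        · rintro ⟨h1, h2, h3⟩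
          symm
          apply Finset.eq_of_subset_of_card_le
          · intro w; simp only [Finset.mem_insert, Finset.mem_singleton]
            rintro (rfl | rfl | rfl) <;> assumption
          · rw [(hC s hs).2, Finset.card_eq_three.mpr
              ⟨a, b, d, hne, hd'.1.symm, hd'.2.symm, rfl⟩]
        · rintro rfl; simp
      rw [Finset.sum_congr rfl (fun s hs => by rw [if_congr (iff_of_eq (this s hs)) rfl rfl])]
      simp
    · rw [if_neg (c := (d ≠ a ∧ d ≠ b ∧ ({a, b, d} : Finset ι) ∈ C)) (by tauto)]
      refine Finset.sum_eq_zero fun s hs => ?_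
      simp only
      rw [if_neg (c := (0 < σ a ∧ σ b < 0 ∧ d ≠ a ∧ d ≠ b)) (by tauto), ite_self]
  · rw [if_neg hab]
    refine Finset.sum_eq_zero fun d hd => Finset.sum_eq_zero fun s hs => ?_
    simp only
    rw [if_neg (c := (0 < σ a ∧ σ b < 0 ∧ d ≠ a ∧ d ≠ b)) (by tauto), ite_self]

theorem pair_count {ι : Type*} (σ : ι → ℝ) (Λ : Finset ι) (n : ℕ) (hn : Λ.card = n) :
    (∑ a ∈ Λ, ∑ b ∈ Λ, if 0 < σ a ∧ σ b < 0 then (1 : ℕ) else 0) ≤ n * (n - 1) / 2 := by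
  have h : (∑ a ∈ Λ, ∑ b ∈ Λ, if 0 < σ a ∧ σ b < 0 then (1 : ℕ) else 0)
      = (Λ.filter fun a => 0 < σ a).card * (Λ.filter fun a => σ a < 0).card := by
    rw [Finset.card_filter, Finset.card_filter, Finset.sum_mul_sum]
    refine Finset.sum_congr rfl fun a _ => Finset.sum_congr rfl fun b _ => ?_
    by_cases h1 : 0 < σ a <;> by_cases h2 : σ b < 0 <;> simp [h1, h2]
  rw [h]
  generalize hp : (Λ.filter fun a => 0 < σ a).card = p
  generalize hm : (Λ.filter fun a => σ a < 0).card = m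
  have hpm : p + m ≤ n := by
    rw [← hn, ← hp, ← hm, ← Finset.card_union_of_disjoint]
    · apply Finset.card_le_card
      intro a; simp only [Finset.mem_union, Finset.mem_filter]; tauto
    · rw [Finset.disjoint_left]; intro a
      simp only [Finset.mem_filter]
      rintro ⟨_, h⟩ ⟨_, h'⟩; exact lt_asymm h h'
  rw [Nat.le_div_iff_mul_le (by norm_num)]
  rcases Nat.eq_zero_or_pos p with h0 | h0
  · simp [h0]
  rcases Nat.eq_zero_or_pos m with h1 | h1
  · simp [h1]
  calc p * m * 2 ≤ (p + m) * (p + m - 1) := by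
        clear hp hm h hpm
        obtain ⟨p, rfl⟩ := Nat.exists_eq_succ_of_ne_zero h0.ne'
        obtain ⟨m, rfl⟩ := Nat.exists_eq_succ_of_ne_zero h1.ne'
        have : p.succ + m.succ - 1 = p + m + 1 := by omega
        rw [this, Nat.succ_eq_add_one, Nat.succ_eq_add_one]
        nlinarith [Nat.zero_le (p * p), Nat.zero_le (m * m)]
    _ ≤ n * (n - 1) := Nat.mul_le_mul hpm (by omega)

theorem edge_bound (Λ : Finset PP) (k : ℕ) (hΛ : PlaneFamily Λ) (α β δ : PP → ℝ)
    (hc : ∀ a ∈ Λ, ∀ x y, a x y = α a * x + β a * y + δ a)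
    (q1 q2 q3 v1 v2 v3 : ℝ) (σ c : PP → ℝ)
    (hσ : ∀ a, σ a = α a * v1 + β a * v2 - v3)
    (hcc : ∀ a, c a = α a * q1 + β a * q2 + δ a - q3)
    (a b : PP) (ha : a ∈ Λ) (hb : b ∈ Λ) (hpa : 0 < σ a) (hnb : σ b < 0) :
    |∑ d ∈ Λ, if (d ≠ a ∧ d ≠ b ∧ ({a, b, d} : Finset PP) ∈ kCorridors Λ k) then
        sg (HH σ c a b * DD σ c a b d) else 0| ≤ 2 := by
  obtain ⟨-, -, h3, h4⟩ := hΛ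
  have hab : a ≠ b := by rintro rfl; exact lt_asymm hpa hnb
  have hs : 0 < σ a - σ b := by linarith
  set M := Λ.filter (fun d => d ≠ a ∧ d ≠ b) with hM
  set t := (c b - c a) / (σ a - σ b) with ht
  have ht' : t * (σ a - σ b) = c b - c a := by rw [ht]; field_simp
  set Dx := α a - α b with hDx
  set Dy := β a - β b with hDy
  set X : ℝ → ℝ := fun u => q1 + t * v1 - Dy * u with hX
  set Y : ℝ → ℝ := fun u => q2 + t * v2 + Dx * u with hY
  set A : PP → ℝ := fun d => -(α d - α a) * Dy + (β d - β a) * Dx with hA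
  set B : PP → ℝ := fun d => (α d - α a) * (q1 + t * v1) + (β d - β a) * (q2 + t * v2)
    + (δ d - δ a) with hB
  set r : PP → ℝ := fun d => - B d / A d with hr
  have hdiff : ∀ d ∈ Λ, ∀ u, d (X u) (Y u) - a (X u) (Y u) = A d * u + B d := by
    intro d hd u
    rw [hc d hd, hc a ha]; simp only [hX, hY, hA, hB]; ring
  have hDs : Dx * v1 + Dy * v2 = σ a - σ b := by rw [hσ, hσ]; ring
  have hba : ∀ u, a (X u) (Y u) = b (X u) (Y u) := by
    intro u
    have h1 := hdiff b hb u
    have h2 : A b * u + B b = 0 := by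
      have e1 : A b = 0 := by simp only [hA, hDx, hDy]; ring
      have e2 : B b = 0 := by
        have := ht'
        rw [hσ, hσ, hcc, hcc] at this
        simp only [hB]; linear_combination -this
      rw [e1, e2]; ring
    linarith
  have hA0 : ∀ d ∈ M, A d ≠ 0 := by
    intro d hd h0
    obtain ⟨hdΛ, hda, hdb⟩ := Finset.mem_filter.mp hd
    obtain ⟨p, ⟨hp1, hp2⟩, hpu⟩ := h3 a ha b hb d hdΛ hab hda.symm hdb.symm
    have := hpu (p.1 - Dy, p.2 + Dx) (by
      simp only [hc a ha, hc b hb, hc d hdΛ] at hp1 hp2 ⊢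
      simp only [hA] at h0
      constructor
      · rw [hDx, hDy]; linear_combination hp1
      · linear_combination hp2 - h0)
    have e1 : p.1 - Dy = p.1 := congrArg Prod.fst this
    have e2 : p.2 + Dx = p.2 := congrArg Prod.snd this
    have e1' : Dy = 0 := by linarith
    have e2' : Dx = 0 := by linarith
    rw [e1', e2'] at hDs
    linarith
  have hAr : ∀ d ∈ M, ∀ u, A d * (u - r d) = A d * u + B d := by
    intro d hd u
    have := hA0 d hd
    simp only [hr]; field_simp; ring
  have hroot : ∀ d ∈ M, a (X (r d)) (Y (r d)) = d (X (r d)) (Y (r d)) := by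
    intro d hd
    have h1 := hdiff d (Finset.mem_filter.mp hd).1 (r d)
    rw [← hAr d hd] at h1
    simp at h1; linarith
  have hinj : Set.InjOn r M := by
    intro d hd e he hde
    by_contra hne
    obtain ⟨hdΛ, hda, hdb⟩ := Finset.mem_filter.mp hd
    obtain ⟨heΛ, hea, heb⟩ := Finset.mem_filter.mp he
    refine h4 a ha b hb d hdΛ e heΛ hab hda.symm hea.symm hdb.symm heb.symm hne
      ⟨X (r d), Y (r d), hba _, hroot d hd, ?_⟩
    rw [hde]; exact hroot e he
  have hlev : ∀ d ∈ M, level Λ (X (r d)) (Y (r d)) (a (X (r d)) (Y (r d)))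
      = (M.filter fun e => A e * (r d - r e) < 0).card := by
    intro d hd
    unfold level
    congr 1
    ext e
    simp only [Finset.mem_filter]
    constructor
    · rintro ⟨he, hlt⟩
      have heM : e ∈ M := by
        refine Finset.mem_filter.mpr ⟨he, ?_, ?_⟩
        · rintro rfl; exact lt_irrefl _ hlt
        · rintro rfl; rw [hba] at hlt; exact lt_irrefl _ hlt
      refine ⟨heM, ?_⟩
      rw [hAr e heM, ← hdiff e he]; linarith
    · rintro ⟨heM, hlt⟩
      have he := (Finset.mem_filter.mp heM).1
      rw [hAr e heM, ← hdiff e he] at hlt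
      exact ⟨he, by linarith⟩
  have hmem : ∀ d ∈ M, (({a, b, d} : Finset PP) ∈ kCorridors Λ k)
      ↔ (M.filter fun e => A e * (r d - r e) < 0).card = k := by
    intro d hd
    obtain ⟨hdΛ, hda, hdb⟩ := Finset.mem_filter.mp hd
    rw [← hlev d hd]
    unfold kCorridors IsKCorridorTriple
    rw [Finset.mem_filter, Finset.mem_powersetCard]
    constructor
    · rintro ⟨_, x, y, z, hz, hl⟩
      have za := hz a (by simp)
      have zb := hz b (by simp)
      have zd := hz d (by simp)
      have := (h3 a ha b hb d hdΛ hab hda.symm hdb.symm).unique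
        (y₁ := (x, y)) (y₂ := (X (r d), Y (r d)))
        ⟨by simp [za, zb], by simp [za, zd]⟩ ⟨hba _, hroot d hd⟩
      have e1 : x = X (r d) := congrArg Prod.fst this
      have e2 : y = Y (r d) := congrArg Prod.snd this
      rw [← e1, ← e2, za]; exact hl
    · intro hl
      refine ⟨⟨?_, Finset.card_eq_three.mpr ⟨a, b, d, hab, hda.symm, hdb.symm, rfl⟩⟩,
        X (r d), Y (r d), a (X (r d)) (Y (r d)), ?_, hl⟩
      · intro w; simp only [Finset.mem_insert, Finset.mem_singleton]
        rintro (rfl | rfl | rfl) <;> assumption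
      · intro w; simp only [Finset.mem_insert, Finset.mem_singleton]
        rintro (rfl | rfl | rfl)
        · rfl
        · exact (hba _).symm
        · exact (hroot _ hd).symm
  have hDD : ∀ d, DD σ c a b d = (σ a - σ b) * (-B d) := by
    intro d
    have h1 : (σ a - σ b) * B d = (σ a - σ b) * (c d - c a) + (t * (σ a - σ b)) * (σ d - σ a) := by
      rw [hcc d, hcc a, hσ d]; simp only [hB]
      have := hσ a
      linear_combination ((σ a - σ b) * t) * this
    rw [ht'] at h1
    unfold DD HH
    linear_combination h1
  have hsum : (∑ d ∈ Λ, if (d ≠ a ∧ d ≠ b ∧ ({a, b, d} : Finset PP) ∈ kCorridors Λ k) then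
        sg (HH σ c a b * DD σ c a b d) else 0)
      = - sg (HH σ c a b) * ∑ d ∈ M, (if (M.filter fun e => A e * (r d - r e) < 0).card = k then
        ((SignType.sign (-(A d * r d)) : SignType) : ℤ) else 0) := by
    rw [Finset.mul_sum]
    rw [show (∑ d ∈ Λ, if (d ≠ a ∧ d ≠ b ∧ ({a, b, d} : Finset PP) ∈ kCorridors Λ k) then
        sg (HH σ c a b * DD σ c a b d) else 0) = ∑ d ∈ M,
        if ({a, b, d} : Finset PP) ∈ kCorridors Λ k then
        sg (HH σ c a b * DD σ c a b d) else 0 by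
      rw [hM, Finset.sum_filter]
      refine Finset.sum_congr rfl fun d _ => ?_
      rw [← ite_and]; simp only [and_assoc]]
    refine Finset.sum_congr rfl fun d hd => ?_
    rw [if_congr (hmem d hd) rfl rfl]
    have e : -(A d * r d) = B d := by
      have := hAr d hd 0; linarith
    rw [e, sg_mul, hDD, sg_mul, sg_pos' hs, sg_neg_eq]
    change _ = - sg (HH σ c a b) * (if _ then sg (B d) else 0)
    split_ifs <;> ring
  rw [hsum, abs_mul, abs_neg]
  have h1 := line_bound M A r hA0 hinj k
  have h2 := sg_abs_le (HH σ c a b)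
  calc _ ≤ 1 * (2:ℤ) := mul_le_mul h2 h1 (abs_nonneg _) (by norm_num)
    _ = 2 := by norm_num

/-- Dual Lovász Lemma for planes: Let `Λ` be a set of `n` nonvertical planes
in ℝ³ in general position and `k` a nonnegative integer. Any nonvertical line `l₀` that is
not parallel to any plane of `Λ` (i.e. is neither disjoint from nor contained in any of the
graphs) and is disjoint from every intersection line of two planes of `Λ` is fully contained
in at most `n(n−1)/2` corridors of `C^k`. -/
theorem statement13 (Λ : Finset PP) (n k : ℕ) (hn : Λ.card = n) (hΛ : PlaneFamily Λ)
    (q v : ℝ × ℝ × ℝ) (hv : (v.1, v.2.1) ≠ ((0 : ℝ), (0 : ℝ)))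
    (L : Set (ℝ × ℝ × ℝ))
    (hL : L = {p | ∃ t : ℝ, p = (q.1 + t * v.1, q.2.1 + t * v.2.1, q.2.2 + t * v.2.2)})
    (hnotpar : ∀ a ∈ Λ, ¬ (L ∩ {p : ℝ × ℝ × ℝ | a p.1 p.2.1 = p.2.2} = ∅ ∨
        L ⊆ {p : ℝ × ℝ × ℝ | a p.1 p.2.1 = p.2.2}))
    (hdisj : ∀ a ∈ Λ, ∀ b ∈ Λ, a ≠ b →
      L ∩ {p : ℝ × ℝ × ℝ | a p.1 p.2.1 = p.2.2 ∧ b p.1 p.2.1 = p.2.2} = ∅) :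
    ((kCorridors Λ k).filter fun s => L ⊆ corridorSet s).card ≤ n * (n - 1) / 2 := by
  classical
  have hΛ' := hΛ
  obtain ⟨haff, -, -, -⟩ := hΛ'
  have : ∀ a : PP, ∃ α β δ : ℝ, a ∈ Λ → ∀ x y : ℝ, a x y = α * x + β * y + δ := by
    intro a
    by_cases h : a ∈ Λ
    · obtain ⟨α, β, δ, h'⟩ := haff a h
      exact ⟨α, β, δ, fun _ => h'⟩
    · exact ⟨0, 0, 0, fun h' => absurd h' h⟩
  choose α β δ hc using this
  obtain ⟨q1, q2, q3⟩ := q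
  obtain ⟨v1, v2, v3⟩ := v
  simp only at hL
  set σ : PP → ℝ := fun a => α a * v1 + β a * v2 - v3 with hσ
  set c : PP → ℝ := fun a => α a * q1 + β a * q2 + δ a - q3 with hcd
  have hval : ∀ a ∈ Λ, ∀ t : ℝ, a (q1 + t * v1) (q2 + t * v2) - (q3 + t * v3) = σ a * t + c a := by
    intro a ha t
    rw [hc a ha]; simp only [hσ, hcd]; ring
  have hmemL : ∀ t : ℝ, (q1 + t * v1, q2 + t * v2, q3 + t * v3) ∈ L := by
    intro t; rw [hL]; exact ⟨t, rfl⟩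
  have hσ0 : ∀ a ∈ Λ, σ a ≠ 0 := by
    intro a ha h0
    apply hnotpar a ha
    by_cases hca : c a = 0
    · right
      intro p hp
      rw [hL] at hp
      obtain ⟨t, rfl⟩ := hp
      have := hval a ha t
      rw [h0, hca] at this
      simp only [Set.mem_ofPred_eq]; linarith
    · left
      rw [Set.eq_empty_iff_forall_notMem]
      rintro p ⟨hp, hp'⟩
      rw [hL] at hp
      obtain ⟨t, rfl⟩ := hp
      have := hval a ha t
      rw [h0] at this
      simp only [Set.mem_ofPred_eq] at hp'
      apply hca; linarith
  have hH : ∀ a ∈ Λ, ∀ b ∈ Λ, a ≠ b → HH σ c a b ≠ 0 := by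
    intro a ha b hb hab h0
    have h1 := hσ0 a ha
    have h := hdisj a ha b hb hab
    rw [Set.eq_empty_iff_forall_notMem] at h
    refine h _ ⟨hmemL (-(c a) / σ a), ?_, ?_⟩
    · have := hval a ha (-(c a) / σ a)
      have e : σ a * (-(c a) / σ a) + c a = 0 := by field_simp; ring
      simp only; linarith
    · have := hval b hb (-(c a) / σ a)
      have e : σ b * (-(c a) / σ a) + c b = 0 := by
        unfold HH at h0
        field_simp; linarith
      simp only; linarith
  have hC : ∀ s ∈ kCorridors Λ k, s ⊆ Λ ∧ s.card = 3 := by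
    intro s hs
    exact Finset.mem_powersetCard.mp (Finset.mem_filter.mp hs).1
  have hcont : ∀ s ∈ kCorridors Λ k, L ⊆ corridorSet s → LineCont σ c s := by
    intro s hs hLs t
    have hsub := (hC s hs).1
    obtain ⟨⟨a, ha, ha'⟩, ⟨b, hb, hb'⟩⟩ := hLs (hmemL t)
    simp only at ha' hb'
    refine ⟨⟨a, ha, ?_⟩, ⟨b, hb, ?_⟩⟩
    · rw [← hval a (hsub ha)]; linarith
    · rw [← hval b (hsub hb)]; linarith
  have hlow : (2:ℤ) * ((kCorridors Λ k).filter fun s => L ⊆ corridorSet s).card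
      ≤ ∑ s ∈ kCorridors Λ k, GG σ c s := by
    rw [Finset.card_filter]
    push_cast
    rw [Finset.mul_sum]
    refine Finset.sum_le_sum fun s hs => ?_
    have hsub := (hC s hs).1
    have := triple_sum (σ := σ) (c := c) s (hC s hs).2 (fun a ha => hσ0 a (hsub ha))
      (fun a ha b hb => hH a (hsub ha) b (hsub hb))
    split_ifs with h
    · simpa using this.2 (hcont s hs h)
    · simpa using this.1
  have hup : ∑ s ∈ kCorridors Λ k, GG σ c s
      ≤ 2 * ((∑ a ∈ Λ, ∑ b ∈ Λ, if 0 < σ a ∧ σ b < 0 then (1 : ℕ) else 0 : ℕ) : ℤ) := by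
    rw [double_count σ c Λ _ hC]
    push_cast
    rw [Finset.mul_sum]
    refine Finset.sum_le_sum fun a ha => ?_
    rw [Finset.mul_sum]
    refine Finset.sum_le_sum fun b hb => ?_
    by_cases hab : 0 < σ a ∧ σ b < 0
    · rw [if_pos hab, if_pos hab]
      exact (le_abs_self _).trans (edge_bound Λ k hΛ α β δ (fun a ha => hc a ha) q1 q2 q3 v1 v2 v3
        σ c (fun _ => rfl) (fun _ => rfl) a b ha hb hab.1 hab.2)
    · rw [if_neg hab, if_neg hab]; simp
  have hpc := pair_count σ Λ n hn
  refine le_trans ?_ hpc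
  have := hlow.trans hup
  exact_mod_cast (mul_le_mul_iff_right₀ (by norm_num : (0:ℤ) < 2)).mp this
end
end
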